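/- arXiv:2405.19810 — 3 statements merged into one kernel-verified Lean document; each statement's English description precedes it below -/
import Mathlib

section
/- For every integer e ≥ 3, letting t = ⌈3 + 3√e⌉, for every integer m ≥ binom(e+t, t), every numerical monoid Γ with embedding dimension e+1 and multiplicity m satisfies ρ(Γ) < 𝒞(e,m). (In particular, for each fixed e ≥ 3 one has 𝒭(e,m) < 𝒞(e,m) for all m ≫ 0.) -/
open scoped Pointwise

/-- A numerical monoid: an additive submonoid of ℕ with finite complement. -/
def IsNumericalMonoid (Γ : AddSubmonoid ℕ) : Prop :=
  ((Γ : Set ℕ)ᶜ).Finite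

/-- The (unique) minimal generating set of a submonoid of ℕ: the nonzero elements
that are not sums of two nonzero elements. -/
def minGens (Γ : AddSubmonoid ℕ) : Set ℕ :=
  {g | g ∈ Γ ∧ g ≠ 0 ∧ ∀ a ∈ Γ, ∀ b ∈ Γ, a ≠ 0 → b ≠ 0 → g ≠ a + b}

/-- Embedding dimension: the number of minimal generators. -/
noncomputable def edim (Γ : AddSubmonoid ℕ) : ℕ :=
  (minGens Γ).ncard

/-- Multiplicity: the smallest nonzero element. -/
noncomputable def mult (Γ : AddSubmonoid ℕ) : ℕ :=
  sInf {g : ℕ | g ∈ Γ ∧ g ≠ 0}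

/-- The factorization homomorphism φ, sending a formal ℕ-combination of the minimal
generators to its value in ℕ. -/
noncomputable def factorizationHom (Γ : AddSubmonoid ℕ) : (minGens Γ →₀ ℕ) →+ ℕ :=
  Finsupp.liftAddHom fun g => AddMonoidHom.mulLeft (g : ℕ)

/-- The number of minimal relations ρ(Γ): the least cardinality of a set of pairs
generating the kernel congruence of the factorization homomorphism. -/
noncomputable def rho (Γ : AddSubmonoid ℕ) : ℕ :=
  sInf {n : ℕ | ∃ R : Set ((minGens Γ →₀ ℕ) × (minGens Γ →₀ ℕ)),
    R.Finite ∧ R.ncard = n ∧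
    addConGen (fun a b => (a, b) ∈ R) = AddCon.ker (factorizationHom Γ)}

/-- Pseudo-Frobenius numbers of Γ. -/
def pseudoFrobenius (Γ : AddSubmonoid ℕ) : Set ℕ :=
  {p | p ∉ Γ ∧ ∀ g ∈ Γ, g ≠ 0 → p + g ∈ Γ}

/-- The type of Γ: the number of pseudo-Frobenius numbers. -/
noncomputable def numType (Γ : AddSubmonoid ℕ) : ℕ :=
  (pseudoFrobenius Γ).ncard

/-- The Apéry set of Γ with respect to its multiplicity. -/
def aperySet (Γ : AddSubmonoid ℕ) : Set ℕ :=
  {g | g ∈ Γ ∧ ¬ ∃ γ ∈ Γ, g = γ + mult Γ}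

/-- The Macaulay upper function: if `n = C(n_d,d) + ⋯ + C(n_j,j)` is the Macaulay
expansion of `n`, then `macUpper d n = C(n_d+1,d+1) + ⋯ + C(n_j+1,j+1)`, i.e. `n^⟨d⟩`. -/
noncomputable def macUpper : ℕ → ℕ → ℕ
  | 0, _ => 0
  | d + 1, n =>
    if n = 0 then 0
    else
      Nat.choose (sSup {a : ℕ | Nat.choose a (d + 1) ≤ n} + 1) (d + 2) +
        macUpper d (n - Nat.choose (sSup {a : ℕ | Nat.choose a (d + 1) ≤ n}) (d + 1))

/-- The Macaulay lower function: if `n = C(n_d,d) + ⋯ + C(n_j,j)` is the Macaulay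
expansion of `n`, then `macLower d n = C(n_d-1,d) + ⋯ + C(n_j-1,j)`, i.e. `n_⟨d⟩`. -/
noncomputable def macLower : ℕ → ℕ → ℕ
  | 0, _ => 0
  | d + 1, n =>
    if n = 0 then 0
    else
      Nat.choose (sSup {a : ℕ | Nat.choose a (d + 1) ≤ n} - 1) (d + 1) +
        macLower d (n - Nat.choose (sSup {a : ℕ | Nat.choose a (d + 1) ≤ n}) (d + 1))

/-- The unique positive `r` with `C(e+r-1,r-1) ≤ m < C(e+r,r)`. -/
noncomputable def macR (e m : ℕ) : ℕ :=
  sInf {r : ℕ | 0 < r ∧ m < Nat.choose (e + r) r}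

/-- The bound 𝒞(e,m) = C(e+r-1,r) + s^⟨r⟩ - s, where s = m - C(e+r-1,r-1). -/
noncomputable def mathcalC (e m : ℕ) : ℕ :=
  Nat.choose (e + macR e m - 1) (macR e m) +
      macUpper (macR e m) (m - Nat.choose (e + macR e m - 1) (macR e m - 1)) -
    (m - Nat.choose (e + macR e m - 1) (macR e m - 1))

/-- The bound 𝒟(e,m) = C(e+r-2,r-1) + s_⟨r⟩, where s = m - C(e+r-1,r-1). -/
noncomputable def mathcalD (e m : ℕ) : ℕ :=
  Nat.choose (e + macR e m - 2) (macR e m - 1) +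
    macLower (macR e m) (m - Nat.choose (e + macR e m - 1) (macR e m - 1))


/-- The monomials all of whose immediate divisors lie in `B`: for a lower set `B`, these are the
elements of `B` together with the minimal elements of the complement of `B`. -/
def extension {e : ℕ} (B : Finset (Fin e → ℕ)) : Finset (Fin e → ℕ) :=
  (insert 0 (Finset.univ.biUnion fun i => B.image (· + Pi.single i 1))).filter
    fun v => ∀ i, 0 < v i → v - Pi.single i 1 ∈ B

lemma sub_single_add_single {e : ℕ} (v : Fin e → ℕ) (i : Fin e) (h : 0 < v i) :
    v - Pi.single i 1 + Pi.single i 1 = v := by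
  funext k
  by_cases hk : k = i
  · subst hk; simp; omega
  · simp [hk]

lemma mem_extension {e : ℕ} {B : Finset (Fin e → ℕ)} {v : Fin e → ℕ} :
    v ∈ extension B ↔ ∀ i, 0 < v i → v - Pi.single i 1 ∈ B := by
  unfold extension
  rw [Finset.mem_filter, and_iff_right_iff_imp]
  intro h
  by_cases hv : v = 0
  · simp [hv]
  · obtain ⟨i, hi⟩ := Function.ne_iff.mp hv
    have hi' : 0 < v i := Nat.pos_of_ne_zero hi
    refine Finset.mem_insert_of_mem (Finset.mem_biUnion.mpr ⟨i, Finset.mem_univ _, ?_⟩)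
    exact Finset.mem_image.mpr ⟨_, h i hi', sub_single_add_single v i hi'⟩

/-- A congruence on a free commutative monoid given by a weight function is generated by at most
one relation for each minimal monomial outside the standard monomials. -/
lemma exists_generating_relations {e m : ℕ} (hm : 0 < m) (g : Fin e → ℕ) {X : Type*}
    [AddCommMonoid X] (ψ : ℕ × (Fin e → ℕ) ≃+ X) (φ : X →+ ℕ)
    (hφ : ∀ c a, φ (ψ (c, a)) = c * m + ∑ i, a i * g i) :
    ∃ B : Finset (Fin e → ℕ), B.Nonempty ∧ B ⊆ extension B ∧
      (∀ a ∈ B, ∀ b ∈ B, (∑ i, a i * g i) % m = (∑ i, b i * g i) % m → a = b) ∧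
      ∃ R : Set (X × X), R.Finite ∧ R.ncard ≤ (extension B \ B).card ∧
        addConGen (fun a b => (a, b) ∈ R) = AddCon.ker φ := by
  classical
  set val : (Fin e → ℕ) → ℕ := fun a => ∑ i, a i * g i with hval
  have val_add : ∀ a b, val (a + b) = val a + val b := by
    intro a b; simp [hval, add_mul, Finset.sum_add_distrib]
  let red : (Fin e → ℕ) → ℕ × (Fin e → ℕ) → Prop := fun a q =>
    val a = q.1 * m + val q.2 ∧ (0 < q.1 ∨ toLex q.2 < toLex a)
  let S : Set (Fin e → ℕ) := {a | ∀ q, ¬ red a q}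
  have hinj : ∀ a ∈ S, ∀ b ∈ S, val a % m = val b % m → a = b := by
    have key : ∀ a ∈ S, ∀ b ∈ S, val a % m = val b % m → val b ≤ val a → a = b := by
      intro a ha b hb hab hle
      obtain ⟨c, hc⟩ : ∃ c, val a = c * m + val b := by
        obtain ⟨c, hc⟩ := (Nat.modEq_iff_dvd' hle).mp hab.symm
        exact ⟨c, by rw [mul_comm]; omega⟩
      rcases Nat.eq_zero_or_pos c with h0 | h0
      · subst h0
        rcases lt_trichotomy (toLex a) (toLex b) with h | h | h
        · exact absurd ⟨by simp [hc], Or.inr h⟩ (hb (0, a))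
        · exact toLex.injective h
        · exact absurd ⟨hc, Or.inr h⟩ (ha (0, b))
      · exact absurd ⟨hc, Or.inl h0⟩ (ha (c, b))
    intro a ha b hb hab
    rcases le_total (val b) (val a) with h | h
    · exact key a ha b hb hab h
    · exact (key b hb a ha hab.symm h).symm
  have hfin : S.Finite := by
    refine Set.Finite.of_finite_image (f := fun a => val a % m) ?_ ?_
    · exact (Set.finite_lt_nat m).subset (by rintro _ ⟨a, -, rfl⟩; exact Nat.mod_lt _ hm)
    · intro a ha b hb hab; exact hinj a ha b hb hab
  set B := hfin.toFinset with hB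
  have memB : ∀ a, a ∈ B ↔ a ∈ S := fun a => by simp [hB]
  have red_add : ∀ a q w, red a q → red (a + w) (q.1, q.2 + w) := by
    rintro a q w ⟨h1, h2⟩
    refine ⟨by simp only [val_add]; omega, h2.imp id fun h => ?_⟩
    exact add_lt_add_left h (toLex w)
  have hlow : B ⊆ extension B := by
    intro v hv
    rw [mem_extension]
    intro i hi
    rw [memB] at hv ⊢
    intro q hq
    have := red_add _ _ (Pi.single i 1) hq
    rw [sub_single_add_single v i hi] at this
    exact hv _ this
  have hred : ∀ v, v ∉ B → ∃ q, red v q := by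
    intro v hv
    rw [memB] at hv
    simpa [S] using hv
  choose! nf hnf using hred
  let rel : (Fin e → ℕ) → X × X := fun v => (ψ (0, v), ψ (nf v))
  let R : Set (X × X) := rel '' ((extension B \ B : Finset _) : Set _)
  refine ⟨B, ⟨0, ?_⟩, hlow, fun a ha b hb => hinj a ((memB a).mp ha) b ((memB b).mp hb), R,
    (Finset.finite_toSet _).image _, ?_, ?_⟩
  · rw [memB]
    rintro ⟨c, a⟩ ⟨h1, h2⟩
    have h0 : val 0 = 0 := by simp [hval]
    rw [h0] at h1
    rcases h2 with h2 | h2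
    · have : 0 < c * m := Nat.mul_pos h2 hm
      simp only at h1; omega
    · exact absurd h2 (not_lt.mpr (Pi.toLex_monotone zero_le))
  · exact (Set.ncard_image_le (Finset.finite_toSet _)).trans (by rw [Set.ncard_coe_finset])
  · set K := addConGen (fun a b => (a, b) ∈ R) with hK
    have hle : K ≤ AddCon.ker φ := by
      rw [hK, AddCon.addConGen_le]
      rintro _ _ ⟨v, hv, hvr⟩
      have hv' : v ∉ B := (Finset.mem_sdiff.mp (Finset.mem_coe.mp hv)).2
      simp only [rel, Prod.mk.injEq] at hvr
      obtain ⟨rfl, rfl⟩ := hvr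
      rw [AddCon.ker_rel, hφ, ← Prod.mk.eta (p := nf v), hφ]
      simpa using (hnf v hv').1
    have hstep : ∀ v ∈ extension B \ B, K (ψ (0, v)) (ψ (nf v)) := fun v hv =>
      AddConGen.Rel.of _ _ ⟨v, hv, rfl⟩
    have hmin : ∀ a, a ∉ B → ∃ v ∈ extension B \ B, v ≤ a := by
      intro a ha
      obtain ⟨v, hva, hv⟩ := exists_minimal_le_of_wellFoundedLT (fun v => v ∉ B) a ha
      refine ⟨v, Finset.mem_sdiff.mpr ⟨?_, hv.prop⟩, hva⟩
      rw [mem_extension]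
      intro i hi
      by_contra hcon
      have := hv.le_of_le hcon (by intro k; simp) i
      simp at this; omega
    have hnorm : ∀ p : ℕ ×ₗ Lex (Fin e → ℕ), ∀ a c, p = toLex (val a, toLex a) →
        ∃ c' b, b ∈ B ∧ K (ψ (c, a)) (ψ (c', b)) := by
      intro p
      induction p using WellFoundedLT.induction with
      | ind p ih =>
        rintro a c rfl
        by_cases ha : a ∈ B
        · exact ⟨c, a, ha, K.refl _⟩
        · obtain ⟨v, hv, hva⟩ := hmin a ha
          have hvB := (Finset.mem_sdiff.mp hv).2
          obtain ⟨w, rfl⟩ := exists_add_of_le hva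
          have hr := red_add v _ w (hnf v hvB)
          obtain ⟨c', b, hb, hcb⟩ := ih (toLex (val ((nf v).2 + w), toLex ((nf v).2 + w))) (by
            rw [Prod.Lex.toLex_lt_toLex]
            rcases hr with ⟨h1, h2⟩
            simp only at h1 h2 ⊢
            rcases Nat.eq_zero_or_pos (nf v).1 with h0 | h0
            · right
              rw [h0] at h1 h2
              exact ⟨by omega, by simpa using h2⟩
            · left
              have : 0 < (nf v).1 * m := Nat.mul_pos h0 hm
              omega) ((nf v).2 + w) (c + (nf v).1) rfl
          refine ⟨c', b, hb, K.trans ?_ hcb⟩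
          have h := K.add (hstep v hv) (K.refl (ψ (c, w)))
          rw [← map_add, ← map_add] at h
          convert h using 2
          · simp
          · ext <;> simp [add_comm]
    refine le_antisymm hle ?_
    intro x y hxy
    obtain ⟨⟨c, a⟩, rfl⟩ := ψ.surjective x
    obtain ⟨⟨c', a'⟩, rfl⟩ := ψ.surjective y
    obtain ⟨d, b, hb, hab⟩ := hnorm _ a c rfl
    obtain ⟨d', b', hb', hab'⟩ := hnorm _ a' c' rfl
    have h1 : φ (ψ (d, b)) = φ (ψ (d', b')) := by
      have e1 := hle hab
      have e2 := hle hab'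
      rw [AddCon.ker_rel] at e1 e2 hxy
      rw [← e1, ← e2, hxy]
    rw [hφ, hφ] at h1
    have hbb : b = b' := by
      refine hinj b ((memB b).mp hb) b' ((memB b').mp hb') ?_
      have := congrArg (· % m) h1
      simpa [Nat.add_mod, hval] using this
    subst hbb
    have hd : d = d' := by
      have : d * m = d' * m := by omega
      exact Nat.eq_of_mul_eq_mul_right hm this
    subst hd
    exact K.trans hab (K.symm hab')

lemma exists_standard_monomials {e m : ℕ} (hm : 0 < m) (Γ : AddSubmonoid ℕ)
    (hedim : edim Γ = e + 1) (hmult : mult Γ = m) :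
    ∃ (g : Fin e → ℕ) (B : Finset (Fin e → ℕ)), B.Nonempty ∧ B ⊆ extension B ∧
      (∀ a ∈ B, ∀ b ∈ B, (∑ i, a i * g i) % m = (∑ i, b i * g i) % m → a = b) ∧
      rho Γ ≤ (extension B \ B).card := by
  classical
  have hmem : m ∈ {g : ℕ | g ∈ Γ ∧ g ≠ 0} := by
    rw [← hmult]
    refine Nat.sInf_mem (Set.nonempty_iff_ne_empty.mpr fun h => ?_)
    rw [mult, h, Nat.sInf_empty] at hmult
    omega
  have hgen : m ∈ minGens Γ := by
    refine ⟨hmem.1, hmem.2, fun a ha b hb ha0 hb0 hab => ?_⟩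
    have : m ≤ a := by rw [← hmult]; exact Nat.sInf_le ⟨ha, ha0⟩
    omega
  have hfin : (minGens Γ).Finite := Set.finite_of_ncard_ne_zero (by
    have : (minGens Γ).ncard = e + 1 := hedim
    omega)
  have : Fintype (minGens Γ) := hfin.fintype
  have hcard : Fintype.card (minGens Γ) = e + 1 := by
    rw [← hedim, edim, Set.ncard_eq_toFinset_card', Set.toFinset_card]
  obtain ⟨ε, hε⟩ : ∃ ε : Fin (e + 1) ≃ minGens Γ, ε 0 = ⟨m, hgen⟩ := by
    let ε₀ := (Fintype.equivFinOfCardEq hcard).symm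
    exact ⟨(Equiv.swap (ε₀.symm ⟨m, hgen⟩) 0).trans ε₀, by simp⟩
  let ψ₀ : (ℕ × (Fin e → ℕ)) ≃ (minGens Γ →₀ ℕ) :=
    (Fin.consEquiv fun _ : Fin (e + 1) => ℕ).trans
      ((Equiv.arrowCongr ε (Equiv.refl ℕ)).trans Finsupp.equivFunOnFinite.symm)
  have hψ₀ : ∀ p x, ψ₀ p x = (Fin.cons p.1 p.2 : Fin (e + 1) → ℕ) (ε.symm x) := fun p x => rfl
  let ψ : (ℕ × (Fin e → ℕ)) ≃+ (minGens Γ →₀ ℕ) :=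
    { ψ₀ with
      map_add' := by
        intro p q
        ext x
        change ψ₀ (p + q) x = ψ₀ p x + ψ₀ q x
        simp only [hψ₀]
        refine Fin.cases ?_ (fun i => ?_) (ε.symm x) <;> simp }
  have hψ : ∀ p x, ψ p x = (Fin.cons p.1 p.2 : Fin (e + 1) → ℕ) (ε.symm x) := hψ₀
  let g : Fin e → ℕ := fun i => ε i.succ
  obtain ⟨B, hB0, hB1, hB2, R, hR1, hR2, hR3⟩ :=
    exists_generating_relations hm g ψ (factorizationHom Γ) (by
      intro c a
      rw [factorizationHom, Finsupp.liftAddHom_apply, Finsupp.sum_fintype _ _ (by simp),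
        ← ε.sum_comp, Fin.sum_univ_succ]
      simp only [hψ, Equiv.symm_apply_apply, Fin.cons_zero, Fin.cons_succ]
      simp [hε, g, mul_comm])
  have hrho : rho Γ ≤ R.ncard := Nat.sInf_le ⟨R, hR1, rfl, hR3⟩
  exact ⟨g, B, hB0, hB1, hB2, hrho.trans hR2⟩
/-- The label of the line through `u` in direction `e_i - e_j`. -/
def lineLabel {e : ℕ} (i j : Fin e) (u : Fin e → ℕ) : Fin e → ℕ :=
  Function.update (Function.update u i (u i + u j)) j 0

/-- The number of elements of `B` on the line through `u` in direction `e_i - e_j`. -/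
def lineCount {e : ℕ} (i j : Fin e) (B : Finset (Fin e → ℕ)) (u : Fin e → ℕ) : ℕ :=
  (B.filter fun w => lineLabel i j w = lineLabel i j u).card

/-- The compression of `B`: on each line in direction `e_i - e_j`, the elements of `B` are replaced
by as many elements with smallest possible `j`-th coordinate. -/
def compress {e : ℕ} (i j : Fin e) (B : Finset (Fin e → ℕ)) : Finset (Fin e → ℕ) :=
  (B.biUnion fun w => (Finset.range (w i + w j + 1)).image fun b =>
    Function.update (Function.update w i (w i + w j - b)) j b).filter
      fun u => u j < lineCount i j B u

section Compression

variable {e : ℕ} {i j : Fin e}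

lemma lineLabel_eq_iff (hij : i ≠ j) {u w : Fin e → ℕ} :
    lineLabel i j u = lineLabel i j w ↔
      u i + u j = w i + w j ∧ ∀ k, k ≠ i → k ≠ j → u k = w k := by
  constructor
  · intro h
    refine ⟨by simpa [lineLabel, hij] using congrFun h i, fun k hi hj => ?_⟩
    simpa [lineLabel, hi, hj] using congrFun h k
  · rintro ⟨h1, h2⟩
    funext k
    by_cases hj : k = j
    · subst hj; simp [lineLabel]
    · by_cases hi : k = i
      · subst hi; simp [lineLabel, hj, h1]
      · simp [lineLabel, hi, hj, h2 k hi hj]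

lemma eq_of_lineLabel_eq (hij : i ≠ j) {u w : Fin e → ℕ}
    (h : lineLabel i j u = lineLabel i j w) (hj : u j = w j) : u = w := by
  rw [lineLabel_eq_iff hij] at h
  funext k
  by_cases hkj : k = j
  · rw [hkj, hj]
  · by_cases hki : k = i
    · rw [hki]; omega
    · exact h.2 k hki hkj

lemma exists_on_line (hij : i ≠ j) (w : Fin e → ℕ) {b : ℕ} (hb : b ≤ w i + w j) :
    ∃ u, lineLabel i j u = lineLabel i j w ∧ u j = b := by
  refine ⟨Function.update (Function.update w i (w i + w j - b)) j b, ?_, by simp⟩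
  rw [lineLabel_eq_iff hij]
  refine ⟨by simp [hij]; omega, fun k hi hj => by simp [hi, hj]⟩

lemma lineCount_eq_card_image (hij : i ≠ j) (B : Finset (Fin e → ℕ)) (u : Fin e → ℕ) :
    lineCount i j B u =
      ((B.filter fun w => lineLabel i j w = lineLabel i j u).image (· j)).card := by
  rw [lineCount, Finset.card_image_of_injOn]
  intro x hx y hy hxy
  simp only [Finset.coe_filter, Set.mem_ofPred_eq] at hx hy
  exact eq_of_lineLabel_eq hij (hx.2.trans hy.2.symm) hxy

lemma lineCount_le (hij : i ≠ j) (B : Finset (Fin e → ℕ)) (u : Fin e → ℕ) :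
    lineCount i j B u ≤ u i + u j + 1 := by
  rw [lineCount_eq_card_image hij]
  refine (Finset.card_le_card (t := Finset.range (u i + u j + 1)) ?_).trans (by simp)
  intro b hb
  obtain ⟨x, hx, rfl⟩ := Finset.mem_image.mp hb
  have := ((lineLabel_eq_iff hij).mp (Finset.mem_filter.mp hx).2).1
  simp only [Finset.mem_range]
  omega

lemma lineCount_congr (B : Finset (Fin e → ℕ)) {u w : Fin e → ℕ}
    (h : lineLabel i j u = lineLabel i j w) : lineCount i j B u = lineCount i j B w := by
  rw [lineCount, lineCount, h]

lemma mem_compress (hij : i ≠ j) {B : Finset (Fin e → ℕ)} {u : Fin e → ℕ} :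
    u ∈ compress i j B ↔ u j < lineCount i j B u := by
  rw [compress, Finset.mem_filter, and_iff_right_iff_imp]
  intro h
  obtain ⟨w, hw⟩ := Finset.card_pos.mp (Nat.zero_lt_of_lt h)
  rw [Finset.mem_filter] at hw
  have hl := (lineLabel_eq_iff hij).mp hw.2
  refine Finset.mem_biUnion.mpr ⟨w, hw.1, Finset.mem_image.mpr ⟨u j, ?_, ?_⟩⟩
  · simp only [Finset.mem_range]; omega
  · funext k
    by_cases hkj : k = j
    · subst hkj; simp
    · by_cases hki : k = i
      · subst hki; simp [hij]; omega
      · simp [hki, hkj, hl.2 k hki hkj]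

lemma lineCount_compress (hij : i ≠ j) (B : Finset (Fin e → ℕ)) (u : Fin e → ℕ) :
    lineCount i j (compress i j B) u = lineCount i j B u := by
  rw [lineCount_eq_card_image hij]
  conv_rhs => rw [← Finset.card_range (lineCount i j B u)]
  congr 1
  ext b
  simp only [Finset.mem_image, Finset.mem_filter, Finset.mem_range, mem_compress hij]
  constructor
  · rintro ⟨x, ⟨hx, hl⟩, rfl⟩
    rwa [lineCount_congr B hl] at hx
  · intro hb
    have := lineCount_le hij B u
    obtain ⟨x, hx, hxb⟩ := exists_on_line hij u (b := b) (by omega)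
    exact ⟨x, ⟨by rw [lineCount_congr B hx, hxb]; exact hb, hx⟩, hxb⟩

lemma card_compress (hij : i ≠ j) (B : Finset (Fin e → ℕ)) :
    (compress i j B).card = B.card := by
  have h : ∀ A : Finset (Fin e → ℕ), A ⊆ B ∪ compress i j B → A.card =
      ∑ l ∈ (B ∪ compress i j B).image (lineLabel i j),
        (A.filter fun w => lineLabel i j w = l).card := fun A hA =>
    Finset.card_eq_sum_card_fiberwise fun x hx => Finset.mem_image_of_mem _ (hA hx)
  rw [h _ Finset.subset_union_right, h _ Finset.subset_union_left]
  refine Finset.sum_congr rfl fun l hl => ?_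
  obtain ⟨u, -, rfl⟩ := Finset.mem_image.mp hl
  exact lineCount_compress hij B u

lemma min_card_le_card_of_shadow {D : ℕ} {V T : Finset ℕ}
    (h1 : ∀ b ∈ V, b ≤ D → b ∈ T) (h2 : ∀ b, b + 1 ∈ V → b ∈ T) :
    min V.card (D + 1) ≤ T.card := by
  by_cases hT : Finset.range (D + 1) ⊆ T
  · exact (min_le_right _ _).trans (by simpa using Finset.card_le_card hT)
  · obtain ⟨c, hc, hcT⟩ := Finset.not_subset.mp hT
    rw [Finset.mem_range] at hc
    refine (min_le_left _ _).trans (Finset.card_le_card_of_injOn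
      (fun b => if b < c then b else b - 1) ?_ ?_)
    · intro b hb
      have hbV : b ∈ V := hb
      have hbc : b ≠ c := by
        rintro rfl; exact hcT (h1 _ hbV (by omega))
      by_cases hlt : b < c
      · simpa [hlt] using h1 b hbV (by omega)
      · simp only [hlt, if_false]
        exact h2 _ (by rwa [Nat.sub_add_cancel (by omega)])
    · intro b hb b' hb' hbb
      have ne : ∀ x ∈ V, x ≠ c ∧ x ≠ c + 1 := fun x hx =>
        ⟨by rintro rfl; exact hcT (h1 _ hx (by omega)), by rintro rfl; exact hcT (h2 _ hx)⟩
      have := ne b hb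
      have := ne b' hb'
      simp only at hbb
      split_ifs at hbb <;> omega

lemma compress_extension_subset (hij : i ≠ j) (B : Finset (Fin e → ℕ)) :
    compress i j (extension B) ⊆ extension (compress i j B) := by
  intro v hv
  rw [mem_compress hij] at hv
  rw [mem_extension]
  intro k hk
  rw [mem_compress hij]
  by_cases hkk : k = i ∨ k = j
  · have hD : ∃ D, v i + v j = D + 1 := by
      rcases hkk with rfl | rfl
      · exact ⟨v k + v j - 1, by omega⟩
      · exact ⟨v i + v k - 1, by omega⟩
    obtain ⟨D, hD⟩ := hD
    have hline : ∀ x : Fin e → ℕ, lineLabel i j x = lineLabel i j v →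
        ∀ k', k' = i ∨ k' = j → 0 < x k' →
        lineLabel i j (x - Pi.single k' 1) = lineLabel i j (v - Pi.single k 1) := by
      intro x hx k' hk' hxk'
      rw [lineLabel_eq_iff hij] at hx ⊢
      refine ⟨?_, fun l hli hlj => ?_⟩
      · rcases hk' with rfl | rfl <;> rcases hkk with rfl | rfl <;>
          simp [hij, hij.symm] <;> omega
      · have h1 : l ≠ k' := by rcases hk' with rfl | rfl <;> assumption
        have h2 : l ≠ k := by rcases hkk with rfl | rfl <;> assumption
        simp [h1, h2, hx.2 l hli hlj]
    have hmin : min (lineCount i j (extension B) v) (D + 1) ≤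
        lineCount i j B (v - Pi.single k 1) := by
      rw [lineCount_eq_card_image hij, lineCount_eq_card_image hij]
      refine min_card_le_card_of_shadow ?_ ?_
      · intro b hb hbD
        obtain ⟨x, hx, rfl⟩ := Finset.mem_image.mp hb
        rw [Finset.mem_filter, mem_extension] at hx
        have hs := ((lineLabel_eq_iff hij).mp hx.2).1
        have hxi : 0 < x i := by omega
        exact Finset.mem_image.mpr ⟨x - Pi.single i 1, Finset.mem_filter.mpr
          ⟨hx.1 i hxi, hline x hx.2 i (Or.inl rfl) hxi⟩, by simp [hij.symm]⟩
      · intro b hb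
        obtain ⟨x, hx, hxb⟩ := Finset.mem_image.mp hb
        rw [Finset.mem_filter, mem_extension] at hx
        have hxj : 0 < x j := by omega
        exact Finset.mem_image.mpr ⟨x - Pi.single j 1, Finset.mem_filter.mpr
          ⟨hx.1 j hxj, hline x hx.2 j (Or.inr rfl) hxj⟩, by simp at hxb ⊢; omega⟩
    rcases hkk with rfl | rfl
    · have : (v - Pi.single k 1 : Fin e → ℕ) j = v j := by simp [hij.symm]
      rw [this]; omega
    · have : (v - Pi.single k 1 : Fin e → ℕ) k = v k - 1 := by simp
      rw [this]; omega
  · push Not at hkk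
    have h0 : (v - Pi.single k 1 : Fin e → ℕ) j = v j := by simp [hkk.2.symm]
    rw [h0]
    refine hv.trans_le (Finset.card_le_card_of_injOn (· - Pi.single k 1) ?_ ?_)
    · intro x hx
      rw [Finset.coe_filter, Set.mem_ofPred_eq, mem_extension, lineLabel_eq_iff hij] at hx
      have hxk : x k = v k := hx.2.2 k hkk.1 hkk.2
      rw [Finset.coe_filter, Set.mem_ofPred_eq, lineLabel_eq_iff hij]
      refine ⟨hx.1 k (by omega), ?_, fun l hli hlj => ?_⟩
      · simpa [hkk.1.symm, hkk.2.symm] using hx.2.1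
      · simp [hx.2.2 l hli hlj]
    · intro x hx y hy hxy
      rw [Finset.coe_filter, Set.mem_ofPred_eq, lineLabel_eq_iff hij] at hx hy
      have hxk : x k = v k := hx.2.2 k hkk.1 hkk.2
      have hyk : y k = v k := hy.2.2 k hkk.1 hkk.2
      rw [← sub_single_add_single x k (by omega), ← sub_single_add_single y k (by omega)]
      exact congrArg (· + Pi.single k 1) hxy

lemma sum_compress_lt (hij : i ≠ j) {B : Finset (Fin e → ℕ)} (hB : compress i j B ≠ B)
    (f : (Fin e → ℕ) → ℕ)
    (hf : ∀ u w, lineLabel i j u = lineLabel i j w → u j < w j → f u < f w) :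
    ∑ u ∈ compress i j B, f u < ∑ u ∈ B, f u := by
  set C := compress i j B with hC
  rw [← Finset.sum_sdiff_lt_sum_sdiff]
  set L := (B ∪ C).image (lineLabel i j) with hL
  have maps : ∀ A ⊆ B ∪ C, ∀ x ∈ A, lineLabel i j x ∈ L := fun A hA x hx =>
    Finset.mem_image_of_mem _ (hA hx)
  have hs1 : C \ B ⊆ B ∪ C := Finset.sdiff_subset.trans Finset.subset_union_right
  have hs2 : B \ C ⊆ B ∪ C := Finset.sdiff_subset.trans Finset.subset_union_left
  rw [← Finset.sum_fiberwise_of_maps_to (maps _ hs1),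
    ← Finset.sum_fiberwise_of_maps_to (maps _ hs2)]
  have hcard : ∀ u, ((C \ B).filter fun w => lineLabel i j w = lineLabel i j u).card =
      ((B \ C).filter fun w => lineLabel i j w = lineLabel i j u).card := by
    intro u
    have h := lineCount_compress hij B u
    rw [lineCount, lineCount, ← hC] at h
    have h' := Finset.card_sdiff_add_card_inter
      (C.filter fun w => lineLabel i j w = lineLabel i j u)
      (B.filter fun w => lineLabel i j w = lineLabel i j u)
    have h'' := Finset.card_sdiff_add_card_inter
      (B.filter fun w => lineLabel i j w = lineLabel i j u)
      (C.filter fun w => lineLabel i j w = lineLabel i j u)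
    rw [Finset.inter_comm] at h''
    have e1 : ∀ A A' : Finset (Fin e → ℕ),
        ((A \ A').filter fun w => lineLabel i j w = lineLabel i j u) =
        (A.filter fun w => lineLabel i j w = lineLabel i j u) \
          (A'.filter fun w => lineLabel i j w = lineLabel i j u) := by
      intro A A'
      ext x
      simp only [Finset.mem_filter, Finset.mem_sdiff]
      tauto
    rw [e1, e1]
    omega
  have hbound : ∀ u,
      (∑ x ∈ (C \ B).filter (fun w => lineLabel i j w = lineLabel i j u), f x) +
        ((B \ C).filter fun w => lineLabel i j w = lineLabel i j u).card ≤
      ∑ x ∈ (B \ C).filter (fun w => lineLabel i j w = lineLabel i j u), f x := by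
    intro u
    set c := ((C \ B).filter fun w => lineLabel i j w = lineLabel i j u).sup f with hc
    have h1 := Finset.sum_le_card_nsmul _ f c (fun x hx => Finset.le_sup (f := f) hx)
    by_cases hne : ((C \ B).filter fun w => lineLabel i j w = lineLabel i j u).Nonempty
    · have h2 := Finset.card_nsmul_le_sum
        ((B \ C).filter fun w => lineLabel i j w = lineLabel i j u) f (c + 1) (by
          intro x hx
          obtain ⟨y, hy, hyc⟩ := Finset.exists_mem_eq_sup _ hne f
          rw [Nat.succ_le_iff, hc, hyc]
          simp only [Finset.mem_filter, Finset.mem_sdiff, hC, mem_compress hij] at hx hy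
          refine hf y x (hy.2.trans hx.2.symm) ?_
          have h3 := hy.1.1
          rw [lineCount_congr B (hy.2.trans hx.2.symm)] at h3
          omega)
      rw [hcard] at h1
      simp only [smul_eq_mul, mul_add, mul_one] at h1 h2
      exact (Nat.add_le_add_right h1 _).trans h2
    · have h0 := hcard u
      rw [Finset.not_nonempty_iff_eq_empty] at hne
      rw [hne] at h0 ⊢
      rw [← h0]
      simp
  have hpos : 0 < (B \ C).card := by
    rw [Finset.card_pos, Finset.sdiff_nonempty]
    exact fun h => hB (Finset.eq_of_subset_of_card_le h (card_compress hij B).le).symm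
  rw [Finset.card_eq_sum_card_fiberwise (maps _ hs2)] at hpos
  have hsum : ∑ l ∈ L, ((∑ x ∈ (C \ B).filter (fun w => lineLabel i j w = l), f x) +
        ((B \ C).filter fun w => lineLabel i j w = l).card) ≤
      ∑ l ∈ L, ∑ x ∈ (B \ C).filter (fun w => lineLabel i j w = l), f x := by
    refine Finset.sum_le_sum fun l hl => ?_
    obtain ⟨u, -, rfl⟩ := Finset.mem_image.mp hl
    exact hbound u
  rw [Finset.sum_add_distrib] at hsum
  omega

/-- `B` is stable if it is closed under replacing a variable by one of larger index. -/
def IsStable (B : Finset (Fin e → ℕ)) : Prop :=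
  ∀ u ∈ B, ∀ i j, j < i → 0 < u j → u - Pi.single j 1 + Pi.single i 1 ∈ B

lemma exists_stable (B : Finset (Fin e → ℕ)) (hB : B ⊆ extension B) :
    ∃ B' : Finset (Fin e → ℕ), B' ⊆ extension B' ∧ IsStable B' ∧ B'.card = B.card ∧
      (extension B).card ≤ (extension B').card ∧
      ∀ u, u ∉ B → ∃ u', u' ∉ B' ∧ ∑ k, u' k = ∑ k, u k := by
  induction hN : ∑ u ∈ B, ∑ k : Fin e, (e - k) * u k
    using Nat.strong_induction_on generalizing B with
  | _ N ih =>
    by_cases hst : ∀ i j, j < i → compress i j B = B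
    · refine ⟨B, hB, fun u hu i j hij huj => ?_, rfl, le_rfl, fun u hu => ⟨u, hu, rfl⟩⟩
      have hne : i ≠ j := hij.ne'
      rw [← hst i j hij, mem_compress hne] at hu ⊢
      rw [lineCount_congr B (w := u)]
      · refine lt_of_le_of_lt ?_ hu
        simp [hne.symm]
      · rw [lineLabel_eq_iff hne]
        refine ⟨by simp [hne, hne.symm]; omega, fun k hki hkj => by simp [hki, hkj]⟩
    · push Not at hst
      obtain ⟨i, j, hij, hne⟩ := hst
      have hij' : i ≠ j := hij.ne'
      have hlt := sum_compress_lt hij' hne (fun u => ∑ k : Fin e, (e - k) * u k) (by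
        intro u w huw hj
        rw [lineLabel_eq_iff hij'] at huw
        have split : ∀ x : Fin e → ℕ, ∑ k : Fin e, (e - k) * x k =
            (e - i) * x i + ((e - j) * x j +
              ∑ k ∈ (Finset.univ.erase i).erase j, (e - k) * x k) := by
          intro x
          rw [Finset.add_sum_erase _ (fun k : Fin e => (e - (k : ℕ)) * x k) (by simp [hij'.symm]),
            Finset.add_sum_erase _ (fun k : Fin e => (e - (k : ℕ)) * x k) (Finset.mem_univ i)]
        simp only [split]
        have hrest : ∑ k ∈ (Finset.univ.erase i).erase j, (e - (k : ℕ)) * u k =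
            ∑ k ∈ (Finset.univ.erase i).erase j, (e - (k : ℕ)) * w k := by
          refine Finset.sum_congr rfl fun k hk => ?_
          simp only [Finset.mem_erase] at hk
          rw [huw.2 k hk.2.1 hk.1]
        rw [hrest]
        obtain ⟨d, hd⟩ : ∃ d, e - (j : ℕ) = e - (i : ℕ) + (d + 1) := by
          have h1 : (j : ℕ) < i := hij
          have h2 := i.isLt
          exact ⟨i - j - 1, by omega⟩
        rw [hd]
        have h1 : (d + 1) * u j < (d + 1) * w j := by gcongr
        have h2 := congrArg (fun t => (e - (i : ℕ)) * t) huw.1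
        simp only [mul_add, add_mul] at h1 h2 ⊢
        omega)
      rw [hN] at hlt
      have hsub := compress_extension_subset hij' B
      obtain ⟨B', h1, h2, h3, h4, h5⟩ := ih _ hlt (compress i j B) (by
        refine Finset.Subset.trans ?_ hsub
        intro u hu
        rw [mem_compress hij'] at hu ⊢
        exact hu.trans_le (Finset.card_le_card (Finset.filter_subset_filter _ hB))) rfl
      refine ⟨B', h1, h2, h3.trans (card_compress hij' B), ?_, fun u hu => ?_⟩
      · refine le_trans ?_ h4
        rw [← card_compress hij' (extension B)]
        exact Finset.card_le_card hsub
      · obtain ⟨u', hu', hl⟩ : ∃ u', u' ∉ compress i j B ∧ lineLabel i j u' = lineLabel i j u := by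
          obtain ⟨u', hl, hu'⟩ := exists_on_line hij' u (b := u i + u j) le_rfl
          refine ⟨u', fun hmem => hu ?_, hl⟩
          rw [mem_compress hij', lineCount_congr B hl, hu', lineCount_eq_card_image hij'] at hmem
          have heq : (B.filter fun w => lineLabel i j w = lineLabel i j u).image (· j) =
              Finset.range (u i + u j + 1) := by
            refine Finset.eq_of_subset_of_card_le (fun b hb => ?_) (by simpa using hmem)
            obtain ⟨x, hx, rfl⟩ := Finset.mem_image.mp hb
            have := ((lineLabel_eq_iff hij').mp (Finset.mem_filter.mp hx).2).1
            simp only [Finset.mem_range]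
            omega
          have hj : u j ∈ Finset.range (u i + u j + 1) := by simp
          rw [← heq] at hj
          obtain ⟨x, hx, hxj⟩ := Finset.mem_image.mp hj
          rw [Finset.mem_filter] at hx
          exact eq_of_lineLabel_eq hij' hx.2 hxj ▸ hx.1
        obtain ⟨u'', h6, h7⟩ := h5 u' hu'
        refine ⟨u'', h6, h7.trans ?_⟩
        rw [lineLabel_eq_iff hij'] at hl
        have split : ∀ x : Fin e → ℕ, ∑ k : Fin e, x k =
            x i + (x j + ∑ k ∈ (Finset.univ.erase i).erase j, x k) := by
          intro x
          rw [Finset.add_sum_erase _ x (by simp [hij'.symm]),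
            Finset.add_sum_erase _ x (Finset.mem_univ i)]
        rw [split, split, ← add_assoc, ← add_assoc, hl.1]
        congr 1
        refine Finset.sum_congr rfl fun k hk => ?_
        simp only [Finset.mem_erase] at hk
        exact hl.2 k hk.2.1 hk.1

end Compression

/-- The elements of `B` involving only the first `k` variables. -/
def restrictVars {e : ℕ} (k : ℕ) (B : Finset (Fin e → ℕ)) : Finset (Fin e → ℕ) :=
  B.filter fun u => ∀ i : Fin e, k ≤ i → u i = 0

section Sections

variable {e : ℕ}

lemma mem_restrictVars {k : ℕ} {B : Finset (Fin e → ℕ)} {u : Fin e → ℕ} :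
    u ∈ restrictVars k B ↔ u ∈ B ∧ ∀ i : Fin e, k ≤ i → u i = 0 := by
  rw [restrictVars, Finset.mem_filter]

lemma mem_of_le {B : Finset (Fin e → ℕ)} (hB : B ⊆ extension B) {u w : Fin e → ℕ} (hu : u ∈ B)
    (hw : w ≤ u) : w ∈ B := by
  induction hN : ∑ i, (u i - w i) generalizing u with
  | zero =>
    have : u = w := by
      funext i
      have h1 : w i ≤ u i := hw i
      have h2 := (Finset.sum_eq_zero_iff.mp hN) i (Finset.mem_univ i)
      omega
    rwa [← this]
  | succ n ih =>
    obtain ⟨i, -, hi⟩ : ∃ i ∈ Finset.univ, u i - w i ≠ 0 := by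
      by_contra! h
      rw [Finset.sum_eq_zero h] at hN
      omega
    refine ih (u := u - Pi.single i 1) (mem_extension.mp (hB hu) i (by omega)) ?_ ?_
    · intro k
      have : w k ≤ u k := hw k
      by_cases hk : k = i
      · subst hk; simp; omega
      · simpa [hk] using this
    · have h1 := Finset.add_sum_erase Finset.univ (fun k => u k - w k) (Finset.mem_univ i)
      have h2 := Finset.add_sum_erase Finset.univ
        (fun k => (u - Pi.single i 1 : Fin e → ℕ) k - w k) (Finset.mem_univ i)
      have h3 : ∑ k ∈ Finset.univ.erase i, ((u - Pi.single i 1 : Fin e → ℕ) k - w k) =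
          ∑ k ∈ Finset.univ.erase i, (u k - w k) :=
        Finset.sum_congr rfl fun k hk => by simp [Finset.ne_of_mem_erase hk]
      simp only [Pi.sub_apply, Pi.single_eq_same] at h1 h2 h3 ⊢
      omega

lemma zero_mem_of_nonempty {B : Finset (Fin e → ℕ)} (hB : B ⊆ extension B) (hne : B.Nonempty) :
    0 ∈ B :=
  mem_of_le hB hne.choose_spec fun _ => Nat.zero_le _

lemma card_extension_sdiff_le {B : Finset (Fin e → ℕ)} (hB : B ⊆ extension B)
    (hne : B.Nonempty) :
    (extension B \ B).card ≤ ∑ k ∈ Finset.range e, (restrictVars k B).card := by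
  rw [Finset.sum_range]
  refine (Finset.card_le_card (t := Finset.univ.biUnion fun k : Fin e =>
    (extension B \ B).filter fun v => 0 < v k ∧ ∀ i, k < i → v i = 0) ?_).trans
      (Finset.card_biUnion_le.trans (Finset.sum_le_sum fun k _ => ?_))
  · intro v hv
    have hv0 : (Finset.univ.filter fun i => 0 < v i).Nonempty := by
      rw [Finset.nonempty_iff_ne_empty]
      intro h0
      rw [Finset.filter_eq_empty_iff] at h0
      have : v = 0 := funext fun i => by simpa using h0 (Finset.mem_univ i)
      rw [this] at hv
      exact (Finset.mem_sdiff.mp hv).2 (zero_mem_of_nonempty hB hne)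
    obtain ⟨k, hk, hmax⟩ := Finset.exists_max_image _ id hv0
    refine Finset.mem_biUnion.mpr ⟨k, Finset.mem_univ _, Finset.mem_filter.mpr
      ⟨hv, (Finset.mem_filter.mp hk).2, fun i hi => ?_⟩⟩
    by_contra h
    exact absurd (hmax i (by simpa using Nat.pos_of_ne_zero h)) (not_le.mpr hi)
  · refine Finset.card_le_card_of_injOn (fun v => Function.update v k 0) ?_ ?_
    · intro v hv
      simp only [Finset.coe_filter, Set.mem_ofPred_eq, Finset.mem_sdiff, mem_extension] at hv
      refine mem_restrictVars.mpr ⟨mem_of_le hB (hv.1.1 k hv.2.1) fun i => ?_, fun i hi => ?_⟩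
      · by_cases hik : i = k
        · subst hik; simp
        · simp [hik]
      · by_cases hik : i = k
        · subst hik; simp
        · simpa [hik] using hv.2.2 i (lt_of_le_of_ne hi (Ne.symm hik))
    · have key : ∀ v w : Fin e → ℕ, v ∉ B → w ∈ extension B →
          Function.update v k 0 = Function.update w k 0 → ¬ v k < w k := by
        intro v w hv hw hvw hlt
        refine hv (mem_of_le hB (mem_extension.mp hw k (by omega)) fun i => ?_)
        by_cases hik : i = k
        · subst hik; simp; omega
        · have := congrFun hvw i
          simp only [Function.update_of_ne hik] at this
          simp [hik, this]
      intro v hv w hw hvw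
      simp only [Finset.coe_filter, Set.mem_ofPred_eq, Finset.mem_sdiff] at hv hw
      have h1 := key v w hv.1.2 hw.1.1 hvw
      have h2 := key w v hw.1.2 hv.1.1 hvw.symm
      funext i
      by_cases hik : i = k
      · subst hik; omega
      · have := congrFun hvw i
        simpa only [Function.update_of_ne hik] using this

end Sections

/-- The degree-lexicographic key of an exponent vector. -/
noncomputable def monomialKey {e : ℕ} (u : Fin e → ℕ) : ℕ ×ₗ Lex (Fin e → ℕ) :=
  toLex (∑ i, u i, toLex u)

/-- `O` is an initial segment, in the degree-lexicographic order, of the monomials in the first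
`k` variables. -/
def IsInitialSegment {e : ℕ} (k : ℕ) (O : Finset (Fin e → ℕ)) : Prop :=
  (∀ u ∈ O, ∀ i : Fin e, k ≤ i → u i = 0) ∧
    ∀ u ∈ O, ∀ v : Fin e → ℕ, (∀ i : Fin e, k ≤ i → v i = 0) → monomialKey v ≤ monomialKey u →
      v ∈ O

/-- `B` is closed under replacing a variable by one of larger index less than `k`. -/
def IsStableBelow {e : ℕ} (k : ℕ) (B : Finset (Fin e → ℕ)) : Prop :=
  ∀ u ∈ B, ∀ i j : Fin e, j < i → i < k → 0 < u j → u - Pi.single j 1 + Pi.single i 1 ∈ B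

/-- The quotient of `A` by the `t`-th power of the `j`-th variable. -/
def colon {e : ℕ} (j : Fin e) (t : ℕ) (A : Finset (Fin e → ℕ)) : Finset (Fin e → ℕ) :=
  (A.filter fun u => t ≤ u j).image (· - Pi.single j t)

section Comparison

variable {e : ℕ}

lemma monomialKey_add (u v : Fin e → ℕ) :
    monomialKey (u + v) = monomialKey u + monomialKey v := by
  simp only [monomialKey, Pi.add_apply, Finset.sum_add_distrib]
  rfl

lemma monomialKey_injective : Function.Injective (monomialKey (e := e)) := fun _ _ h =>
  (Prod.ext_iff.mp (toLex.injective h)).2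

lemma monomialKey_lt_iff {u v : Fin e → ℕ} : monomialKey u < monomialKey v ↔
    ∑ i, u i < ∑ i, v i ∨
      ∑ i, u i = ∑ i, v i ∧ ∃ i, (∀ j < i, u j = v j) ∧ u i < v i :=
  Prod.Lex.toLex_lt_toLex

lemma sum_le_of_monomialKey_le {u v : Fin e → ℕ} (h : monomialKey u ≤ monomialKey v) :
    ∑ i, u i ≤ ∑ i, v i := by
  rcases h.lt_or_eq with h | h
  · rcases monomialKey_lt_iff.mp h with h | h
    · exact h.le
    · exact h.1.le
  · rw [monomialKey_injective h]

lemma sub_single_add_single_of_le (v : Fin e → ℕ) (i : Fin e) {t : ℕ} (h : t ≤ v i) :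
    v - Pi.single i t + Pi.single i t = v := by
  funext k
  by_cases hk : k = i
  · subst hk; simp; omega
  · simp [hk]

lemma mem_colon {j : Fin e} {t : ℕ} {A : Finset (Fin e → ℕ)} {w : Fin e → ℕ} :
    w ∈ colon j t A ↔ w + Pi.single j t ∈ A := by
  simp only [colon, Finset.mem_image, Finset.mem_filter]
  constructor
  · rintro ⟨u, ⟨hu, ht⟩, rfl⟩
    rwa [sub_single_add_single_of_le u j ht]
  · exact fun h => ⟨_, ⟨h, by simp⟩, by simp⟩

lemma card_colon (j : Fin e) (t : ℕ) (A : Finset (Fin e → ℕ)) :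
    (colon j t A).card = (A.filter fun u => t ≤ u j).card := by
  refine Finset.card_image_of_injOn fun u hu v hv huv => ?_
  simp only [Finset.coe_filter, Set.mem_ofPred_eq] at hu hv
  rw [← sub_single_add_single_of_le u j hu.2, ← sub_single_add_single_of_le v j hv.2]
  exact congrArg (· + Pi.single j t) huv

lemma colon_mono (j : Fin e) (t : ℕ) {A A' : Finset (Fin e → ℕ)} (h : A ⊆ A') :
    colon j t A ⊆ colon j t A' := fun _ hu => mem_colon.mpr (h (mem_colon.mp hu))

lemma colon_succ (j : Fin e) (t : ℕ) (A : Finset (Fin e → ℕ)) :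
    colon j (t + 1) A = colon j 1 (colon j t A) := by
  ext u
  rw [mem_colon, mem_colon, mem_colon, add_assoc, ← Pi.single_add, add_comm t]

lemma colon_subset_extension {j : Fin e} {t : ℕ} {B : Finset (Fin e → ℕ)}
    (hB : B ⊆ extension B) : colon j t B ⊆ extension (colon j t B) := by
  intro u hu
  rw [mem_extension]
  intro i hi
  rw [mem_colon] at hu ⊢
  refine mem_of_le hB hu (add_le_add_left ?_ _)
  exact fun k => Nat.sub_le _ _

lemma IsStableBelow.colon {k : ℕ} {j : Fin e} {t : ℕ} {B : Finset (Fin e → ℕ)}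
    (hB : IsStableBelow k B) : IsStableBelow k (colon j t B) := by
  intro u hu i i' hii hik hpos
  rw [mem_colon] at hu ⊢
  have := hB _ hu i i' hii hik (by simp; omega)
  convert this using 1
  funext l
  by_cases hl : l = i'
  · subst hl; simp [hii.ne]; omega
  · simp [hl]; omega

lemma vanish_of_mem_colon {k : ℕ} {j : Fin e} {t : ℕ} {A : Finset (Fin e → ℕ)}
    (hA : ∀ u ∈ A, ∀ i : Fin e, k ≤ i → u i = 0) :
    ∀ u ∈ colon j t A, ∀ i : Fin e, k ≤ i → u i = 0 := by
  intro u hu i hi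
  have := hA _ (mem_colon.mp hu) i hi
  simp only [Pi.add_apply] at this
  omega

lemma IsInitialSegment.colon {k : ℕ} {j : Fin e} (hj : j < k) {t : ℕ} {O : Finset (Fin e → ℕ)}
    (hO : IsInitialSegment k O) : IsInitialSegment k (colon j t O) := by
  refine ⟨vanish_of_mem_colon hO.1, fun u hu v hv hvu => ?_⟩
  rw [mem_colon] at hu ⊢
  refine hO.2 _ hu _ (fun i hi => ?_) ?_
  · have : i ≠ j := by rintro rfl; omega
    simp [hv i hi, this]
  · rw [monomialKey_add, monomialKey_add]
    exact add_le_add_left hvu _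

lemma IsInitialSegment.restrictVars {k l : ℕ} {O : Finset (Fin e → ℕ)}
    (hO : IsInitialSegment k O) (hl : l ≤ k) : IsInitialSegment l (restrictVars l O) := by
  refine ⟨fun u hu => (mem_restrictVars.mp hu).2, fun u hu v hv hvu => ?_⟩
  exact mem_restrictVars.mpr ⟨hO.2 u (mem_restrictVars.mp hu).1 v
    (fun i hi => hv i (hl.trans hi)) hvu, hv⟩

lemma exists_initialSegment {k : ℕ} (hk : 0 < k) (he : k ≤ e) (N : ℕ) :
    ∃ O : Finset (Fin e → ℕ), IsInitialSegment k O ∧ O.card = N := by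
  induction N with
  | zero => exact ⟨∅, ⟨by simp, by simp⟩, rfl⟩
  | succ N ih =>
    obtain ⟨O, hO, hcard⟩ := ih
    set S : Set (Fin e → ℕ) := {u | (∀ i : Fin e, k ≤ i → u i = 0) ∧ u ∉ O} with hS
    have hne : S.Nonempty := by
      let f : ℕ → Fin e → ℕ := fun n => Pi.single ⟨0, by omega⟩ n
      have hf : Function.Injective f := Pi.single_injective (M := fun _ => ℕ) _
      obtain ⟨n, hn⟩ := Set.Infinite.exists_notMem_finset (Set.infinite_range_of_injective hf) O
      obtain ⟨⟨a, rfl⟩, ha⟩ := hn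
      refine ⟨f a, fun i hi => ?_, ha⟩
      have : i ≠ ⟨0, by omega⟩ := fun h => by
        rw [h] at hi; simp at hi; omega
      simp [f, this]
    obtain ⟨u, hu, hmin⟩ := (InvImage.wf (monomialKey (e := e)) wellFounded_lt).has_min S hne
    refine ⟨insert u O, ⟨?_, ?_⟩, by rw [Finset.card_insert_of_notMem hu.2, hcard]⟩
    · intro v hv
      rcases Finset.mem_insert.mp hv with rfl | hv
      · exact hu.1
      · exact hO.1 v hv
    · intro v hv w hw hwv
      rw [Finset.mem_insert] at hv ⊢
      rcases hv with rfl | hv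
      · by_cases hwO : w ∈ O
        · exact Or.inr hwO
        · exact Or.inl (monomialKey_injective
            (hwv.antisymm (not_lt.mp (hmin w ⟨hw, hwO⟩))))
      · exact Or.inr (hO.2 v hv w hw hwv)

lemma IsInitialSegment.subset_of_card_le {k : ℕ} {O O' : Finset (Fin e → ℕ)}
    (hO : IsInitialSegment k O) (hO' : IsInitialSegment k O') (h : O.card ≤ O'.card) :
    O ⊆ O' := by
  by_contra hcon
  obtain ⟨u, hu, hu'⟩ := Finset.not_subset.mp hcon
  have hsub : O' ⊆ O := fun v hv => by
    rcases le_total (monomialKey u) (monomialKey v) with huv | huv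
    · exact absurd (hO'.2 v hv u (hO.1 u hu) huv) hu'
    · exact hO.2 u hu v (hO'.1 v hv) huv
  exact hu' ((Finset.eq_of_subset_of_card_le hsub h) ▸ hu)

lemma monomialKey_le_of_shift {k : ℕ} (hk : k + 1 < e) {w u : Fin e → ℕ} {t : ℕ}
    (hw : ∀ i : Fin e, k + 1 ≤ i → w i = 0) (hu : ∀ i : Fin e, k + 1 ≤ i → u i = 0)
    (h : monomialKey (w + Pi.single ⟨k + 1, hk⟩ t) ≤ monomialKey u) :
    monomialKey (w + Pi.single ⟨k, by omega⟩ t) ≤ monomialKey u := by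
  set a : Fin e := ⟨k + 1, hk⟩ with ha
  set b : Fin e := ⟨k, by omega⟩ with hb
  have hsum : ∀ c : Fin e, ∑ i, (w + Pi.single c t : Fin e → ℕ) i = ∑ i, w i + t := by
    intro c
    simp [Finset.sum_add_distrib]
  by_contra! hlt
  rw [monomialKey_lt_iff, hsum] at hlt
  rcases hlt with hlt | ⟨heq, i, hij, hi⟩
  · have := sum_le_of_monomialKey_le h
    rw [hsum] at this
    omega
  · refine absurd h (not_le.mpr (monomialKey_lt_iff.mpr (Or.inr ⟨by rw [hsum, heq], ?_⟩)))
    rcases lt_trichotomy i b with hib | hib | hib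
    · refine ⟨i, fun j hj => ?_, ?_⟩
      · have := hij j hj
        have h1 : j ≠ b := (hj.trans hib).ne
        have h2 : j ≠ a := by rintro rfl; simp [Fin.lt_def, ha, hb] at hj hib; omega
        simpa [h1, h2] using this
      · have h2 : i ≠ a := by rintro rfl; simp [Fin.lt_def, ha, hb] at hib
        simpa [hib.ne, h2] using hi
    · subst hib
      exfalso
      have h3 : ∑ j, u j < ∑ j, (w + Pi.single b t : Fin e → ℕ) j := by
        refine Finset.sum_lt_sum (fun j _ => ?_) ⟨b, Finset.mem_univ _, hi⟩
        rcases lt_trichotomy j b with hj | hj | hj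
        · exact (hij j hj).le
        · subst hj; exact hi.le
        · rw [hu j (by simpa [Fin.lt_def, hb] using hj)]
          exact Nat.zero_le _
      rw [hsum] at h3
      omega
    · have h1 : k + 1 ≤ (i : ℕ) := by simpa [Fin.lt_def, hb] using hib
      simp [hw i h1, hib.ne'] at hi

lemma card_colon_one_add {k : ℕ} (hk : k < e) {A : Finset (Fin e → ℕ)}
    (hA : ∀ u ∈ A, ∀ i : Fin e, k + 1 ≤ i → u i = 0) :
    (colon ⟨k, hk⟩ 1 A).card + (restrictVars k A).card = A.card := by
  rw [card_colon, ← Finset.card_filter_add_card_filter_not (s := A) (fun u => 1 ≤ u ⟨k, hk⟩)]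
  congr 2
  refine Finset.filter_congr fun u hu => ⟨fun h => ?_, fun h i hi => ?_⟩
  · simp [h ⟨k, hk⟩ le_rfl]
  · rcases hi.lt_or_eq with hlt | heq
    · exact hA u hu i hlt
    · have : i = ⟨k, hk⟩ := Fin.ext heq.symm
      subst this
      omega

/-- Among stable lower sets of at most a given size, initial segments have the largest
sections. -/
lemma card_restrictVars_le {k : ℕ} (hk : k < e) {B O : Finset (Fin e → ℕ)}
    (hB : B ⊆ extension B) (hBk : ∀ u ∈ B, ∀ i : Fin e, k + 1 ≤ i → u i = 0)
    (hst : IsStableBelow (k + 1) B) (hO : IsInitialSegment (k + 1) O) (hcard : B.card ≤ O.card) :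
    (restrictVars k B).card ≤ (restrictVars k O).card := by
  induction k generalizing B O with
  | zero =>
    have hzero : restrictVars 0 B ⊆ {0} := fun u hu => by
      rw [mem_restrictVars] at hu
      exact Finset.mem_singleton.mpr (funext fun i => hu.2 i (Nat.zero_le _))
    rcases B.eq_empty_or_nonempty with rfl | hne
    · simp [restrictVars]
    · obtain ⟨u, hu⟩ := Finset.card_pos.mp (lt_of_lt_of_le hne.card_pos hcard)
      refine (Finset.card_le_card hzero).trans (Finset.card_le_card (s := {0}) ?_)
      refine Finset.singleton_subset_iff.mpr (mem_restrictVars.mpr ⟨?_, fun _ _ => rfl⟩)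
      refine hO.2 u hu 0 (fun _ _ => rfl) ?_
      by_contra! hlt
      rcases monomialKey_lt_iff.mp hlt with h | ⟨-, i, -, hi⟩
      · simp at h
      · simp at hi
  | succ k ih =>
    by_contra! hlt
    have hk' : k < e := by omega
    set b : Fin e := ⟨k, hk'⟩ with hb
    set a : Fin e := ⟨k + 1, hk⟩ with ha
    have hba : b < a := by simp [Fin.lt_def, ha, hb]
    set E := restrictVars (k + 1) B with hE
    have hEk : ∀ u ∈ E, ∀ i : Fin e, k + 1 ≤ i → u i = 0 := fun u hu => (mem_restrictVars.mp hu).2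
    have hEB : E ⊆ B := fun u hu => (mem_restrictVars.mp hu).1
    have hEext : E ⊆ extension E := fun u hu => by
      rw [mem_extension]
      intro i hi
      refine mem_restrictVars.mpr ⟨mem_extension.mp (hB (hEB hu)) i hi, fun j hj => ?_⟩
      simp [hEk u hu j hj]
    have hEst : IsStableBelow (k + 1) E := fun u hu i j hij hik hj =>
      mem_restrictVars.mpr ⟨hst u (hEB hu) i j hij (by omega) hj, fun l hl => by
        have h1 : l ≠ i := by rintro rfl; omega
        simp [hEk u hu l hl, h1]⟩
    obtain ⟨O', hO', hcard'⟩ := exists_initialSegment (Nat.succ_pos k) hk' E.card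
    have hcolon : ∀ t, (colon b t O').card ≤ (colon b t E).card := by
      intro t
      induction t with
      | zero => simpa [card_colon] using hcard'.le
      | succ t iht =>
        obtain ⟨P, hP, hPcard⟩ := exists_initialSegment (Nat.succ_pos k) hk' (colon b t E).card
        have hOt := hO'.colon (j := b) (Nat.lt_succ_self k) (t := t)
        have hsub := hOt.subset_of_card_le hP (iht.trans hPcard.ge)
        have hEt := vanish_of_mem_colon (j := b) (t := t) hEk
        have h1 := ih hk' (colon_subset_extension hEext) hEt hEst.colon hP hPcard.ge
        have h2 := card_colon_one_add hk' hEt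
        have h3 := card_colon_one_add hk' hP.1
        have h4 := Finset.card_le_card (colon_mono b 1 hsub)
        rw [colon_succ b t O', colon_succ b t E]
        rw [← hb] at h2 h3
        omega
    set D := O'.sup fun u => ∑ i, u i with hD
    set H : Finset (Fin e → ℕ) := (Finset.Iic fun _ => D).filter fun v =>
      (∀ i : Fin e, k + 2 ≤ i → v i = 0) ∧ ∃ u ∈ O', monomialKey v ≤ monomialKey u with hH
    have mem_H : ∀ v, v ∈ H ↔ (∀ i : Fin e, k + 2 ≤ i → v i = 0) ∧
        ∃ u ∈ O', monomialKey v ≤ monomialKey u := by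
      intro v
      rw [hH, Finset.mem_filter, and_iff_right_iff_imp]
      rintro ⟨-, u, hu, hvu⟩
      rw [Finset.mem_Iic]
      intro i
      exact (Finset.single_le_sum (f := v) (fun _ _ => Nat.zero_le _) (Finset.mem_univ i)).trans
        ((sum_le_of_monomialKey_le hvu).trans (Finset.le_sup (f := fun u => ∑ i, u i) hu))
    have hOH : O.card < H.card := by
      have hOr := hO.restrictVars (l := k + 1) (by omega)
      have hss := hOr.subset_of_card_le hO' (by omega)
      obtain ⟨p, hp, hp'⟩ := Finset.exists_mem_notMem_of_card_lt_card (hcard'.symm ▸ hlt)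
      have hpO : p ∉ O := fun h => hp' (mem_restrictVars.mpr ⟨h, hO'.1 p hp⟩)
      have hpk : ∀ i : Fin e, k + 2 ≤ i → p i = 0 := fun i hi => hO'.1 p hp i (by omega)
      refine Finset.card_lt_card (Finset.ssubset_iff_subset_ne.mpr ⟨fun u hu => ?_, fun h => ?_⟩)
      · refine (mem_H u).mpr ⟨hO.1 u hu, p, hp, ?_⟩
        by_contra! hpu
        exact hpO (hO.2 u hu p hpk hpu.le)
      · exact hpO (h ▸ (mem_H p).mpr ⟨hpk, p, hp, le_rfl⟩)
    have hHB : H.card ≤ B.card := by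
      set T := (H ∪ B).image (fun u => u a) with hT
      rw [Finset.card_eq_sum_card_fiberwise (s := H) (f := fun u => u a) (t := T)
          (fun u hu => Finset.mem_image_of_mem _ (Finset.mem_union_left _ hu)),
        Finset.card_eq_sum_card_fiberwise (s := B) (f := fun u => u a) (t := T)
          (fun u hu => Finset.mem_image_of_mem _ (Finset.mem_union_right _ hu))]
      refine Finset.sum_le_sum fun t _ => ?_
      refine le_trans ?_ ((hcolon t).trans ?_)
      · refine Finset.card_le_card_of_injOn (fun u => u - Pi.single a t) (fun u hu => ?_) ?_
        · simp only [Finset.coe_filter, Set.mem_ofPred_eq, mem_H] at hu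
          obtain ⟨⟨huk, v, hv, huv⟩, hut⟩ := hu
          have hw : ∀ i : Fin e, k + 1 ≤ i → (u - Pi.single a t : Fin e → ℕ) i = 0 := by
            intro i hi
            by_cases hia : i = a
            · subst hia; simp [hut]
            · have : (i : ℕ) ≠ k + 1 := fun h => hia (Fin.ext h)
              simp [hia, huk i (by omega)]
          refine mem_colon.mpr (hO'.2 v hv _ (fun i hi => ?_) ?_)
          · have : i ≠ b := by rintro rfl; simp [hb] at hi
            have h0 := hw i hi
            simp only [Pi.sub_apply] at h0
            simp [this, h0]
          · refine monomialKey_le_of_shift hk hw (hO'.1 v hv) ?_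
            rwa [sub_single_add_single_of_le u a hut.ge]
        · intro u hu v hv huv
          simp only [Finset.coe_filter, Set.mem_ofPred_eq] at hu hv
          rw [← sub_single_add_single_of_le u a hu.2.ge, ← sub_single_add_single_of_le v a hv.2.ge]
          exact congrArg (· + Pi.single a t) huv
      · refine Finset.card_le_card_of_injOn (fun u => u + Pi.single a t) (fun u hu => ?_)
          (fun u _ v _ huv => add_right_cancel huv)
        have hua : u a = 0 := vanish_of_mem_colon hEk u hu a (by simp [ha])
        have hstep : ∀ s ≤ t, u + Pi.single b (t - s) + Pi.single a s ∈ B := by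
          intro s
          induction s with
          | zero => exact fun _ => by simpa using hEB (mem_colon.mp hu)
          | succ s ihs =>
            intro hs
            have := hst _ (ihs (by omega)) a b hba (by simp [ha]) (by simp [hba.ne]; omega)
            convert this using 1
            funext l
            by_cases hlb : l = b
            · subst hlb; simp [hba.ne]; omega
            · by_cases hla : l = a
              · rw [hla]; simp [hba.ne']; omega
              · simp [hlb, hla]
        refine Finset.mem_coe.mpr (Finset.mem_filter.mpr ⟨?_, by simp [hua]⟩)
        simpa using hstep t le_rfl
    omega

lemma card_restrictVars_le_of_initialSegment {B O : Finset (Fin e → ℕ)} (hB : B ⊆ extension B)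
    (hst : IsStable B) (hO : IsInitialSegment e O) (hcard : B.card ≤ O.card) {k : ℕ}
    (hk : k ≤ e) : (restrictVars k B).card ≤ (restrictVars k O).card := by
  induction hk using Nat.decreasingInduction with
  | self =>
    have h : ∀ A : Finset (Fin e → ℕ), restrictVars e A = A := fun A =>
      Finset.filter_true_of_mem fun u _ i hi => absurd i.isLt (not_lt.mpr hi)
    rwa [h, h]
  | of_succ k hk ih =>
    have h : ∀ A : Finset (Fin e → ℕ), restrictVars k (restrictVars (k + 1) A) =
        restrictVars k A := fun A => by
      ext u
      simp only [mem_restrictVars, and_assoc, and_congr_right_iff, and_iff_right_iff_imp]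
      exact fun _ h i hi => h i (by omega)
    rw [← h B, ← h O]
    refine card_restrictVars_le hk (fun u hu => ?_) (fun u hu => (mem_restrictVars.mp hu).2)
      (fun u hu i j hij hik hj => ?_) (hO.restrictVars hk) ih
    · rw [mem_restrictVars] at hu
      refine mem_extension.mpr fun i hi => mem_restrictVars.mpr
        ⟨mem_extension.mp (hB hu.1) i hi, fun j hj => ?_⟩
      simp [hu.2 j hj]
    · rw [mem_restrictVars] at hu ⊢
      refine ⟨hst u hu.1 i j hij hj, fun l hl => ?_⟩
      have h1 : l ≠ i := by rintro rfl; omega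
      simp [hu.2 l hl, h1]

end Comparison

section Counting

variable {e : ℕ}

lemma mem_piAntidiag_iff {S : Finset (Fin e)} {d : ℕ} {u : Fin e → ℕ} :
    u ∈ S.piAntidiag d ↔ ∑ i, u i = d ∧ ∀ i ∉ S, u i = 0 := by
  rw [Finset.mem_piAntidiag]
  have h : (∀ i, u i ≠ 0 → i ∈ S) ↔ ∀ i ∉ S, u i = 0 := forall_congr' fun i => not_imp_comm
  rw [h]
  refine and_congr_left fun h0 => ?_
  rw [Finset.sum_subset (Finset.subset_univ S) fun i _ hi => h0 i hi]

lemma card_piAntidiag (S : Finset (Fin e)) (d : ℕ) :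
    (S.piAntidiag d).card = (S.card + d - 1).choose d := by
  rw [← Finset.card_finsuppAntidiag_nat_eq_choose, Finset.finsuppAntidiag, Finset.card_map,
    Finset.card_attach]

lemma sum_choose_add_sub_one (k R : ℕ) :
    ∑ d ∈ Finset.range (R + 1), (k + d - 1).choose d = (k + R).choose R := by
  induction R with
  | zero => simp
  | succ R ih =>
    rw [Finset.sum_range_succ, ih, show k + (R + 1) - 1 = k + R by omega,
      show k + (R + 1) = k + R + 1 by omega, Nat.choose_succ_succ]

/-- The monomials of degree at most `R` in the variables in `S`. -/
def monomialsUpTo (S : Finset (Fin e)) (R : ℕ) : Finset (Fin e → ℕ) :=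
  (Finset.range (R + 1)).biUnion fun d => S.piAntidiag d

lemma mem_monomialsUpTo {S : Finset (Fin e)} {R : ℕ} {u : Fin e → ℕ} :
    u ∈ monomialsUpTo S R ↔ ∑ i, u i ≤ R ∧ ∀ i ∉ S, u i = 0 := by
  simp only [monomialsUpTo, Finset.mem_biUnion, Finset.mem_range, mem_piAntidiag_iff]
  constructor
  · rintro ⟨d, hd, h1, h2⟩
    exact ⟨by omega, h2⟩
  · rintro ⟨h1, h2⟩
    exact ⟨_, by omega, rfl, h2⟩

lemma card_monomialsUpTo (S : Finset (Fin e)) (R : ℕ) :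
    (monomialsUpTo S R).card = (S.card + R).choose R := by
  rw [monomialsUpTo, Finset.card_biUnion]
  · simp only [card_piAntidiag, sum_choose_add_sub_one]
  · intro d _ d' _ hdd
    refine Finset.disjoint_left.mpr fun u hu hu' => hdd ?_
    rw [mem_piAntidiag_iff] at hu hu'
    exact hu.1.symm.trans hu'.1

lemma card_filter_between (p : ℕ) {k : ℕ} (hk : k ≤ e) :
    (Finset.univ.filter fun i : Fin e => p ≤ i ∧ i < k).card = k - p := by
  rw [← Nat.card_Ico, ← Finset.card_image_of_injective _ Fin.val_injective]
  congr 1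
  ext x
  simp only [Finset.mem_image, Finset.mem_filter, Finset.mem_univ, true_and, Finset.mem_Ico]
  exact ⟨fun ⟨i, hi, hx⟩ => hx ▸ hi, fun hx => ⟨⟨x, by omega⟩, hx, rfl⟩⟩

/-- The monomials of degree `d` involving only variables of index at least `p`. -/
def tailMonomials (e p d : ℕ) : Finset (Fin e → ℕ) :=
  (Finset.univ.filter fun i : Fin e => p ≤ i).piAntidiag d

lemma mem_tailMonomials {p d : ℕ} {u : Fin e → ℕ} :
    u ∈ tailMonomials e p d ↔ ∑ i, u i = d ∧ ∀ i : Fin e, i < p → u i = 0 := by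
  simp only [tailMonomials, mem_piAntidiag_iff, Finset.mem_filter, Finset.mem_univ, true_and,
    not_le]

lemma card_restrictVars_tailMonomials (p d : ℕ) {k : ℕ} (hk : k ≤ e) :
    (restrictVars k (tailMonomials e p d)).card = (k - p + d - 1).choose d := by
  rw [← card_filter_between p hk, ← card_piAntidiag]
  congr 1
  ext u
  rw [mem_restrictVars, mem_tailMonomials, mem_piAntidiag_iff, and_assoc]
  refine and_congr_right fun _ => ?_
  simp only [Finset.mem_filter, Finset.mem_univ, true_and, not_and_or, not_le, not_lt]
  exact ⟨fun h i hi => hi.elim (h.1 i) (h.2 i), fun h => ⟨fun i hi => h i (Or.inl hi),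
    fun i hi => h i (Or.inr hi)⟩⟩

lemma card_tailMonomials (p d : ℕ) : (tailMonomials e p d).card = (e - p + d - 1).choose d := by
  rw [← card_restrictVars_tailMonomials p d le_rfl]
  congr 1
  exact (Finset.filter_true_of_mem fun u _ i hi => absurd i.isLt (not_lt.mpr hi)).symm

lemma sum_choose_sub_add (p q d : ℕ) :
    ∑ k ∈ Finset.range (p + q + 1), (k - p + (d + 1) - 1).choose (d + 1) =
      (q + (d + 1)).choose (d + 2) := by
  induction q with
  | zero =>
    rw [Nat.choose_eq_zero_of_lt (by omega)]
    refine Finset.sum_eq_zero fun k hk => Nat.choose_eq_zero_of_lt ?_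
    have := Finset.mem_range.mp hk
    omega
  | succ q ih =>
    rw [← add_assoc, Finset.sum_range_succ, ih,
      show p + q + 1 - p + (d + 1) - 1 = q + (d + 1) by omega,
      show q + 1 + (d + 1) = q + (d + 1) + 1 by omega, Nat.choose_succ_succ, add_comm]

/-- `X` is an initial segment, in the lexicographic order, of the monomials of degree `d`. -/
def IsLexSegment (d : ℕ) (X : Finset (Fin e → ℕ)) : Prop :=
  (∀ u ∈ X, ∑ i, u i = d) ∧
    ∀ u ∈ X, ∀ v : Fin e → ℕ, ∑ i, v i = d → monomialKey v ≤ monomialKey u → v ∈ X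

lemma IsLexSegment.subset_of_card_le {d : ℕ} {X Y : Finset (Fin e → ℕ)}
    (hX : IsLexSegment d X) (hY : IsLexSegment d Y) (h : X.card ≤ Y.card) : X ⊆ Y := by
  by_contra hcon
  obtain ⟨u, hu, hu'⟩ := Finset.not_subset.mp hcon
  have hsub : Y ⊆ X := fun v hv => by
    rcases le_total (monomialKey u) (monomialKey v) with huv | huv
    · exact absurd (hY.2 v hv u (hX.1 u hu) huv) hu'
    · exact hX.2 u hu v (hY.1 v hv) huv
  exact hu' ((Finset.eq_of_subset_of_card_le hsub h) ▸ hu)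

lemma isLexSegment_tailMonomials (p d : ℕ) : IsLexSegment d (tailMonomials e p d) := by
  refine ⟨fun u hu => (mem_tailMonomials.mp hu).1, fun u hu v hv hvu => ?_⟩
  rw [mem_tailMonomials] at hu ⊢
  refine ⟨hv, fun i hi => ?_⟩
  by_contra hvi
  refine absurd hvu (not_le.mpr (monomialKey_lt_iff.mpr (Or.inr ⟨hu.1.trans hv.symm, ?_⟩)))
  have hne : (Finset.univ.filter fun j => v j ≠ 0).Nonempty := ⟨i, by simpa using hvi⟩
  obtain ⟨j, hj, hmin⟩ := Finset.exists_min_image _ id hne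
  have hji : j ≤ i := hmin i (by simpa using hvi)
  refine ⟨j, fun l hl => ?_, ?_⟩
  · have h1 : v l = 0 := by
      by_contra h
      exact absurd (hmin l (by simpa using h)) (not_le.mpr hl)
    rw [h1, hu.2 l]
    exact lt_of_lt_of_le (Fin.lt_def.mp hl) ((Fin.le_def.mp hji).trans hi.le)
  · rw [hu.2 j (lt_of_le_of_lt (Fin.le_def.mp hji) hi)]
    exact Nat.pos_of_ne_zero (Finset.mem_filter.mp hj).2

lemma IsLexSegment.colon {d : ℕ} (j : Fin e) {X : Finset (Fin e → ℕ)}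
    (hX : IsLexSegment (d + 1) X) : IsLexSegment d (colon j 1 X) := by
  have hsum : ∀ u : Fin e → ℕ, ∑ i, (u + Pi.single j 1 : Fin e → ℕ) i = ∑ i, u i + 1 := by
    intro u
    simp [Finset.sum_add_distrib]
  refine ⟨fun u hu => ?_, fun u hu v hv hvu => ?_⟩
  · have := hX.1 _ (mem_colon.mp hu)
    rw [hsum] at this
    omega
  · rw [mem_colon] at hu ⊢
    refine hX.2 _ hu _ (by rw [hsum, hv]) ?_
    rw [monomialKey_add, monomialKey_add]
    exact add_le_add_left hvu _

lemma add_one_le_choose (n : ℕ) {d : ℕ} (hd : 0 < d) : n + 1 ≤ (n + d).choose d := by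
  obtain ⟨c, rfl⟩ : ∃ c, d = c + 1 := ⟨d - 1, by omega⟩
  induction n with
  | zero => simp
  | succ n ih =>
    rw [← add_assoc, Nat.choose_succ_succ, Nat.succ_eq_add_one,
      show n + 1 + c = n + (c + 1) by omega]
    have : 0 < (n + (c + 1)).choose c := Nat.choose_pos (by omega)
    omega

lemma choose_sSup_le {d n : ℕ} (hd : 0 < d) :
    Nat.choose (sSup {a | Nat.choose a d ≤ n}) d ≤ n ∧
      n < Nat.choose (sSup {a | Nat.choose a d ≤ n} + 1) d := by
  have hbdd : BddAbove {a | Nat.choose a d ≤ n} := by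
    refine ⟨n + d, fun a ha => ?_⟩
    by_contra! hlt
    have h1 := add_one_le_choose n hd
    have h2 := Nat.choose_le_choose d hlt.le
    have h3 : Nat.choose a d ≤ n := ha
    omega
  refine ⟨Nat.sSup_mem ⟨0, ?_⟩ hbdd, ?_⟩
  · show Nat.choose 0 d ≤ n
    rw [Nat.choose_eq_zero_of_lt hd]
    exact Nat.zero_le _
  · by_contra! hle
    have := le_csSup hbdd
      (show sSup {a | Nat.choose a d ≤ n} + 1 ∈ {a | Nat.choose a d ≤ n} from hle)
    omega

lemma sum_card_restrictVars_le_macUpper {d : ℕ} {X : Finset (Fin e → ℕ)} (hX : IsLexSegment d X)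
    (hcard : X.card < (e + d - 1).choose d) :
    ∑ k ∈ Finset.range (e + 1), (restrictVars k X).card ≤ macUpper d X.card := by
  induction d generalizing X with
  | zero =>
    have : X = ∅ := by simpa using hcard
    subst this
    simp [restrictVars]
  | succ d ih =>
    rcases X.eq_empty_or_nonempty with rfl | hne
    · simp [restrictVars]
    obtain ⟨ha1, ha2⟩ := choose_sSup_le (d := d + 1) (n := X.card) (Nat.succ_pos d)
    rw [macUpper, if_neg hne.card_pos.ne']
    set a := sSup {a | Nat.choose a (d + 1) ≤ X.card}
    clear_value a
    have had : d + 1 ≤ a := by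
      by_contra! hlt
      have := Nat.choose_le_choose (d + 1) (show a + 1 ≤ d + 1 by omega)
      rw [Nat.choose_self] at this
      have := hne.card_pos
      omega
    have hae : a < e + d := by
      by_contra! hle
      have := Nat.choose_le_choose (d + 1) hle
      rw [show e + (d + 1) - 1 = e + d by omega] at hcard
      omega
    obtain ⟨q, rfl⟩ : ∃ q, a = q + d := ⟨a - d, by omega⟩
    obtain ⟨p, rfl⟩ : ∃ p, e = p + 1 + q := ⟨e - 1 - q, by omega⟩
    set x : Fin (p + 1 + q) := ⟨p, by omega⟩ with hx
    have hT : tailMonomials (p + 1 + q) (p + 1) (d + 1) ⊆ X := by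
      refine (isLexSegment_tailMonomials _ _).subset_of_card_le hX ?_
      rw [card_tailMonomials]
      convert ha1 using 2
      omega
    have hXT : X ⊆ tailMonomials (p + 1 + q) p (d + 1) := by
      refine hX.subset_of_card_le (isLexSegment_tailMonomials _ _) ?_
      rw [card_tailMonomials, show p + 1 + q - p + (d + 1) - 1 = q + d + 1 by omega]
      exact ha2.le
    have hXx : ∀ u ∈ X, u x = 0 → u ∈ tailMonomials (p + 1 + q) (p + 1) (d + 1) := by
      intro u hu hux
      have h := mem_tailMonomials.mp (hXT hu)
      refine mem_tailMonomials.mpr ⟨h.1, fun i hi => ?_⟩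
      rcases (Nat.lt_succ_iff.mp hi).lt_or_eq with h1 | h1
      · exact h.2 i h1
      · rwa [show i = x from Fin.ext h1]
    have hsplit : ∀ k, (restrictVars k X).card ≤
        (restrictVars k (tailMonomials (p + 1 + q) (p + 1) (d + 1))).card +
          (restrictVars k (colon x 1 X)).card := by
      intro k
      rw [← Finset.card_filter_add_card_filter_not (s := restrictVars k X) (fun u => u x = 0)]
      refine Nat.add_le_add (Finset.card_le_card fun u hu => ?_)
        (Finset.card_le_card_of_injOn (fun u => u - Pi.single x 1) (fun u hu => ?_) ?_)
      · simp only [Finset.mem_filter, mem_restrictVars] at hu ⊢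
        exact ⟨hXx u hu.1.1 hu.2, hu.1.2⟩
      · simp only [Finset.coe_filter, Set.mem_ofPred_eq, mem_restrictVars] at hu
        refine mem_restrictVars.mpr ⟨mem_colon.mpr ?_, fun i hi => ?_⟩
        · rw [sub_single_add_single u x (Nat.pos_of_ne_zero hu.2)]
          exact hu.1.1
        · simp [hu.1.2 i hi]
      · intro u hu v hv huv
        simp only [Finset.coe_filter, Set.mem_ofPred_eq] at hu hv
        rw [← sub_single_add_single u x (Nat.pos_of_ne_zero hu.2),
          ← sub_single_add_single v x (Nat.pos_of_ne_zero hv.2)]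
        exact congrArg (· + Pi.single x 1) huv
    have hcolon : (colon x 1 X).card = X.card - (q + d).choose (d + 1) := by
      have h1 : (X.filter fun u => ¬ 1 ≤ u x) = tailMonomials (p + 1 + q) (p + 1) (d + 1) := by
        ext u
        rw [Finset.mem_filter, not_le, Nat.lt_one_iff]
        refine ⟨fun h => hXx u h.1 h.2, fun h => ⟨hT h, ?_⟩⟩
        exact (mem_tailMonomials.mp h).2 x (by simp [hx])
      have h2 := Finset.card_filter_add_card_filter_not (s := X) (fun u => 1 ≤ u x)
      rw [h1, card_tailMonomials, show p + 1 + q - (p + 1) + (d + 1) - 1 = q + d by omega] at h2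
      rw [card_colon]
      omega
    refine (Finset.sum_le_sum fun k _ => hsplit k).trans ?_
    rw [Finset.sum_add_distrib]
    refine Nat.add_le_add (le_of_eq ?_) ?_
    · rw [show q + d + 1 = q + (d + 1) by omega, ← sum_choose_sub_add (p + 1) q d]
      refine Finset.sum_congr rfl fun k hk => ?_
      rw [card_restrictVars_tailMonomials _ _ (Nat.lt_succ_iff.mp (Finset.mem_range.mp hk))]
    · rw [← hcolon]
      refine ih (hX.colon x) ?_
      rw [hcolon]
      have h1 := Nat.choose_succ_succ (q + d) d
      have h2 : (q + d).choose d ≤ (p + 1 + q + d - 1).choose d :=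
        Nat.choose_le_choose d (by omega)
      simp only [Nat.succ_eq_add_one] at h1
      omega

end Counting

section MainTheorem

variable {e : ℕ}

lemma isInitialSegment_monomialsUpTo (R : ℕ) :
    IsInitialSegment e (monomialsUpTo (Finset.univ : Finset (Fin e)) R) := by
  refine ⟨fun u _ i hi => absurd i.isLt (not_lt.mpr hi), fun u hu v _ hvu => ?_⟩
  rw [mem_monomialsUpTo] at hu ⊢
  exact ⟨(sum_le_of_monomialKey_le hvu).trans hu.1, fun i hi => absurd (Finset.mem_univ i) hi⟩

lemma IsInitialSegment.monomialsUpTo_subset {O : Finset (Fin e → ℕ)} (hO : IsInitialSegment e O)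
    {R : ℕ} (h : (e + R).choose R ≤ O.card) : monomialsUpTo Finset.univ R ⊆ O :=
  (isInitialSegment_monomialsUpTo R).subset_of_card_le hO
    (by rwa [card_monomialsUpTo, Finset.card_univ, Fintype.card_fin])

lemma sum_card_restrictVars_le {O : Finset (Fin e → ℕ)}
    (hO : IsInitialSegment e O) {R : ℕ} (h1 : (e + R).choose R ≤ O.card)
    (h2 : O.card < (e + (R + 1)).choose (R + 1)) :
    ∑ k ∈ Finset.range e, (restrictVars k O).card + (O.card - (e + R).choose R) ≤
      (e + R).choose (R + 1) + macUpper (R + 1) (O.card - (e + R).choose R) := by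
  have hlow := hO.monomialsUpTo_subset h1
  have hup : O ⊆ monomialsUpTo Finset.univ (R + 1) :=
    hO.subset_of_card_le (isInitialSegment_monomialsUpTo _)
      (by rw [card_monomialsUpTo, Finset.card_univ, Fintype.card_fin]; exact h2.le)
  set X := O.filter fun u => ¬ ∑ i, u i ≤ R
  have hlowO : (O.filter fun u => ∑ i, u i ≤ R) = monomialsUpTo Finset.univ R := by
    ext u
    rw [Finset.mem_filter]
    refine ⟨fun h => mem_monomialsUpTo.mpr ⟨h.2, fun i hi => absurd (Finset.mem_univ i) hi⟩,
      fun h => ⟨hlow h, (mem_monomialsUpTo.mp h).1⟩⟩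
  have hXcard : X.card = O.card - (e + R).choose R := by
    have h : (O.filter fun u => ∑ i, u i ≤ R).card + X.card = O.card :=
      Finset.card_filter_add_card_filter_not _
    rw [hlowO, card_monomialsUpTo, Finset.card_univ, Fintype.card_fin] at h
    omega
  have hX : IsLexSegment (R + 1) X := by
    refine ⟨fun u hu => ?_, fun u hu v hv hvu => ?_⟩
    · rw [Finset.mem_filter] at hu
      have := (mem_monomialsUpTo.mp (hup hu.1)).1
      omega
    · rw [Finset.mem_filter] at hu ⊢
      exact ⟨hO.2 u hu.1 v (fun i hi => absurd i.isLt (not_lt.mpr hi)) hvu, by omega⟩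
  have hsum := sum_card_restrictVars_le_macUpper hX (by
    rw [hXcard, show e + (R + 1) - 1 = e + R by omega]
    have : (e + (R + 1)).choose (R + 1) = (e + R).choose R + (e + R).choose (R + 1) :=
      Nat.choose_succ_succ _ _
    omega)
  have hfull : restrictVars e X = X :=
    Finset.filter_true_of_mem fun u _ i hi => absurd i.isLt (not_lt.mpr hi)
  rw [Finset.sum_range_succ, hfull] at hsum
  have hk : ∀ k ∈ Finset.range e, (restrictVars k O).card ≤
      (k + R).choose R + (restrictVars k X).card := by
    intro k hk
    have hke : k ≤ e := (Finset.mem_range.mp hk).le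
    rw [← Finset.card_filter_add_card_filter_not (s := restrictVars k O) (fun u => ∑ i, u i ≤ R)]
    refine Nat.add_le_add ?_ (Finset.card_le_card fun u hu => ?_)
    · have hS := card_monomialsUpTo (Finset.univ.filter fun i : Fin e => 0 ≤ (i : ℕ) ∧ i < k) R
      rw [card_filter_between 0 hke, Nat.sub_zero] at hS
      rw [← hS]
      refine Finset.card_le_card fun u hu => ?_
      rw [Finset.mem_filter, mem_restrictVars] at hu
      refine mem_monomialsUpTo.mpr ⟨hu.2, fun i hi => hu.1.2 i ?_⟩
      simpa using hi
    · rw [Finset.mem_filter, mem_restrictVars] at hu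
      exact mem_restrictVars.mpr ⟨Finset.mem_filter.mpr ⟨hu.1.1, hu.2⟩, hu.1.2⟩
  have hsumO := Finset.sum_le_sum hk
  have hhockey : ∑ k ∈ Finset.range e, (k + R).choose R = (e + R).choose (R + 1) := by
    cases e with
    | zero => simp
    | succ n => rw [Nat.sum_range_add_choose, show n + 1 + R = n + R + 1 by omega]
  rw [Finset.sum_add_distrib, hhockey] at hsumO
  rw [← hXcard]
  omega

lemma IsStable.mem_of_single_mem {B : Finset (Fin e → ℕ)} (hB : IsStable B) (he : 0 < e) {d : ℕ}
    (h : Pi.single ⟨0, he⟩ d ∈ B) {u : Fin e → ℕ} (hu : ∑ i, u i = d) : u ∈ B := by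
  set z : Fin e := ⟨0, he⟩ with hz
  induction hn : d - u z generalizing u with
  | zero =>
    have hsplit := Finset.add_sum_erase Finset.univ u (Finset.mem_univ z)
    have hrest : ∑ i ∈ Finset.univ.erase z, u i = 0 := by omega
    convert h
    funext i
    by_cases hi : i = z
    · subst hi; simp; omega
    · simp [hi, Finset.sum_eq_zero_iff.mp hrest i (by simp [hi])]
  | succ n ih =>
    obtain ⟨i, hiz, hi⟩ : ∃ i, i ≠ z ∧ u i ≠ 0 := by
      by_contra! hcon
      rw [Finset.sum_eq_single z (fun i _ hi => hcon i hi) (by simp)] at hu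
      omega
    have hw : u - Pi.single i 1 + Pi.single z 1 ∈ B := by
      refine ih ?_ ?_
      · have hs := congrArg (fun v : Fin e → ℕ => ∑ l, v l)
          (sub_single_add_single u i (Nat.pos_of_ne_zero hi))
        simp only [Pi.add_apply, Finset.sum_add_distrib, Finset.sum_pi_single', Finset.mem_univ,
          if_true] at hs ⊢
        omega
      · simp [hiz.symm]
        omega
    have hzi : z < i := lt_of_le_of_ne (Fin.le_def.mpr (Nat.zero_le _)) hiz.symm
    have := hB _ hw i z hzi (by simp)
    convert this using 1
    funext l
    by_cases hl : l = i
    · subst hl; simp; omega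
    · simp [hl]

/-- If `B` does not contain all monomials of degree at most `R`, then it has fewer minimal
non-members than expected. -/
lemma card_extension_sdiff_lt (he : 2 ≤ e) {B : Finset (Fin e → ℕ)} (hB : B ⊆ extension B)
    (hne : B.Nonempty) {m R : ℕ} (hcard : B.card ≤ m) (h1 : (e + R).choose R ≤ m)
    (h2 : m < (e + (R + 1)).choose (R + 1)) {u : Fin e → ℕ} (hu : u ∉ B) (huR : ∑ i, u i ≤ R) :
    (extension B \ B).card + (m - (e + R).choose R) <
      (e + R).choose (R + 1) + macUpper (R + 1) (m - (e + R).choose R) := by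
  obtain ⟨B', hB', hst, hcard', hext, hmiss⟩ := exists_stable B hB
  obtain ⟨u', hu', husum⟩ := hmiss u hu
  obtain ⟨O, hO, rfl⟩ := exists_initialSegment (e := e) (by omega : 0 < e) le_rfl m
  have hOsum := sum_card_restrictVars_le hO h1 h2
  have hne' : B'.Nonempty := Finset.card_pos.mp (hcard' ▸ hne.card_pos)
  have hB1 := card_extension_sdiff_le hB' hne'
  have hle : (extension B \ B).card ≤ (extension B' \ B').card := by
    rw [Finset.card_sdiff_of_subset hB, Finset.card_sdiff_of_subset hB']
    omega
  have he0 : 0 < e := by omega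
  set z : Fin e := ⟨0, he0⟩ with hz
  have hzB : Pi.single z (∑ i, u i) ∉ B' := fun h => hu' (hst.mem_of_single_mem he0 h husum)
  have hlt1 : (restrictVars 1 B').card < (restrictVars 1 O).card := by
    have ha : (restrictVars 1 B').card ≤ R := by
      refine (Finset.card_le_card (t := (Finset.range (∑ i, u i)).image (Pi.single z))
        fun v hv => ?_).trans (Finset.card_image_le.trans (by simpa using huR))
      rw [mem_restrictVars] at hv
      have hvz : v = Pi.single z (v z) := by
        funext i
        by_cases hi : i = z
        · subst hi; simp
        · have : (i : ℕ) ≠ 0 := fun h => hi (Fin.ext h)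
          simp [hi, hv.2 i (by omega)]
      refine Finset.mem_image.mpr ⟨v z, ?_, hvz.symm⟩
      rw [Finset.mem_range]
      by_contra! hcon
      refine hzB (mem_of_le hB' hv.1 ?_)
      rw [hvz]
      simpa using hcon
    have hb : R + 1 ≤ (restrictVars 1 O).card := by
      rw [← Finset.card_range (R + 1), ← Finset.card_image_of_injective (Finset.range (R + 1))
        (Pi.single_injective (M := fun _ : Fin e => ℕ) z)]
      refine Finset.card_le_card fun v hv => ?_
      obtain ⟨b, hb, rfl⟩ := Finset.mem_image.mp hv
      rw [Finset.mem_range] at hb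
      refine mem_restrictVars.mpr ⟨hO.monomialsUpTo_subset h1 (mem_monomialsUpTo.mpr
        ⟨by simpa using Nat.lt_succ_iff.mp hb, fun i hi => absurd (Finset.mem_univ i) hi⟩),
        fun i hi => ?_⟩
      have : i ≠ z := fun h => by
        rw [h] at hi
        simp [hz] at hi
      simp [this]
    omega
  have hlt : ∑ k ∈ Finset.range e, (restrictVars k B').card <
      ∑ k ∈ Finset.range e, (restrictVars k O).card :=
    Finset.sum_lt_sum (fun k hk => card_restrictVars_le_of_initialSegment hB' hst hO
      (hcard'.trans_le hcard) (Finset.mem_range.mp hk).le) ⟨1, by simp; omega, hlt1⟩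
  omega

lemma card_add_mul_card_le {m R : ℕ} (hm : 0 < m) (g : Fin e → ℕ)
    (hinj : ∀ a b : Fin e → ℕ, ∑ i, a i ≤ R + 1 → ∑ i, b i ≤ R + 1 →
      (∑ i, a i * g i) % m = (∑ i, b i * g i) % m → a = b) :
    (e + R).choose R + e * (e - 1 + R).choose R ≤ m := by
  have : NeZero m := ⟨hm.ne'⟩
  set π : (Fin e → ℕ) → ZMod m := fun a => ((∑ i, a i * g i : ℕ) : ZMod m) with hπ
  have hadd : ∀ a i, π (a + Pi.single i 1) = π a + (g i : ZMod m) := by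
    intro a i
    simp only [hπ, ← Nat.cast_add]
    congr 1
    simp [add_mul, Finset.sum_add_distrib, Pi.single_apply]
  have hsum : ∀ (a : Fin e → ℕ) i, ∑ j, (a + Pi.single i 1 : Fin e → ℕ) j = ∑ j, a j + 1 := by
    intro a i
    simp [Finset.sum_add_distrib]
  have hπinj : ∀ a b : Fin e → ℕ, ∑ i, a i ≤ R + 1 → ∑ i, b i ≤ R + 1 → π a = π b → a = b :=
    fun a b ha hb hab => hinj a b ha hb ((ZMod.natCast_eq_natCast_iff' _ _ m).mp hab)
  set P := (monomialsUpTo (Finset.univ : Finset (Fin e)) R).image π with hP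
  set Q := (Finset.univ : Finset (Fin e)).biUnion fun i =>
    (monomialsUpTo (Finset.univ.erase i) R).image fun a => π a - (g i : ZMod m) with hQ
  have hPcard : P.card = (e + R).choose R := by
    rw [hP, Finset.card_image_of_injOn, card_monomialsUpTo, Finset.card_univ, Fintype.card_fin]
    intro a ha b hb hab
    have ha' := (mem_monomialsUpTo.mp ha).1
    have hb' := (mem_monomialsUpTo.mp hb).1
    exact hπinj a b (by omega) (by omega) hab
  have key : ∀ i j, ∀ a ∈ monomialsUpTo (Finset.univ.erase i) R,
      ∀ b ∈ monomialsUpTo (Finset.univ.erase j) R,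
      π a - (g i : ZMod m) = π b - (g j : ZMod m) → i = j ∧ a = b := by
    intro i j a ha b hb hab
    rw [mem_monomialsUpTo] at ha hb
    have h := hπinj (a + Pi.single j 1) (b + Pi.single i 1) (by rw [hsum]; omega)
      (by rw [hsum]; omega) (by rw [hadd, hadd]; linear_combination hab)
    have hij : i = j := by
      by_contra hij
      have := congrFun h i
      simp [hij, ha.2 i (by simp)] at this
    subst hij
    exact ⟨rfl, add_right_cancel h⟩
  have hQcard : Q.card = e * (e - 1 + R).choose R := by
    rw [hQ, Finset.card_biUnion]
    · rw [Finset.sum_congr rfl fun i _ => ?_, Finset.sum_const, Finset.card_univ, Fintype.card_fin,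
        smul_eq_mul]
      rw [Finset.card_image_of_injOn fun a ha b hb hab => (key i i a ha b hb hab).2,
        card_monomialsUpTo, Finset.card_erase_of_mem (Finset.mem_univ i), Finset.card_univ,
        Fintype.card_fin]
    · intro i _ j _ hij
      refine Finset.disjoint_left.mpr fun x hx hy => hij ?_
      obtain ⟨a, ha, hax⟩ := Finset.mem_image.mp hx
      obtain ⟨b, hb, hbx⟩ := Finset.mem_image.mp hy
      exact (key i j a ha b hb (hax.trans hbx.symm)).1
  have hdisj : Disjoint P Q := by
    refine Finset.disjoint_left.mpr fun x hx hy => ?_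
    obtain ⟨a, ha, hax⟩ := Finset.mem_image.mp hx
    obtain ⟨i, -, hi⟩ := Finset.mem_biUnion.mp hy
    obtain ⟨b, hb, hbx⟩ := Finset.mem_image.mp hi
    rw [mem_monomialsUpTo] at ha hb
    have h := hπinj (a + Pi.single i 1) b (by rw [hsum]; omega) (by omega)
      (by rw [hadd]; linear_combination hax - hbx)
    have := congrFun h i
    simp [hb.2 i (by simp)] at this
  rw [← hPcard, ← hQcard, ← Finset.card_union_of_disjoint hdisj]
  simpa [ZMod.card] using Finset.card_le_univ (P ∪ Q)

lemma choose_le_of_large {R : ℕ} (he : 3 ≤ e) (hR : 2 ≤ R) (hRe : 9 * e ≤ (R - 2) ^ 2) :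
    (e + (R + 2)).choose (R + 2) ≤ (e + R).choose R + e * (e - 1 + R).choose R := by
  have h1 := Nat.add_one_mul_choose_eq (e + R) R
  have h2 := Nat.add_one_mul_choose_eq (e + R + 1) (R + 1)
  have h3 := Nat.choose_mul_succ_eq (e - 1 + R) R
  rw [show e - 1 + R + 1 - R = e by omega, show e - 1 + R + 1 = e + R by omega] at h3
  rw [show e + (R + 2) = e + R + 1 + 1 by omega]
  obtain ⟨x, rfl⟩ : ∃ x, R = x + 2 := ⟨R - 2, by omega⟩
  obtain ⟨f, rfl⟩ : ∃ f, e = f + 3 := ⟨e - 3, by omega⟩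
  rw [Nat.add_sub_cancel] at hRe
  set R := x + 2
  set e := f + 3
  set A := (e + R + 1 + 1).choose (R + 2)
  set B := (e + R + 1).choose (R + 1)
  set C := (e + R).choose R
  set D := (e - 1 + R).choose R
  have hpoly : (e + R + 2) * (e + R + 1) * (e + R) ≤ (R + 2) * (R + 1) * (e + R + e * e) := by
    have hx : 9 * (f + 3) ≤ x ^ 2 := hRe
    simp only [e, R]
    nlinarith [Nat.mul_le_mul_left ((f + 3) * (f + 1)) hx, Nat.zero_le (x * f ^ 2),
      Nat.zero_le (x * f), Nat.zero_le (f ^ 3), Nat.zero_le (f ^ 2)]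
  have hpos : 0 < (R + 2) * (R + 1) * (e + R) := by positivity
  refine Nat.le_of_mul_le_mul_left ?_ hpos
  calc (R + 2) * (R + 1) * (e + R) * A = (e + R + 2) * (e + R + 1) * (e + R) * C := by
        linear_combination (R + 1) * (e + R) * h2.symm + (e + R) * (e + R + 2) * h1.symm
    _ ≤ (R + 2) * (R + 1) * (e + R + e * e) * C := Nat.mul_le_mul_right _ hpoly
    _ = (R + 2) * (R + 1) * (e + R) * (C + e * D) := by
        linear_combination (R + 2) * (R + 1) * e * h3.symm

lemma macR_spec {m : ℕ} (he : 0 < e) (hm : 0 < m) :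
    0 < macR e m ∧ m < (e + macR e m).choose (macR e m) ∧
      (e + (macR e m - 1)).choose (macR e m - 1) ≤ m := by
  have hmem : macR e m ∈ {r : ℕ | 0 < r ∧ m < Nat.choose (e + r) r} := by
    refine Nat.sInf_mem ⟨m, hm, ?_⟩
    rw [← Nat.choose_symm_add, add_comm]
    exact add_one_le_choose m he
  refine ⟨hmem.1, hmem.2, ?_⟩
  by_contra! hlt
  have h0 : 0 < macR e m - 1 := by
    by_contra! h
    rw [Nat.le_zero.mp h, Nat.choose_zero_right] at hlt
    omega
  have := Nat.sInf_le
    (show macR e m - 1 ∈ {r : ℕ | 0 < r ∧ m < Nat.choose (e + r) r} from ⟨h0, hlt⟩)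
  rw [← macR] at this
  omega

end MainTheorem

/-- For fixed e ≥ 3, 𝒭(e,m) < 𝒞(e,m) for all m ≥ C(e+t,t), where t = ⌈3 + 3√e⌉. -/
theorem rho_lt_C_of_large_mult (e : ℕ) (he : 3 ≤ e) (m : ℕ)
    (hm : Nat.choose (e + ⌈(3 : ℝ) + 3 * Real.sqrt e⌉₊) ⌈(3 : ℝ) + 3 * Real.sqrt e⌉₊ ≤ m)
    (Γ : AddSubmonoid ℕ) (hΓ : IsNumericalMonoid Γ)
    (hedim : edim Γ = e + 1) (hmult : mult Γ = m) :
    rho Γ < mathcalC e m := by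
  have he0 : 0 < e := by omega
  have hm0 : 0 < m := lt_of_lt_of_le (Nat.choose_pos (Nat.le_add_left _ _)) hm
  obtain ⟨hr0, hr2, hr1⟩ := macR_spec he0 hm0
  set t := ⌈(3 : ℝ) + 3 * Real.sqrt e⌉₊ with ht
  have htr : t < macR e m := by
    by_contra! hle
    have := Nat.choose_le_choose e (Nat.add_le_add_left hle e)
    rw [Nat.choose_symm_add, Nat.choose_symm_add] at this
    omega
  have hte : (3 : ℝ) + 3 * Real.sqrt e ≤ t := Nat.le_ceil _
  have hsq := Real.sq_sqrt (Nat.cast_nonneg (α := ℝ) e)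
  have hs0 := Real.sqrt_nonneg (e : ℝ)
  have ht3 : 3 ≤ t := by
    have : (3 : ℝ) ≤ t := by linarith
    exact_mod_cast this
  obtain ⟨R, hR⟩ : ∃ R, macR e m = R + 2 := ⟨macR e m - 2, by omega⟩
  have hRe : 9 * e ≤ (R - 2) ^ 2 := by
    have h1 : 9 * e ≤ (t - 3) ^ 2 := by
      have : (9 * e : ℝ) ≤ ((t - 3 : ℕ) : ℝ) ^ 2 := by
        rw [Nat.cast_sub ht3]
        push_cast
        nlinarith
      exact_mod_cast this
    exact h1.trans (Nat.pow_le_pow_left (by omega) 2)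
  rw [hR] at hr1 hr2
  rw [show R + 2 - 1 = R + 1 by omega] at hr1
  obtain ⟨g, B, hne, hB, hinj, hrho⟩ := exists_standard_monomials hm0 Γ hedim hmult
  have hcard : B.card ≤ m := by
    rw [← Finset.card_range m]
    refine Finset.card_le_card_of_injOn (fun a => (∑ i, a i * g i) % m) (fun a _ => ?_)
      fun a ha b hb hab => hinj a ha b hb hab
    simpa using Nat.mod_lt _ hm0
  obtain ⟨u, huR, hu⟩ : ∃ u : Fin e → ℕ, ∑ i, u i ≤ R + 1 ∧ u ∉ B := by
    by_contra! hall
    have h1 := card_add_mul_card_le hm0 g fun a b ha hb =>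
      hinj a (hall a ha) b (hall b hb)
    have h2 := choose_le_of_large he (by omega : 2 ≤ R) hRe
    omega
  have hlt := card_extension_sdiff_lt (by omega) hB hne hcard hr1 hr2 hu huR
  rw [mathcalC, hR, show e + (R + 2) - 1 = e + (R + 1) by omega, show R + 2 - 1 = R + 1 by omega]
  rw [show R + 1 + 1 = R + 2 by omega] at hlt
  omega
end

section
/- Let e ≥ 2 and k ≥ 2 be integers, and let m be an integer with binom(e+k, k) ≤ m ≤ binom(e+k−1, k−1) + e·binom(e+k−2, k−1) − 1. Then every numerical monoid Γ with embedding dimension e+1 and multiplicity m satisfies ρ(Γ) < 𝒞(e,m). -/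
open scoped Pointwise

/-- Prefix sums of the increments of the Macaulay growth function: if the degree-`t` monomials in
`n` variables are listed lexicographically, `lexGain t n b` sums, over the first `b` of them, the
number of variables strictly below every variable of the monomial. -/
def lexGain : ℕ → ℕ → ℕ → ℕ
  | 0, n, b => if b = 0 then 0 else n - 1
  | _ + 1, 0, _ => 0
  | t + 1, n + 1, b =>
    lexGain (t + 1) n (min b (Nat.multichoose n (t + 1))) +
      lexGain t (n + 1) (b - Nat.multichoose n (t + 1))

theorem lexGain_zero_right (t n : ℕ) : lexGain t n 0 = 0 := by
  induction t generalizing n with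
  | zero => simp [lexGain]
  | succ t iht =>
    induction n with
    | zero => simp [lexGain]
    | succ n ihn => simp [lexGain, iht, ihn]

theorem lexGain_of_le {t n b : ℕ} (h : b ≤ Nat.multichoose n (t + 1)) :
    lexGain (t + 1) (n + 1) b = lexGain (t + 1) n b := by
  simp [lexGain, h, lexGain_zero_right]

theorem lexGain_add (t n x : ℕ) :
    lexGain (t + 1) (n + 1) (Nat.multichoose n (t + 1) + x) =
      lexGain (t + 1) n (Nat.multichoose n (t + 1)) + lexGain t (n + 1) x := by
  simp [lexGain]

theorem lexGain_mono (t n : ℕ) : Monotone (lexGain t n) := by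
  induction t generalizing n with
  | zero => intro a b h; simp only [lexGain]; split_ifs <;> omega
  | succ t iht =>
    induction n with
    | zero => intro a b h; simp [lexGain]
    | succ n ihn =>
      intro a b h
      simp only [lexGain]
      exact add_le_add (ihn (by omega)) (iht _ (by omega))

theorem multichoose_mono_left (t : ℕ) : Monotone fun n => Nat.multichoose n (t + 1) :=
  monotone_nat_of_le_succ fun n => by
    simp only [Nat.multichoose_succ_succ]; omega

theorem multichoose_succ_pos (n t : ℕ) : 0 < Nat.multichoose (n + 1) t := by
  rw [Nat.multichoose_eq]; exact Nat.choose_pos (by omega)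

theorem multichoose_le_succ_right (n t : ℕ) :
    Nat.multichoose (n + 1) t ≤ Nat.multichoose (n + 1) (t + 1) := by
  rw [Nat.multichoose_succ_succ]; omega

theorem multichoose_strictMono_left {p n t : ℕ} (h : p < n) :
    Nat.multichoose p (t + 1) < Nat.multichoose n (t + 1) := by
  have h1 : Nat.multichoose (p + 1) (t + 1) ≤ Nat.multichoose n (t + 1) :=
    multichoose_mono_left t h
  have := multichoose_succ_pos p t
  rw [Nat.multichoose_succ_succ] at h1
  omega

theorem lexGain_eq_of_le {t n n' b : ℕ} (hn : n ≤ n') (h : b ≤ Nat.multichoose n (t + 1)) :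
    lexGain (t + 1) n' b = lexGain (t + 1) n b := by
  induction n', hn using Nat.le_induction with
  | base => rfl
  | succ m hm ih => rw [lexGain_of_le (h.trans (multichoose_mono_left t hm)), ih]

theorem lexGain_multichoose (t n : ℕ) :
    lexGain t (n + 1) (Nat.multichoose (n + 1) t) = Nat.multichoose n (t + 1) := by
  induction t generalizing n with
  | zero => simp [lexGain]
  | succ t iht =>
    induction n with
    | zero =>
      rw [Nat.multichoose_succ_succ 0 t, lexGain_add, iht]
      simp [lexGain]
    | succ n ih =>
      rw [Nat.multichoose_succ_succ (n + 1) t, lexGain_add, ih, iht,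
        Nat.multichoose_succ_succ n (t + 1)]

/-- Initial windows of the lexicographic weights have minimal weight. -/
def LexSuperadditive (t : ℕ) : Prop :=
  ∀ n u v, u + v ≤ Nat.multichoose n t → lexGain t n u + lexGain t n v ≤ lexGain t n (u + v)

/-- Final windows of the lexicographic weights have strictly maximal weight. -/
def LexFinalMax (t : ℕ) : Prop :=
  ∀ n u v, u < Nat.multichoose n t → v < Nat.multichoose n t → Nat.multichoose n t ≤ u + v →
    lexGain t n u + lexGain t n v <
      lexGain t n (Nat.multichoose n t) + lexGain t n (u + v - Nat.multichoose n t)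

/-- Initial windows get lighter when the degree grows. -/
def LexDegreeAntitone (t : ℕ) : Prop :=
  ∀ n b, b ≤ Nat.multichoose n t → lexGain (t + 1) n b ≤ lexGain t n b

theorem LexFinalMax.le {t : ℕ} (h : LexFinalMax t) {n u v : ℕ} (hu : u ≤ Nat.multichoose n t)
    (hv : v ≤ Nat.multichoose n t) (huv : Nat.multichoose n t ≤ u + v) :
    lexGain t n u + lexGain t n v ≤
      lexGain t n (Nat.multichoose n t) + lexGain t n (u + v - Nat.multichoose n t) := by
  rcases hu.lt_or_eq with hu | rfl
  · rcases hv.lt_or_eq with hv | rfl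
    · exact (h n u v hu hv huv).le
    · rw [Nat.add_sub_cancel, add_comm]
  · rw [Nat.add_sub_cancel_left]

/-- Final windows in degree `t + 1` are lighter than final windows in degree `t` with more
variables. -/
theorem lexGain_suffix_lt {t : ℕ} (hA : LexSuperadditive t) (hB : LexFinalMax t) {p n c : ℕ}
    (hpn : p < n) (hc : 0 < c) (hcp : c ≤ Nat.multichoose p (t + 1))
    (hcn : c ≤ Nat.multichoose n t) :
    lexGain (t + 1) p (Nat.multichoose p (t + 1)) + lexGain t n (Nat.multichoose n t - c) <
      lexGain t n (Nat.multichoose n t) +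
        lexGain (t + 1) p (Nat.multichoose p (t + 1) - c) := by
  induction p generalizing c with
  | zero => simp at hcp; omega
  | succ p ih =>
    have hN := Nat.multichoose_succ_succ p t
    have hfull := lexGain_add t p (Nat.multichoose (p + 1) t)
    rw [← hN] at hfull
    by_cases hc1 : c ≤ Nat.multichoose (p + 1) t
    · have h1 := lexGain_add t p (Nat.multichoose (p + 1) t - c)
      rw [← Nat.add_sub_assoc hc1, ← hN] at h1
      rw [hfull, h1]
      cases t with
      | zero =>
        simp only [Nat.multichoose_zero_right] at *
        obtain rfl : c = 1 := by omega
        simp [lexGain]; omega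
      | succ t =>
        have hlt := multichoose_strictMono_left (t := t) hpn
        have h2 := hB n (Nat.multichoose (p + 1) (t + 1)) (Nat.multichoose n (t + 1) - c) hlt
          (by omega) (by omega)
        rw [show Nat.multichoose (p + 1) (t + 1) + (Nat.multichoose n (t + 1) - c) -
            Nat.multichoose n (t + 1) = Nat.multichoose (p + 1) (t + 1) - c by omega,
          lexGain_eq_of_le hpn.le le_rfl, lexGain_eq_of_le hpn.le (Nat.sub_le _ _)] at h2
        omega
    · push Not at hc1
      obtain ⟨d, rfl⟩ := Nat.exists_eq_add_of_lt hc1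
      have h2 := ih (c := d + 1) (by omega) (by omega) (by omega) (by omega)
      have h3 := hA n (Nat.multichoose n t - (Nat.multichoose (p + 1) t + d + 1))
        (Nat.multichoose (p + 1) t) (by omega)
      have h4 : lexGain t n (Nat.multichoose (p + 1) t) =
          lexGain t (p + 1) (Nat.multichoose (p + 1) t) := by
        cases t with
        | zero => simp at hcn
        | succ t => exact lexGain_eq_of_le hpn.le le_rfl
      rw [show Nat.multichoose n t - (Nat.multichoose (p + 1) t + d + 1) +
        Nat.multichoose (p + 1) t = Nat.multichoose n t - (d + 1) by omega] at h3
      rw [hfull, show Nat.multichoose (p + 1) (t + 1) - (Nat.multichoose (p + 1) t + d + 1) =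
        Nat.multichoose p (t + 1) - (d + 1) by omega, lexGain_of_le (Nat.sub_le _ _)]
      omega

theorem LexFinalMax.succ {t : ℕ} (hA : LexSuperadditive t) (hB : LexFinalMax t) :
    LexFinalMax (t + 1) := by
  intro n
  induction n with
  | zero => intro u v hu; simp at hu
  | succ n ih =>
    have hN := Nat.multichoose_succ_succ n t
    set P := Nat.multichoose n (t + 1) with hP
    set S := Nat.multichoose (n + 1) t with hS
    have hS0 : 0 < S := multichoose_succ_pos n t
    rw [hN]
    have hadd := lexGain_add t n
    rw [← hP] at hadd
    have hlow : ∀ b ≤ P, lexGain (t + 1) (n + 1) b = lexGain (t + 1) n b :=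
      fun b hb => lexGain_of_le hb
    have hsuf : ∀ c, 0 < c → c ≤ P → c ≤ S → lexGain (t + 1) n P + lexGain t (n + 1) (S - c) <
        lexGain t (n + 1) S + lexGain (t + 1) n (P - c) := fun c h1 h2 h3 =>
      lexGain_suffix_lt hA hB (Nat.lt_succ_self n) h1 h2 h3
    -- one index in each block
    have mixed : ∀ μ v, μ < S → v ≤ P → S ≤ μ + v →
        lexGain (t + 1) (n + 1) (P + μ) + lexGain (t + 1) (n + 1) v <
          lexGain (t + 1) (n + 1) (P + S) + lexGain (t + 1) (n + 1) (μ + v - S) := by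
      intro μ v hμ hv hs
      have h1 := hsuf (S - μ) (by omega) (by omega) (by omega)
      rw [hadd, hadd, hlow v hv, hlow _ (by omega)]
      rw [show S - (S - μ) = μ by omega] at h1
      have h3 : lexGain (t + 1) n v + lexGain (t + 1) n (P - (S - μ)) ≤
          lexGain (t + 1) n P + lexGain (t + 1) n (μ + v - S) := by
        rcases hv.lt_or_eq with hv | rfl
        · have h3 := ih v (P - (S - μ)) hv (by omega) (by omega)
          rw [show v + (P - (S - μ)) - P = μ + v - S by omega] at h3
          exact h3.le
        · rw [show P - (S - μ) = μ + P - S by omega]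
      omega
    intro u v hu hv huv
    wlog huv' : v ≤ u generalizing u v
    · have := this v u hv hu (by omega) (by omega)
      rw [show v + u = u + v by omega] at this
      omega
    by_cases hvP : P ≤ v
    · obtain ⟨μ, rfl⟩ := Nat.exists_eq_add_of_le (hvP.trans huv')
      obtain ⟨ν, rfl⟩ := Nat.exists_eq_add_of_le hvP
      rw [hadd, hadd, hadd]
      by_cases hs : S ≤ μ + ν
      · have h1 := hB (n + 1) μ ν (by omega) (by omega) hs
        rw [← hS] at h1
        rw [show P + μ + (P + ν) - (P + S) = P + (μ + ν - S) by omega, hadd]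
        omega
      · have h1 := hA (n + 1) μ ν (by omega)
        have h2 := hsuf (S - (μ + ν)) (by omega) (by omega) (by omega)
        rw [show S - (S - (μ + ν)) = μ + ν by omega] at h2
        rw [show P + μ + (P + ν) - (P + S) = P - (S - (μ + ν)) by omega, hlow _ (by omega)]
        omega
    · by_cases huP : P ≤ u
      · obtain ⟨μ, rfl⟩ := Nat.exists_eq_add_of_le huP
        have := mixed μ v (by omega) (by omega) (by omega)
        rwa [show P + μ + v - (P + S) = μ + v - S by omega]
      · have h1 := mixed 0 (u + v - P) hS0 (by omega) (by omega)
        have h2 := ih u v (by omega) (by omega) (by omega)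
        rw [add_zero, hlow P le_rfl, hlow (u + v - P) (by omega)] at h1
        rw [hlow u (by omega), hlow v (by omega)]
        rw [show 0 + (u + v - P) - S = u + v - (P + S) by omega] at h1
        omega

theorem lexDegreeAntitone_zero : LexDegreeAntitone 0 := by
  intro n b hb
  simp only [Nat.multichoose_zero_right] at hb
  rcases Nat.le_one_iff_eq_zero_or_eq_one.mp hb with rfl | rfl
  · simp [lexGain_zero_right]
  · have : lexGain 1 n 1 = 0 := by
      induction n with
      | zero => simp [lexGain]
      | succ n ih =>
        cases n with
        | zero => simp [lexGain]
        | succ n => rw [lexGain_of_le (by simp), ih]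
    rw [zero_add, this]
    exact Nat.zero_le _

theorem LexDegreeAntitone.succ {t : ℕ} (hA : LexSuperadditive t) (hC : LexDegreeAntitone t)
    (hB : LexFinalMax (t + 1 + 1)) : LexDegreeAntitone (t + 1) := by
  intro n
  induction n with
  | zero => intro b _; simp [lexGain]
  | succ n ihn =>
    intro b
    induction b using Nat.strong_induction_on with
    | _ b ihb =>
      intro hb
      cases n with
      | zero => simp [lexGain]
      | succ n =>
        have hN1 := Nat.multichoose_succ_succ (n + 1) t
        have hN2 := Nat.multichoose_succ_succ n (t + 1)
        have hpos := multichoose_succ_pos n (t + 1)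
        have hle := multichoose_le_succ_right n (t + 1)
        by_cases hb1 : b ≤ Nat.multichoose (n + 1) (t + 1)
        · rw [lexGain_of_le hb1, lexGain_of_le (hb1.trans hle)]
          exact ihn b hb1
        · obtain ⟨β, rfl⟩ := Nat.exists_eq_add_of_le (not_le.mp hb1).le
          have hchain : ∀ x, x < Nat.multichoose (n + 1) (t + 1) + β →
              x ≤ Nat.multichoose (n + 1 + 1) t →
              lexGain (t + 1 + 1) (n + 1 + 1) x ≤ lexGain t (n + 1 + 1) x := fun x hx hx' =>
            (ihb x hx (by rw [hN1]; omega)).trans (hC (n + 1 + 1) x hx')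
          rw [lexGain_add t (n + 1) β]
          by_cases hb2 : Nat.multichoose (n + 1) (t + 1) + β ≤ Nat.multichoose (n + 1) (t + 1 + 1)
          · rw [lexGain_of_le hb2]
            have h1 := hB.le (n := n + 1) (u := Nat.multichoose (n + 1) (t + 1) + β)
              (v := Nat.multichoose n (t + 1 + 1)) hb2 (by omega) (by omega)
            have h2 := hchain β (by omega) (by omega)
            rw [lexGain_of_le (by omega)] at h2
            have h3 := lexGain_add (t + 1) n (Nat.multichoose (n + 1) (t + 1))
            rw [← hN2] at h3
            have h4 : lexGain (t + 1 + 1) (n + 1) (Nat.multichoose n (t + 1 + 1)) =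
              lexGain (t + 1 + 1) n (Nat.multichoose n (t + 1 + 1)) := lexGain_of_le le_rfl
            rw [show Nat.multichoose (n + 1) (t + 1) + β + Nat.multichoose n (t + 1 + 1) -
              Nat.multichoose (n + 1) (t + 1 + 1) = β by omega] at h1
            omega
          · obtain ⟨γ, hγ⟩ := Nat.exists_eq_add_of_le (not_le.mp hb2).le
            have hβ : β = γ + Nat.multichoose n (t + 1 + 1) := by omega
            rw [hγ, lexGain_add (t + 1) (n + 1) γ]
            have h3 := lexGain_add (t + 1) n (Nat.multichoose (n + 1) (t + 1))
            rw [← hN2] at h3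
            have h2 := hchain (Nat.multichoose n (t + 1 + 1)) (by omega) (by omega)
            rw [lexGain_of_le (by omega), lexGain_of_le le_rfl] at h2
            have h4 := hC (n + 1 + 1) γ (by omega)
            have h5 := hA (n + 1 + 1) γ (Nat.multichoose n (t + 1 + 1)) (by omega)
            rw [← hβ] at h5
            omega

theorem LexSuperadditive.succ {t : ℕ} (hA : LexSuperadditive t) (hC : LexDegreeAntitone t)
    (hB : LexFinalMax (t + 1)) : LexSuperadditive (t + 1) := by
  intro n
  induction n with
  | zero => intro u v h; simp [lexGain]
  | succ n ih =>
    intro u v h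
    wlog huv : v ≤ u generalizing u v
    · have := this v u (by omega) (by omega)
      rw [add_comm u v]; omega
    rw [Nat.multichoose_succ_succ] at h
    by_cases h1 : u + v ≤ Nat.multichoose n (t + 1)
    · rw [lexGain_of_le h1, lexGain_of_le (by omega), lexGain_of_le (by omega)]
      exact ih u v h1
    · by_cases h2 : Nat.multichoose n (t + 1) ≤ u
      · obtain ⟨α, rfl⟩ := Nat.exists_eq_add_of_le h2
        rw [add_assoc, lexGain_add, lexGain_add]
        have h3 := hA (n + 1) α v (by omega)
        have h4 := hC (n + 1) v (by omega)
        omega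
      · obtain ⟨β, hβ⟩ := Nat.exists_eq_add_of_le (not_le.mp h1).le
        have h3 := hB.le (n := n) (u := u) (v := v) (by omega) (by omega) (by omega)
        have h4 := hC (n + 1) β (by omega)
        rw [lexGain_of_le (by omega)] at h4
        rw [hβ, lexGain_add, lexGain_of_le (by omega), lexGain_of_le (by omega)]
        rw [show u + v - Nat.multichoose n (t + 1) = β by omega] at h3
        omega

theorem lexWindows (t : ℕ) :
    (LexSuperadditive t ∧ LexFinalMax t ∧ LexDegreeAntitone t) ∧
      LexSuperadditive (t + 1) ∧ LexFinalMax (t + 1) := by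
  induction t with
  | zero =>
    have hA : LexSuperadditive 0 := by
      intro n u v h
      simp only [Nat.multichoose_zero_right] at h
      rcases Nat.eq_zero_or_pos u with rfl | hu
      · simp [lexGain_zero_right]
      · obtain rfl : v = 0 := by omega
        simp [lexGain_zero_right]
    have hB : LexFinalMax 0 := by
      intro n u v hu hv h
      simp only [Nat.multichoose_zero_right] at *
      omega
    have hB' := hB.succ hA
    exact ⟨⟨hA, hB, lexDegreeAntitone_zero⟩, hA.succ lexDegreeAntitone_zero hB', hB'⟩
  | succ t ih =>
    obtain ⟨⟨hA, hB, hC⟩, hA', hB'⟩ := ih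
    have hB'' := hB'.succ hA'
    have hC' := hC.succ hA hB''
    exact ⟨⟨hA', hB', hC'⟩, hA'.succ hC' hB'', hB''⟩

theorem lexSuperadditive (t : ℕ) : LexSuperadditive t := (lexWindows t).1.1

theorem lexFinalMax (t : ℕ) : LexFinalMax t := (lexWindows t).1.2.1

theorem lexDegreeAntitone (t : ℕ) : LexDegreeAntitone t := (lexWindows t).1.2.2

theorem lexGain_one (n b : ℕ) (hb : b ≤ n) : lexGain 1 n b = b.choose 2 := by
  induction n with
  | zero =>
    obtain rfl : b = 0 := by omega
    simp [lexGain]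
  | succ n ih =>
    rcases hb.lt_or_eq with hb | rfl
    · rw [lexGain_of_le (by simp; omega), ih (by omega)]
    · have := lexGain_multichoose 1 n
      simp only [Nat.multichoose_one_right] at this
      rw [this, Nat.multichoose_eq]
      simp

theorem add_lexGain_multichoose (t n : ℕ) :
    Nat.multichoose n (t + 1) + lexGain (t + 1) n (Nat.multichoose n (t + 1)) =
      Nat.multichoose n (t + 1 + 1) := by
  cases n with
  | zero => simp [lexGain]
  | succ n => rw [lexGain_multichoose, Nat.multichoose_succ_succ n (t + 1), add_comm]

theorem add_lexGain_le_lexGain_add {t p γ : ℕ} (h : γ ≤ Nat.multichoose p (t + 1)) :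
    γ + lexGain (t + 1) p γ ≤ lexGain (t + 1) (p + 1) (γ + Nat.multichoose (p + 1) t) := by
  induction t generalizing p γ with
  | zero =>
    simp only [zero_add, Nat.multichoose_one_right, Nat.multichoose_zero_right] at *
    rw [lexGain_one _ _ h, lexGain_one _ _ (by omega), Nat.choose_succ_succ' γ 1]
    simp
  | succ t iht =>
    induction p generalizing γ with
    | zero =>
      obtain rfl : γ = 0 := by simpa using h
      simp [lexGain_zero_right]
    | succ q ihq =>
      by_cases h1 : γ ≤ Nat.multichoose q (t + 1 + 1)
      · rw [lexGain_of_le h1]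
        refine (ihq h1).trans ?_
        have h2 := Nat.multichoose_succ_succ q (t + 1)
        rw [← lexGain_of_le (n := q + 1) (by omega)]
        exact lexGain_mono _ _ (by
          have : Nat.multichoose (q + 1) (t + 1) ≤ Nat.multichoose (q + 1 + 1) (t + 1) :=
            multichoose_mono_left t (Nat.le_succ _)
          omega)
      · obtain ⟨γ, rfl⟩ := Nat.exists_eq_add_of_le (not_le.mp h1).le
        have h2 := Nat.multichoose_succ_succ q (t + 1)
        have h3 := Nat.multichoose_succ_succ (q + 1) t
        have h4 := iht (p := q + 1) (γ := γ) (by omega)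
        have h5 := add_lexGain_multichoose (t + 1) q
        have h6 := lexGain_multichoose (t + 1 + 1) q
        rw [show Nat.multichoose q (t + 1 + 1) + γ + Nat.multichoose (q + 1 + 1) (t + 1) =
          Nat.multichoose (q + 1) (t + 1 + 1) + (γ + Nat.multichoose (q + 1 + 1) t) by omega,
          lexGain_add, lexGain_add]
        omega

/-- The numerical inequality behind Macaulay's growth bound. -/
theorem lexGain_slice {t n b₀ b₁ : ℕ} (h₀ : b₀ ≤ Nat.multichoose n (t + 1))
    (h₁ : b₁ ≤ Nat.multichoose (n + 1) t) :
    b₀ + lexGain (t + 1) n b₀ ≤ lexGain (t + 1) (n + 1) (b₀ + b₁) ∨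
      lexGain (t + 1) n b₀ + lexGain t (n + 1) b₁ ≤ lexGain (t + 1) (n + 1) (b₀ + b₁) := by
  induction t generalizing n b₀ b₁ with
  | zero =>
    simp only [zero_add, Nat.multichoose_one_right, Nat.multichoose_zero_right] at *
    rw [lexGain_one _ _ h₀, lexGain_one _ _ (by omega)]
    rcases Nat.le_one_iff_eq_zero_or_eq_one.mp h₁ with rfl | rfl
    · right; simp [lexGain]
    · left; rw [Nat.choose_succ_succ' b₀ 1]; simp
  | succ t iht =>
    induction n generalizing b₀ b₁ with
    | zero =>
      obtain rfl : b₀ = 0 := by simpa using h₀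
      left; simp [lexGain_zero_right]
    | succ q ihq =>
      have hP := Nat.multichoose_succ_succ q (t + 1)
      have hS := Nat.multichoose_succ_succ (q + 1) t
      have hN := Nat.multichoose_succ_succ (q + 1) (t + 1)
      by_cases hb : b₀ + b₁ ≤ Nat.multichoose (q + 1) (t + 1 + 1)
      · rw [lexGain_of_le hb]
        by_cases h0 : b₀ ≤ Nat.multichoose q (t + 1 + 1)
        · rw [lexGain_of_le h0]
          by_cases h1 : b₁ ≤ Nat.multichoose (q + 1) (t + 1)
          · rw [lexGain_of_le h1]
            exact ihq h0 h1
          · left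
            exact (add_lexGain_le_lexGain_add h0).trans (lexGain_mono _ _ (by omega))
        · right
          obtain ⟨β, rfl⟩ := Nat.exists_eq_add_of_le (not_le.mp h0).le
          have h3 := lexSuperadditive (t + 1) (q + 1) β b₁ (by omega)
          rw [Nat.add_assoc _ β b₁, lexGain_add, lexGain_add, lexGain_of_le (b := b₁) (by omega)]
          omega
      · obtain ⟨β, hβ⟩ := Nat.exists_eq_add_of_le (not_le.mp hb).le
        rw [hβ, lexGain_add]
        by_cases h0 : b₀ ≤ Nat.multichoose q (t + 1 + 1)
        · left
          have h2 := lexGain_mono (t + 1 + 1) q h0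
          have h3 := add_lexGain_multichoose (t + 1) q
          have h4 := lexGain_multichoose (t + 1 + 1) q
          rw [lexGain_of_le h0]
          omega
        · obtain ⟨γ, rfl⟩ := Nat.exists_eq_add_of_le (not_le.mp h0).le
          have h3 := add_lexGain_multichoose (t + 1) q
          have h4 := lexGain_multichoose (t + 1 + 1) q
          have h5 := lexGain_add (t + 1) q (Nat.multichoose (q + 1) (t + 1))
          rw [← hP] at h5
          have h6 : lexGain (t + 1) (q + 1 + 1) γ = lexGain (t + 1) (q + 1) γ :=
            lexGain_of_le (by omega)
          have h7 : lexGain (t + 1) (q + 1 + 1) (Nat.multichoose (q + 1) (t + 1)) =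
            lexGain (t + 1) (q + 1) (Nat.multichoose (q + 1) (t + 1)) := lexGain_of_le le_rfl
          rw [lexGain_add]
          by_cases hγ : β ≤ γ
          · right
            have h8 := (lexFinalMax (t + 1)).le (n := q + 1) (u := γ) (v := b₁) (by omega)
              (by omega) (by omega)
            rw [show γ + b₁ - Nat.multichoose (q + 1) (t + 1) = β by omega] at h8
            rw [lexGain_of_le (b := β) (by omega), lexGain_of_le (b := b₁) (by omega)]
            omega
          · obtain ⟨δ, rfl⟩ := Nat.exists_eq_add_of_le (not_le.mp hγ).le
            obtain rfl : b₁ = Nat.multichoose (q + 1) (t + 1) + δ := by omega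
            rw [lexGain_add]
            rcases iht (n := q + 1) (b₀ := γ) (b₁ := δ) (by omega) (by omega) with h8 | h8
            · left; omega
            · right; omega

theorem macUpper_eq_add_lexGain {d n s : ℕ} (h : s < Nat.multichoose n d) :
    macUpper d s = s + lexGain d n s := by
  induction d generalizing n s with
  | zero =>
    obtain rfl : s = 0 := by simpa using h
    simp [macUpper, lexGain]
  | succ d ih =>
    rcases Nat.eq_zero_or_pos s with rfl | hs
    · simp [macUpper, lexGain_zero_right]
    obtain ⟨p, hp, hp'⟩ :
        ∃ p, Nat.multichoose p (d + 1) ≤ s ∧ s < Nat.multichoose (p + 1) (d + 1) := by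
      induction n with
      | zero => simp at h
      | succ n ihn =>
        by_cases hn : s < Nat.multichoose n (d + 1)
        · exact ihn hn
        · exact ⟨n, not_lt.mp hn, h⟩
    have hpn : p + 1 ≤ n := by
      by_contra! hn
      have : Nat.multichoose n (d + 1) ≤ Nat.multichoose p (d + 1) :=
        multichoose_mono_left d (by omega)
      omega
    have hsup : sSup {a : ℕ | Nat.choose a (d + 1) ≤ s} = p + d := by
      refine IsGreatest.csSup_eq ⟨?_, fun a ha => ?_⟩
      · simpa [Nat.multichoose_eq] using hp
      · by_contra! hlt
        have h1 : (p + 1 + d).choose (d + 1) ≤ a.choose (d + 1) :=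
          Nat.choose_le_choose _ (by omega)
        have h2 : a.choose (d + 1) ≤ s := ha
        rw [Nat.multichoose_eq] at hp'
        rw [show p + 1 + (d + 1) - 1 = p + 1 + d by omega] at hp'
        omega
    obtain ⟨x, rfl⟩ := Nat.exists_eq_add_of_le hp
    have hx : x < Nat.multichoose (p + 1) d := by
      rw [Nat.multichoose_succ_succ] at hp'; omega
    have h1 : (p + d).choose (d + 1) = Nat.multichoose p (d + 1) := by
      rw [Nat.multichoose_eq]; rfl
    have h2 : (p + d + 1).choose (d + 2) = Nat.multichoose p (d + 1 + 1) := by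
      rw [Nat.multichoose_eq]; rfl
    have h3 := add_lexGain_multichoose d p
    rw [macUpper, if_neg hs.ne', hsup, h1, h2, Nat.add_sub_cancel_left, ih hx,
      lexGain_eq_of_le hpn hp'.le, lexGain_add]
    omega

theorem multichoose_mono_right (n : ℕ) : Monotone (Nat.multichoose (n + 1)) :=
  monotone_nat_of_le_succ fun t => multichoose_le_succ_right n t

theorem lexGain_antitone_degree {n s t b : ℕ} (hts : t ≤ s)
    (hb : b ≤ Nat.multichoose (n + 1) t) : lexGain s (n + 1) b ≤ lexGain t (n + 1) b := by
  induction s, hts using Nat.le_induction with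
  | base => rfl
  | succ s hs ih =>
    exact (lexDegreeAntitone s _ _ (hb.trans (multichoose_mono_right n hs))).trans ih

/-- Final windows of the same length have the same weight in every degree. -/
theorem lexGain_suffix {n s t c : ℕ} (hts : t ≤ s) (hc : c ≤ Nat.multichoose (n + 1) t) :
    lexGain s (n + 1) (Nat.multichoose (n + 1) s) +
        lexGain t (n + 1) (Nat.multichoose (n + 1) t - c) =
      lexGain t (n + 1) (Nat.multichoose (n + 1) t) +
        lexGain s (n + 1) (Nat.multichoose (n + 1) s - c) := by
  induction s, hts using Nat.le_induction with
  | base => rfl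
  | succ s hs ih =>
    have h1 := multichoose_mono_right n hs
    rw [Nat.multichoose_succ_succ, Nat.add_sub_assoc (hc.trans h1), lexGain_add, lexGain_add]
    omega

/-- The weight of the first `x` monomials of degrees `t, t + 1, …, t + d - 1` in `e` variables,
where every degree is filled before the next one is started. -/
def lexFill (e : ℕ) : ℕ → ℕ → ℕ → ℕ
  | 0, _, _ => 0
  | d + 1, t, x =>
    lexGain t e (min x (Nat.multichoose e t)) + lexFill e d (t + 1) (x - Nat.multichoose e t)

theorem lexFill_zero_right (e d t : ℕ) : lexFill e d t 0 = 0 := by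
  induction d generalizing t with
  | zero => rfl
  | succ d ih => simp [lexFill, ih, lexGain_zero_right]

theorem lexFill_succ_of_le {e d t x : ℕ} (h : x ≤ Nat.multichoose e t) :
    lexFill e (d + 1) t x = lexGain t e x := by
  simp [lexFill, h, lexFill_zero_right]

theorem lexFill_succ_add (e d t x : ℕ) :
    lexFill e (d + 1) t (Nat.multichoose e t + x) =
      lexGain t e (Nat.multichoose e t) + lexFill e d (t + 1) x := by
  simp [lexFill]

theorem lexFill_le_lexGain {e d t x : ℕ} (h : x ≤ Nat.multichoose e t) :
    lexFill e d t x ≤ lexGain t e x := by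
  cases d with
  | zero => exact Nat.zero_le _
  | succ d => exact (lexFill_succ_of_le h).le

theorem lexFill_add_suffix_le {n d t c x : ℕ} (hc : c ≤ Nat.multichoose (n + 1) t) (hcx : c ≤ x) :
    lexFill (n + 1) d (t + 1) x + lexGain t (n + 1) (Nat.multichoose (n + 1) t - c) ≤
      lexGain t (n + 1) (Nat.multichoose (n + 1) t) + lexFill (n + 1) d (t + 1) (x - c) := by
  induction d generalizing t c x with
  | zero => simpa [lexFill] using lexGain_mono t (n + 1) (Nat.sub_le _ _)
  | succ d ih =>
    have hM := multichoose_le_succ_right n t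
    have hM' := multichoose_le_succ_right n (t + 1)
    by_cases hx : x ≤ Nat.multichoose (n + 1) (t + 1)
    · rw [lexFill_succ_of_le hx, lexFill_succ_of_le (by omega)]
      have h1 := lexGain_suffix (Nat.le_add_right t 1) hc
      have h2 := (lexFinalMax (t + 1)).le hx
        (Nat.sub_le (Nat.multichoose (n + 1) (t + 1)) c) (by omega)
      rw [show x + (Nat.multichoose (n + 1) (t + 1) - c) - Nat.multichoose (n + 1) (t + 1) =
        x - c by omega] at h2
      omega
    · obtain ⟨y, rfl⟩ := Nat.exists_eq_add_of_le (not_le.mp hx).le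
      rw [lexFill_succ_add]
      by_cases hy : c ≤ y
      · rw [Nat.add_sub_assoc hy, lexFill_succ_add]
        have h1 := lexGain_suffix (Nat.le_add_right t 1) hc
        have h2 := ih (t := t + 1) (by omega) hy
        omega
      · have h1 := lexGain_suffix (n := n) (c := c - y) (Nat.le_add_right t 1) (by omega)
        have h2 : lexFill (n + 1) d (t + 1 + 1) y ≤ lexGain (t + 1 + 1) (n + 1) y :=
          lexFill_le_lexGain (by omega)
        have h3 : lexGain (t + 1 + 1) (n + 1) y ≤ lexGain t (n + 1) y :=
          lexGain_antitone_degree (by omega) (by omega)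
        have h4 := lexSuperadditive t (n + 1) y (Nat.multichoose (n + 1) t - c) (by omega)
        rw [show y + (Nat.multichoose (n + 1) t - c) = Nat.multichoose (n + 1) t - (c - y) by
          omega] at h4
        rw [show Nat.multichoose (n + 1) (t + 1) + y - c =
          Nat.multichoose (n + 1) (t + 1) - (c - y) by omega, lexFill_succ_of_le (by omega)]
        omega

theorem lexGain_add_lexFill_le {n d t a x : ℕ} (ha : a ≤ Nat.multichoose (n + 1) t) :
    lexGain t (n + 1) a + lexFill (n + 1) d (t + 1) x ≤ lexFill (n + 1) (d + 1) t (a + x) := by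
  by_cases hx : a + x ≤ Nat.multichoose (n + 1) t
  · rw [lexFill_succ_of_le hx]
    have h1 : lexFill (n + 1) d (t + 1) x ≤ lexGain (t + 1) (n + 1) x :=
      lexFill_le_lexGain (by have := multichoose_le_succ_right n t; omega)
    have h2 := lexDegreeAntitone t (n + 1) x (by omega)
    have h3 := lexSuperadditive t (n + 1) a x hx
    omega
  · have h1 := lexFill_add_suffix_le (n := n) (d := d) (t := t)
      (c := Nat.multichoose (n + 1) t - a) (x := x) (by omega) (by omega)
    rw [show Nat.multichoose (n + 1) t - (Nat.multichoose (n + 1) t - a) = a by omega] at h1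
    rw [show a + x = Nat.multichoose (n + 1) t + (x - (Nat.multichoose (n + 1) t - a)) by omega,
      lexFill_succ_add]
    omega

theorem lexFill_le_succ (n d t x : ℕ) :
    lexFill (n + 1) d (t + 1) x ≤ lexFill (n + 1) (d + 1) t x := by
  simpa [lexGain_zero_right] using lexGain_add_lexFill_le (n := n) (d := d) (x := x)
    (Nat.zero_le (Nat.multichoose (n + 1) t))

theorem sum_lexGain_le_lexFill {n d t : ℕ} {h : ℕ → ℕ}
    (hh : ∀ i, h i ≤ Nat.multichoose (n + 1) (t + i)) :
    ∑ i ∈ Finset.range d, lexGain (t + i) (n + 1) (h i) ≤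
      lexFill (n + 1) d t (∑ i ∈ Finset.range d, h i) := by
  induction d generalizing t h with
  | zero => simp [lexFill]
  | succ d ih =>
    have h1 := ih (t := t + 1) (h := fun i => h (i + 1)) fun i => by
      simpa only [Nat.add_assoc, Nat.add_comm 1] using hh (i + 1)
    have h2 := lexGain_add_lexFill_le (d := d) (x := ∑ i ∈ Finset.range d, h (i + 1)) (hh 0)
    simp only [Nat.add_assoc, Nat.add_comm 1, Nat.add_zero] at h1 h2
    rw [Finset.sum_range_succ', Finset.sum_range_succ', add_comm, add_comm _ (h 0)]
    simp only [Nat.add_zero]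
    omega

theorem lexGain_add_lt_of_lt {n s t a g : ℕ} (hts : t ≤ s) (ha : a < Nat.multichoose (n + 1) t)
    (hg : g < Nat.multichoose (n + 1) s) (hag : Nat.multichoose (n + 1) t ≤ a + g) :
    lexGain t (n + 1) a + lexGain s (n + 1) g <
      lexGain t (n + 1) (Nat.multichoose (n + 1) t) +
        lexGain s (n + 1) (a + g - Nat.multichoose (n + 1) t) := by
  have h1 := multichoose_mono_right n hts
  have h2 := lexGain_suffix (n := n) (c := Nat.multichoose (n + 1) t - a) hts (by omega)
  have h3 := lexFinalMax s (n + 1) g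
    (Nat.multichoose (n + 1) s - (Nat.multichoose (n + 1) t - a)) hg (by omega) (by omega)
  rw [show g + (Nat.multichoose (n + 1) s - (Nat.multichoose (n + 1) t - a)) -
    Nat.multichoose (n + 1) s = a + g - Nat.multichoose (n + 1) t by omega] at h3
  rw [show Nat.multichoose (n + 1) t - (Nat.multichoose (n + 1) t - a) = a by omega] at h2
  omega

theorem lexGain_add_sum_lt {n d s t a : ℕ} {g : ℕ → ℕ} (hts : t < s)
    (ha : a < Nat.multichoose (n + 1) t) (hg : ∀ i, g i < Nat.multichoose (n + 1) (s + i))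
    (hag : Nat.multichoose (n + 1) t ≤ a + ∑ i ∈ Finset.range d, g i) :
    lexGain t (n + 1) a + ∑ i ∈ Finset.range d, lexGain (s + i) (n + 1) (g i) <
      lexGain t (n + 1) (Nat.multichoose (n + 1) t) +
        lexFill (n + 1) d s (a + ∑ i ∈ Finset.range d, g i - Nat.multichoose (n + 1) t) := by
  induction d generalizing s a g with
  | zero => simp at hag; omega
  | succ d ih =>
    have hg' : ∀ i, g (i + 1) < Nat.multichoose (n + 1) (s + 1 + i) := fun i => by
      simpa only [Nat.add_assoc, Nat.add_comm 1] using hg (i + 1)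
    have hst := multichoose_mono_right n hts.le
    have hg0 := hg 0
    rw [Finset.sum_range_succ'] at hag ⊢
    rw [Finset.sum_range_succ']
    simp only [Nat.add_zero] at hg0 ⊢
    by_cases h0 : a + g 0 < Nat.multichoose (n + 1) t
    · have h1 := ih (s := s + 1) (g := fun i => g (i + 1)) (by omega) h0 hg' (by omega)
      have h2 := lexFill_le_succ n d s
        (a + g 0 + ∑ i ∈ Finset.range d, g (i + 1) - Nat.multichoose (n + 1) t)
      have h3 : lexGain s (n + 1) (g 0) ≤ lexGain t (n + 1) (g 0) :=
        lexGain_antitone_degree hts.le (by omega)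
      have h4 := lexSuperadditive t (n + 1) a (g 0) h0.le
      rw [show a + (∑ i ∈ Finset.range d, g (i + 1) + g 0) =
        a + g 0 + ∑ i ∈ Finset.range d, g (i + 1) by omega]
      simp only [Nat.add_assoc, Nat.add_comm 1] at h1 h2 ⊢
      omega
    · have h1 := lexGain_add_lt_of_lt hts.le ha hg0 (not_lt.mp h0)
      have h2 := sum_lexGain_le_lexFill (d := d) fun i => (hg' i).le
      have h3 := lexGain_add_lexFill_le (n := n) (d := d) (t := s)
        (a := a + g 0 - Nat.multichoose (n + 1) t) (x := ∑ i ∈ Finset.range d, g (i + 1))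
        (by omega)
      rw [show a + (∑ i ∈ Finset.range d, g (i + 1) + g 0) - Nat.multichoose (n + 1) t =
        a + g 0 - Nat.multichoose (n + 1) t + ∑ i ∈ Finset.range d, g (i + 1) by omega]
      simp only [Nat.add_assoc, Nat.add_comm 1] at h2 h3 ⊢
      omega

/-- If some degree `t + k` and all later degrees are not filled although there are enough
monomials to fill degrees `t, …, t + k`, the weight is strictly smaller than that of the filling. -/
theorem sum_lexGain_lt_lexFill {n d t k : ℕ} {h : ℕ → ℕ}
    (hh : ∀ i, h i ≤ Nat.multichoose (n + 1) (t + i))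
    (hk : ∀ i, k ≤ i → h i < Nat.multichoose (n + 1) (t + i))
    (hsum : ∑ i ∈ Finset.range (k + 1), Nat.multichoose (n + 1) (t + i) ≤
      ∑ i ∈ Finset.range d, h i) :
    ∑ i ∈ Finset.range d, lexGain (t + i) (n + 1) (h i) <
      lexFill (n + 1) d t (∑ i ∈ Finset.range d, h i) := by
  induction k generalizing d t h with
  | zero =>
    cases d with
    | zero => have := multichoose_succ_pos n t; simp at hsum; omega
    | succ d =>
      have hg : ∀ i, h (i + 1) < Nat.multichoose (n + 1) (t + 1 + i) := fun i => by
        simpa only [Nat.add_assoc, Nat.add_comm 1] using hk (i + 1) (by omega)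
      rw [Finset.sum_range_succ', Finset.sum_range_succ' h] at hsum
      rw [Finset.sum_range_succ', Finset.sum_range_succ' h]
      simp only [Finset.range_zero, Finset.sum_empty, Nat.add_zero, Nat.zero_add] at hsum ⊢
      have h1 := lexGain_add_sum_lt (d := d) (Nat.lt_add_one t) (hk 0 le_rfl) hg (by omega)
      rw [← lexFill_succ_add, Nat.add_sub_cancel' (by omega), add_comm (h 0)] at h1
      simp only [Nat.add_assoc, Nat.add_comm 1] at h1 ⊢
      omega
  | succ k ih =>
    cases d with
    | zero =>
      have := multichoose_succ_pos n t
      rw [Finset.sum_range_succ'] at hsum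
      simp at hsum
      omega
    | succ d =>
      have hh0 := hh 0
      rw [Finset.sum_range_succ', Finset.sum_range_succ' h] at hsum
      have h1 := ih (d := d) (t := t + 1) (h := fun i => h (i + 1))
        (fun i => by simpa only [Nat.add_assoc, Nat.add_comm 1] using hh (i + 1))
        (fun i hi => by
          simpa only [Nat.add_assoc, Nat.add_comm 1] using hk (i + 1) (by omega))
        (by simp only [Nat.add_assoc, Nat.add_comm 1] at hsum hh0 ⊢; omega)
      have h2 := lexGain_add_lexFill_le (d := d) (x := ∑ i ∈ Finset.range d, h (i + 1)) hh0
      rw [Finset.sum_range_succ', Finset.sum_range_succ', add_comm _ (h 0)]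
      simp only [Nat.add_assoc, Nat.add_comm 1, Nat.add_zero] at h1 h2 ⊢
      omega

theorem lexFill_sum_add_le {e d t r s : ℕ} (hs : s ≤ Nat.multichoose e (t + r)) :
    lexFill e d t (∑ i ∈ Finset.range r, Nat.multichoose e (t + i) + s) ≤
      ∑ i ∈ Finset.range r, lexGain (t + i) e (Nat.multichoose e (t + i)) +
        lexGain (t + r) e s := by
  induction r generalizing d t with
  | zero => simpa using lexFill_le_lexGain hs
  | succ r ih =>
    cases d with
    | zero => exact Nat.zero_le _
    | succ d =>
      have h1 := ih (d := d) (t := t + 1) (by rwa [Nat.add_assoc, Nat.add_comm 1])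
      rw [Finset.sum_range_succ', Finset.sum_range_succ']
      simp only [Nat.add_assoc, Nat.add_comm 1, Nat.add_zero] at h1 ⊢
      rw [show ∀ a b : ℕ, a + (b + s) = b + (a + s) by omega, lexFill_succ_add]
      omega

theorem sum_multichoose (e r : ℕ) :
    ∑ i ∈ Finset.range (r + 1), Nat.multichoose e i = Nat.multichoose (e + 1) r := by
  induction r with
  | zero => simp
  | succ r ih => rw [Finset.sum_range_succ, ih, Nat.multichoose_succ_succ, add_comm]

theorem one_add_sum_lexGain_multichoose (n r : ℕ) :
    1 + ∑ i ∈ Finset.range r, lexGain i (n + 1) (Nat.multichoose (n + 1) i) =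
      Nat.multichoose (n + 1) r := by
  induction r with
  | zero => simp
  | succ r ih =>
    rw [Finset.sum_range_succ, lexGain_multichoose, ← add_assoc, ih, Nat.multichoose_succ_succ,
      add_comm]

theorem one_add_lexFill_le_mathcalC {n m : ℕ} (d : ℕ) (hm : 0 < m) :
    1 + lexFill (n + 1) d 0 m ≤ mathcalC (n + 1) m := by
  have hne : {r : ℕ | 0 < r ∧ m < Nat.choose (n + 1 + r) r}.Nonempty := by
    refine ⟨m, hm, ?_⟩
    have h1 : (1 + m).choose m ≤ (n + 1 + m).choose m := Nat.choose_le_choose _ (by omega)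
    rw [add_comm 1 m, Nat.choose_succ_self_right] at h1
    omega
  obtain ⟨hr0, hr⟩ : 0 < macR (n + 1) m ∧ m < Nat.choose (n + 1 + macR (n + 1) m)
    (macR (n + 1) m) := Nat.sInf_mem hne
  have hmin : Nat.choose (n + 1 + macR (n + 1) m - 1) (macR (n + 1) m - 1) ≤ m := by
    by_contra! hlt
    rcases Nat.eq_zero_or_pos (macR (n + 1) m - 1) with h0 | h0
    · rw [h0] at hlt; simp at hlt; omega
    · have : macR (n + 1) m ≤ macR (n + 1) m - 1 :=
        Nat.sInf_le ⟨h0, by rwa [← Nat.add_sub_assoc hr0]⟩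
      omega
  rw [mathcalC]
  generalize macR (n + 1) m = r at hr0 hr hmin
  obtain ⟨q, rfl⟩ := Nat.exists_eq_succ_of_ne_zero hr0.ne'
  have h1 : (n + 1 + q.succ - 1).choose (q.succ - 1) = Nat.multichoose (n + 1 + 1) q := by
    rw [Nat.multichoose_eq]; congr 1; omega
  have h2 : (n + 1 + q.succ - 1).choose q.succ = Nat.multichoose (n + 1) (q + 1) := by
    rw [Nat.multichoose_eq]
  have h3 : (n + 1 + q.succ).choose q.succ = Nat.multichoose (n + 1 + 1) (q + 1) := by
    rw [Nat.multichoose_eq]; congr 1; omega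
  rw [h1] at hmin
  rw [h3, Nat.multichoose_succ_succ] at hr
  rw [h1, h2]
  obtain ⟨s, rfl⟩ := Nat.exists_eq_add_of_le hmin
  have hs : s < Nat.multichoose (n + 1) (q + 1) := by omega
  rw [Nat.add_sub_cancel_left, macUpper_eq_add_lexGain hs]
  have h4 := lexFill_sum_add_le (d := d) (t := 0) (r := q + 1) (s := s) (e := n + 1)
    (by simpa using hs.le)
  simp only [Nat.zero_add, sum_multichoose] at h4
  have h5 := one_add_sum_lexGain_multichoose n (q + 1)
  omega

section Monomials

open Finsupp

variable {σ : Type*}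

theorem single_one_le {f : σ →₀ ℕ} {i : σ} (hi : f i ≠ 0) : single i 1 ≤ f :=
  single_le_iff.mpr (Nat.one_le_iff_ne_zero.mpr hi)

/-- The number of elements of total degree `t` of a set of monomials in the variables `s`. -/
def hilbert (s : Finset σ) (L : Finset (σ →₀ ℕ)) (t : ℕ) : ℕ :=
  (L.filter fun f => ∑ i ∈ s, f i = t).card

theorem sum_hilbert {s : Finset σ} {L : Finset (σ →₀ ℕ)} {d : ℕ}
    (hd : ∀ f ∈ L, ∑ i ∈ s, f i < d) : ∑ t ∈ Finset.range d, hilbert s L t = L.card :=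
  (Finset.card_eq_sum_card_fiberwise fun f hf => by simpa using hd f hf).symm

variable [DecidableEq σ]

theorem sub_single_mem_finsuppAntidiag {s : Finset σ} {n : ℕ} {f : σ →₀ ℕ} {i : σ}
    (hf : f ∈ s.finsuppAntidiag (n + 1)) (hi : f i ≠ 0) :
    f - single i 1 ∈ s.finsuppAntidiag n := by
  rw [Finset.mem_finsuppAntidiag] at hf ⊢
  have his : i ∈ s := hf.2 (mem_support_iff.mpr hi)
  refine ⟨?_, (support_mono tsub_le_self).trans hf.2⟩
  have h1 : ∑ j ∈ s, (f - single i 1 + single i 1 : σ →₀ ℕ) j = n + 1 := by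
    rw [tsub_add_cancel_of_le (single_one_le hi), hf.1]
  simp only [Finsupp.add_apply, Finset.sum_add_distrib] at h1
  rw [Finset.sum_eq_single_of_mem i his (fun j _ hj => single_eq_of_ne hj),
    single_eq_same] at h1
  exact Nat.add_right_cancel h1

theorem mem_finsuppAntidiag_of_insert {s : Finset σ} {n : ℕ} {f : σ →₀ ℕ} {y : σ} (hy : y ∉ s)
    (hf : f ∈ (insert y s).finsuppAntidiag n) (h0 : f y = 0) : f ∈ s.finsuppAntidiag n := by
  rw [Finset.mem_finsuppAntidiag] at hf ⊢
  rw [Finset.sum_insert hy, h0, zero_add] at hf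
  exact ⟨hf.1, (Finset.subset_insert_iff_of_notMem (by simpa using h0)).mp hf.2⟩

theorem card_filter_add_card_image_sub_single (B : Finset (σ →₀ ℕ)) (y : σ) :
    (B.filter fun f => f y = 0).card +
      ((B.filter fun f => f y ≠ 0).image (· - single y 1)).card = B.card := by
  rw [Finset.card_image_of_injOn]
  · exact Finset.card_filter_add_card_filter_not _
  · intro f hf g hg hfg
    simp only [Finset.coe_filter, Set.mem_ofPred_eq] at hf hg
    exact (tsub_left_inj (single_one_le hf.2) (single_one_le hg.2)).mp hfg

theorem card_le_multichoose {B : Finset (σ →₀ ℕ)} {s : Finset σ} {t : ℕ}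
    (h : B ⊆ s.finsuppAntidiag t) : B.card ≤ Nat.multichoose s.card t :=
  (Finset.card_le_card h).trans (Finset.card_finsuppAntidiag_nat_eq_multichoose t).le

/-- Macaulay's growth bound: a set `U` of monomials of degree `t + 1` all of whose divisors of
degree `t` lie in `B`. -/
theorem card_le_card_add_lexGain {t : ℕ} {s : Finset σ} {B U : Finset (σ →₀ ℕ)}
    (hB : B ⊆ s.finsuppAntidiag t) (hU : U ⊆ s.finsuppAntidiag (t + 1))
    (h : ∀ v ∈ U, ∀ i, v i ≠ 0 → v - single i 1 ∈ B) :
    U.card ≤ B.card + lexGain t s.card B.card := by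
  induction t generalizing s B U with
  | zero =>
    have hU1 := card_le_multichoose hU
    rcases B.eq_empty_or_nonempty with rfl | hne
    · obtain rfl : U = ∅ := by
        rw [Finset.eq_empty_iff_forall_notMem]
        intro v hv
        have hv0 : v ≠ 0 := by
          rintro rfl
          simpa using hU hv
        obtain ⟨i, hi⟩ := Finsupp.ne_iff.mp hv0
        simpa using h v hv i hi
      simp
    · have := hne.card_pos
      simp only [zero_add, Nat.multichoose_one_right] at hU1
      simp only [lexGain, this.ne', if_false]
      omega
  | succ t iht =>
    induction s using Finset.induction_on generalizing B U with
    | empty =>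
      have := card_le_multichoose hU
      simp at this
      simp [this]
    | insert y s hy ihs =>
      have hBc := card_filter_add_card_image_sub_single B y
      have hUc := card_filter_add_card_image_sub_single U y
      set B₀ := B.filter fun f => f y = 0
      set U₀ := U.filter fun f => f y = 0
      set B₁ := (B.filter fun f => f y ≠ 0).image (· - single y 1) with hB₁
      set U₁ := (U.filter fun f => f y ≠ 0).image (· - single y 1) with hU₁
      have hB₀s : B₀ ⊆ s.finsuppAntidiag (t + 1) := fun f hf => by
        rw [Finset.mem_filter] at hf
        exact mem_finsuppAntidiag_of_insert hy (hB hf.1) hf.2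
      have hU₀s : U₀ ⊆ s.finsuppAntidiag (t + 1 + 1) := fun f hf => by
        rw [Finset.mem_filter] at hf
        exact mem_finsuppAntidiag_of_insert hy (hU hf.1) hf.2
      have hB₁s : B₁ ⊆ (insert y s).finsuppAntidiag t := fun f hf => by
        simp only [hB₁, Finset.mem_image, Finset.mem_filter] at hf
        obtain ⟨f, ⟨hf, hfy⟩, rfl⟩ := hf
        exact sub_single_mem_finsuppAntidiag (hB hf) hfy
      have hU₁s : U₁ ⊆ (insert y s).finsuppAntidiag (t + 1) := fun f hf => by
        simp only [hU₁, Finset.mem_image, Finset.mem_filter] at hf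
        obtain ⟨f, ⟨hf, hfy⟩, rfl⟩ := hf
        exact sub_single_mem_finsuppAntidiag (hU hf) hfy
      have h₀ : U₀.card ≤ B₀.card + lexGain (t + 1) s.card B₀.card := by
        refine ihs hB₀s hU₀s fun v hv i hi => ?_
        rw [Finset.mem_filter] at hv ⊢
        exact ⟨h v hv.1 i hi, by simp [hv.2]⟩
      have h₁ : U₁.card ≤ B₁.card + lexGain t (insert y s).card B₁.card := by
        refine iht hB₁s hU₁s fun v hv i hi => ?_
        simp only [hU₁, Finset.mem_image, Finset.mem_filter] at hv
        obtain ⟨v, ⟨hv, hvy⟩, rfl⟩ := hv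
        rw [tsub_apply] at hi
        simp only [hB₁, Finset.mem_image, Finset.mem_filter]
        refine ⟨v - single i 1, ⟨h v hv i (by omega), ?_⟩, tsub_right_comm⟩
        rw [tsub_apply]
        by_cases hiy : i = y
        · subst hiy; omega
        · rw [single_eq_of_ne (Ne.symm hiy)]; omega
      have h₂ : U₁.card ≤ B.card := by
        refine Finset.card_le_card fun v hv => ?_
        simp only [hU₁, Finset.mem_image, Finset.mem_filter] at hv
        obtain ⟨v, ⟨hv, hvy⟩, rfl⟩ := hv
        exact h v hv y hvy
      have hB₁c := card_le_multichoose hB₁s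
      rw [Finset.card_insert_of_notMem hy] at h₁ hB₁c ⊢
      rw [← hBc]
      rcases lexGain_slice (card_le_multichoose hB₀s) hB₁c with h₃ | h₃ <;> omega

theorem filter_sum_subset_finsuppAntidiag {s : Finset σ} {L : Finset (σ →₀ ℕ)}
    (hL : ∀ f ∈ L, f.support ⊆ s) (t : ℕ) :
    (L.filter fun f => ∑ i ∈ s, f i = t) ⊆ s.finsuppAntidiag t := fun f hf => by
  rw [Finset.mem_filter] at hf
  exact Finset.mem_finsuppAntidiag.mpr ⟨hf.2, hL f hf.1⟩

theorem hilbert_le {s : Finset σ} {L : Finset (σ →₀ ℕ)} (hL : ∀ f ∈ L, f.support ⊆ s) (t : ℕ) :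
    hilbert s L t ≤ Nat.multichoose s.card t :=
  card_le_multichoose (filter_sum_subset_finsuppAntidiag hL t)

/-- The minimal monomials outside a down-closed set `L` of monomials are bounded in terms of the
Hilbert function of `L`. -/
theorem card_corners_le {s : Finset σ} {L C : Finset (σ →₀ ℕ)} {d : ℕ}
    (hL : ∀ f ∈ L, f.support ⊆ s) (hdown : ∀ f ∈ L, ∀ g ≤ f, g ∈ L) (h0 : 0 ∈ L)
    (hd : ∀ f ∈ L, ∑ i ∈ s, f i < d) (hC : ∀ c ∈ C, c.support ⊆ s) (hCL : Disjoint C L)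
    (hCc : ∀ c ∈ C, ∀ i, c i ≠ 0 → c - single i 1 ∈ L) :
    C.card ≤ 1 + ∑ t ∈ Finset.range d, lexGain t s.card (hilbert s L t) := by
  have hsub : ∀ f : σ →₀ ℕ, f.support ⊆ s → ∀ i, f i ≠ 0 → ∀ t, ∑ j ∈ s, f j = t + 1 →
      ∑ j ∈ s, (f - single i 1 : σ →₀ ℕ) j = t := fun f hf i hi t ht =>
    (Finset.mem_finsuppAntidiag.mp (sub_single_mem_finsuppAntidiag
      (Finset.mem_finsuppAntidiag.mpr ⟨ht, hf⟩) hi)).1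
  have hstep : ∀ t, hilbert s C (t + 1) + hilbert s L (t + 1) ≤
      hilbert s L t + lexGain t s.card (hilbert s L t) := by
    intro t
    rw [hilbert, hilbert, ← Finset.card_union_of_disjoint
      (Finset.disjoint_filter_filter hCL)]
    refine card_le_card_add_lexGain (filter_sum_subset_finsuppAntidiag hL t)
      (Finset.union_subset (filter_sum_subset_finsuppAntidiag hC _)
        (filter_sum_subset_finsuppAntidiag hL _)) fun v hv i hi => ?_
    rw [← Finset.filter_union, Finset.mem_filter, Finset.mem_union] at hv
    rw [Finset.mem_filter]
    rcases hv with ⟨hv | hv, hvt⟩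
    · exact ⟨hCc v hv i hi, hsub v (hC v hv) i hi t hvt⟩
    · exact ⟨hdown v hv _ tsub_le_self, hsub v (hL v hv) i hi t hvt⟩
  have hCcard : ∑ t ∈ Finset.range d, hilbert s C (t + 1) = C.card := by
    have hpos : ∀ c ∈ C, 0 < ∑ i ∈ s, c i ∧ ∑ i ∈ s, c i < d + 1 := by
      intro c hc
      have hc0 : c ≠ 0 := by
        rintro rfl
        exact Finset.disjoint_left.mp hCL hc h0
      obtain ⟨i, hi⟩ := Finsupp.ne_iff.mp hc0
      have his : i ∈ s := hC c hc (mem_support_iff.mpr hi)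
      have h1 : c i ≤ ∑ j ∈ s, c j := Finset.single_le_sum (fun _ _ => Nat.zero_le _) his
      have hci : c i ≠ 0 := hi
      obtain ⟨t, ht⟩ := Nat.exists_eq_add_of_le' (show 1 ≤ ∑ j ∈ s, c j by omega)
      have h2 := hsub c (hC c hc) i hi t ht
      have h3 := hd _ (hCc c hc i hi)
      omega
    have h1 := sum_hilbert (d := d + 1) fun c hc => (hpos c hc).2
    rw [Finset.sum_range_succ'] at h1
    have h2 : hilbert s C 0 = 0 := by
      rw [hilbert, Finset.card_eq_zero, Finset.filter_eq_empty_iff]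
      exact fun c hc => (hpos c hc).1.ne'
    omega
  have h1 := Finset.sum_le_sum fun t (_ : t ∈ Finset.range d) => hstep t
  rw [Finset.sum_add_distrib, Finset.sum_add_distrib, hCcard] at h1
  have h2 := Finset.sum_range_succ' (hilbert s L) d
  rw [Finset.sum_range_succ] at h2
  have h3 : hilbert s L 0 ≤ 1 := by simpa using hilbert_le hL 0
  omega

theorem multichoose_le_hilbert_iff {s : Finset σ} {L : Finset (σ →₀ ℕ)}
    (hL : ∀ f ∈ L, f.support ⊆ s) {t : ℕ} :
    Nat.multichoose s.card t ≤ hilbert s L t ↔ s.finsuppAntidiag t ⊆ L := by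
  rw [← Finset.card_finsuppAntidiag_nat_eq_multichoose]
  refine ⟨fun h => ?_, fun h => Finset.card_le_card fun f hf => ?_⟩
  · rw [← Finset.eq_of_subset_of_card_le (filter_sum_subset_finsuppAntidiag hL t) h]
    exact Finset.filter_subset _ _
  · exact Finset.mem_filter.mpr ⟨h hf, (Finset.mem_finsuppAntidiag.mp hf).1⟩

theorem hilbert_lt_of_le {s : Finset σ} {L : Finset (σ →₀ ℕ)} (hs : s.Nonempty)
    (hL : ∀ f ∈ L, f.support ⊆ s) (hdown : ∀ f ∈ L, ∀ g ≤ f, g ∈ L) {t t' : ℕ} (htt' : t ≤ t')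
    (h : hilbert s L t < Nat.multichoose s.card t) :
    hilbert s L t' < Nat.multichoose s.card t' := by
  induction t', htt' using Nat.le_induction with
  | base => exact h
  | succ t' _ ih =>
    contrapose! ih
    rw [multichoose_le_hilbert_iff hL] at ih ⊢
    obtain ⟨j, hj⟩ := hs
    intro f hf
    refine hdown (f + single j 1) (ih ?_) f (le_self_add)
    rw [Finset.mem_finsuppAntidiag] at hf ⊢
    refine ⟨?_, support_add.trans (Finset.union_subset hf.2 ?_)⟩
    · simp only [coe_add, Pi.add_apply, Finset.sum_add_distrib]
      rw [← hf.1, Finset.sum_eq_single_of_mem j hj fun i _ hi => single_eq_of_ne hi,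
        single_eq_same]
    · exact support_single_subset.trans (Finset.singleton_subset_iff.mpr hj)

end Monomials

theorem one_add_sum_lexGain_lt_mathcalC {n d k : ℕ} {h : ℕ → ℕ}
    (hh : ∀ i, h i ≤ Nat.multichoose (n + 1) i)
    (hk : ∀ i, k ≤ i → h i < Nat.multichoose (n + 1) i)
    (hsum : Nat.choose (n + 1 + k) k ≤ ∑ i ∈ Finset.range d, h i) :
    1 + ∑ i ∈ Finset.range d, lexGain i (n + 1) (h i) <
      mathcalC (n + 1) (∑ i ∈ Finset.range d, h i) := by
  have h1 : Nat.choose (n + 1 + k) k = Nat.multichoose (n + 1 + 1) k := by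
    rw [Nat.multichoose_eq]; congr 1; omega
  rw [h1] at hsum
  have h2 := sum_lexGain_lt_lexFill (n := n) (d := d) (t := 0) (k := k) (h := h)
    (by simpa using hh) (by simpa using hk)
    (by simpa only [Nat.zero_add, sum_multichoose] using hsum)
  have h3 := one_add_lexFill_le_mathcalC (n := n) d
    ((multichoose_succ_pos (n + 1) k).trans_le hsum)
  simp only [Nat.zero_add] at h2
  omega

section Normal

open Finsupp

variable {σ : Type*} {φ : (σ →₀ ℕ) →+ ℕ}

theorem map_mono_of_le {a b : σ →₀ ℕ} (h : a ≤ b) : φ a ≤ φ b := by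
  rw [← tsub_add_cancel_of_le h, map_add]
  exact Nat.le_add_left _ _

theorem apply_le_map (hφ : ∀ i, 0 < φ (single i 1)) (a : σ →₀ ℕ) (i : σ) : a i ≤ φ a := by
  have h1 : φ (single i (a i)) ≤ φ a := map_mono_of_le (single_le_iff.mpr le_rfl)
  rw [← mul_one (a i), ← smul_eq_mul, ← smul_single, map_nsmul, smul_eq_mul] at h1
  exact (Nat.le_mul_of_pos_right _ (hφ i)).trans h1

theorem finite_fiber [Finite σ] (hφ : ∀ i, 0 < φ (single i 1)) (w : ℕ) : {a | φ a = w}.Finite := by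
  classical
  refine (Set.finite_Iic (equivFunOnFinite.symm fun _ : σ => w)).subset fun a ha i => ?_
  have : φ a = w := ha
  simpa [this] using apply_le_map hφ a i

theorem map_eq_map_erase_add (a : σ →₀ ℕ) (o : σ) :
    φ a = φ (a.erase o) + a o * φ (single o 1) := by
  conv_lhs => rw [← erase_add_single o a, map_add]
  rw [← smul_eq_mul, ← map_nsmul, smul_single, smul_eq_mul, mul_one]

theorem natCast_map_erase {m : ℕ} {o : σ} (hm : φ (single o 1) = m) (a : σ →₀ ℕ) :
    (φ (a.erase o) : ZMod m) = φ a := by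
  rw [map_eq_map_erase_add a o, hm]
  simp

variable [LinearOrder σ]

/-- A monomial is normal if it is the lexicographically largest one in its fibre. -/
def IsNormal (φ : (σ →₀ ℕ) →+ ℕ) (a : σ →₀ ℕ) : Prop :=
  ∀ b, φ b = φ a → toLex b ≤ toLex a

/-- The minimal monomials that are not normal. -/
def IsMinNonnormal (φ : (σ →₀ ℕ) →+ ℕ) (c : σ →₀ ℕ) : Prop :=
  ¬ IsNormal φ c ∧ ∀ i, c i ≠ 0 → IsNormal φ (c - single i 1)

theorem exists_isNormal [Finite σ] (hφ : ∀ i, 0 < φ (single i 1)) (a : σ →₀ ℕ) :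
    ∃ b, φ b = φ a ∧ IsNormal φ b := by
  obtain ⟨b, hb, hmax⟩ :=
    Set.exists_max_image {b | φ b = φ a} toLex (finite_fiber hφ (φ a)) ⟨a, rfl⟩
  exact ⟨b, hb, fun c hc => hmax c (hc.trans hb)⟩

theorem IsNormal.eq {a b : σ →₀ ℕ} (ha : IsNormal φ a) (hb : IsNormal φ b) (h : φ a = φ b) :
    a = b :=
  toLex.injective (le_antisymm (hb a h) (ha b h.symm))

theorem IsNormal.of_le {a b : σ →₀ ℕ} (ha : IsNormal φ a) (hba : b ≤ a) : IsNormal φ b := by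
  intro c hc
  have h1 := ha (c + (a - b)) (by rw [map_add, hc, ← map_add, add_tsub_cancel_of_le hba])
  nth_rewrite 2 [← add_tsub_cancel_of_le hba] at h1
  rw [toLex_add, toLex_add] at h1
  exact le_of_add_le_add_right h1

theorem toLex_lt_of_bot_lt {o : σ} (ho : ∀ i, o ≤ i) {a b : σ →₀ ℕ} (h : a o < b o) :
    toLex a < toLex b :=
  Finsupp.Lex.lt_iff.mpr ⟨o, fun j hj => absurd hj (ho j).not_gt, h⟩

theorem IsNormal.add_single_bot {o : σ} (ho : ∀ i, o ≤ i) {a : σ →₀ ℕ} (ha : IsNormal φ a) :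
    IsNormal φ (a + single o 1) := by
  intro b hb
  by_cases hbo : b o = 0
  · exact (toLex_lt_of_bot_lt ho (by simp [hbo])).le
  · rw [← tsub_add_cancel_of_le (single_one_le hbo)] at hb ⊢
    rw [map_add, map_add, Nat.add_right_cancel_iff] at hb
    rw [toLex_add, toLex_add]
    exact add_le_add_left (ha _ hb) _

theorem IsMinNonnormal.apply_bot {o : σ} (ho : ∀ i, o ≤ i) {c : σ →₀ ℕ} (hc : IsMinNonnormal φ c) :
    c o = 0 := by
  by_contra h
  have h1 := (hc.2 o h).add_single_bot ho
  rw [tsub_add_cancel_of_le (single_one_le h)] at h1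
  exact hc.1 h1

theorem exists_isMinNonnormal_le {b : σ →₀ ℕ} (hb : ¬ IsNormal φ b) :
    ∃ c ≤ b, IsMinNonnormal φ c := by
  obtain ⟨c, hcb, hc⟩ := exists_minimal_le_of_wellFoundedLT (fun c => ¬ IsNormal φ c) b hb
  refine ⟨c, hcb, hc.prop, fun i hi => ?_⟩
  by_contra h
  have h1 := hc.le_of_le h tsub_le_self i
  simp at h1
  omega

theorem addConGen_eq_ker [Finite σ] (hφ : ∀ i, 0 < φ (single i 1))
    {R : Set ((σ →₀ ℕ) × (σ →₀ ℕ))} (hR : ∀ p ∈ R, φ p.1 = φ p.2)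
    (hcorner : ∀ c, IsMinNonnormal φ c → ∃ b, IsNormal φ b ∧ (c, b) ∈ R) :
    addConGen (fun a b => (a, b) ∈ R) = AddCon.ker φ := by
  refine le_antisymm (AddCon.addConGen_le.mpr fun a b h => hR _ h) fun {a a'} haa' => ?_
  have hle : addConGen (fun a b => (a, b) ∈ R) ≤ AddCon.ker φ :=
    AddCon.addConGen_le.mpr fun a b h => hR _ h
  have key : ∀ a, ∃ b, IsNormal φ b ∧ addConGen (fun a b => (a, b) ∈ R) a b := by
    intro a
    obtain ⟨b, hb, hmax⟩ := Set.exists_max_image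
      {b | addConGen (fun a b => (a, b) ∈ R) a b} toLex
      ((finite_fiber hφ (φ a)).subset fun b hb => (hle hb).symm) ⟨a, AddCon.refl _ a⟩
    refine ⟨b, ?_, hb⟩
    by_contra hbn
    obtain ⟨c, hcb, hc⟩ := exists_isMinNonnormal_le hbn
    obtain ⟨n, hn, hcn⟩ := hcorner c hc
    have h1 : addConGen (fun a b => (a, b) ∈ R) a (n + (b - c)) := by
      refine AddCon.trans _ hb ?_
      have h2 := AddCon.add (addConGen fun a b => (a, b) ∈ R)
        (AddConGen.Rel.of _ _ hcn) (AddCon.refl _ (b - c))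
      rwa [add_tsub_cancel_of_le hcb] at h2
    have h2 := hmax _ h1
    nth_rewrite 2 [← add_tsub_cancel_of_le hcb] at h2
    rw [toLex_add, toLex_add] at h2
    have h3 := le_antisymm (le_of_add_le_add_right h2) (hn c (hR _ hcn))
    exact hc.1 (toLex.injective h3 ▸ hn)
  obtain ⟨b, hb, hab⟩ := key a
  obtain ⟨b', hb', hab'⟩ := key a'
  have h1 : φ a = φ b := hle hab
  have h2 : φ a' = φ b' := hle hab'
  have h3 : φ a = φ a' := haa'
  obtain rfl : b = b' := hb.eq hb' (by rw [← h1, ← h2, h3])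
  exact AddCon.trans _ hab (AddCon.symm _ hab')

/-- The normal monomials that do not involve the variable `o`. -/
def normalSet (φ : (σ →₀ ℕ) →+ ℕ) (o : σ) : Set (σ →₀ ℕ) :=
  {a | IsNormal φ a ∧ a o = 0}

theorem eq_of_map_eq_add_mul {m : ℕ} {o : σ} (ho : ∀ i, o ≤ i) (hm : φ (single o 1) = m)
    {a b : σ →₀ ℕ} (ha : a ∈ normalSet φ o) (hb : b ∈ normalSet φ o) {q : ℕ}
    (h : φ b = φ a + q * m) : a = b := by
  have h1 := hb.1 (a + q • single o 1) (by rw [map_add, map_nsmul, hm, smul_eq_mul, h])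
  have hq : q = 0 := by
    by_contra hq
    refine (toLex_lt_of_bot_lt ho ?_).not_ge h1
    simp [ha.2, hb.2]
    omega
  exact ha.1.eq hb.1 (by simp [h, hq])

theorem normalSet_injOn {m : ℕ} {o : σ} (ho : ∀ i, o ≤ i) (hm : φ (single o 1) = m) :
    Set.InjOn (fun a => (φ a : ZMod m)) (normalSet φ o) := by
  intro a ha b hb hab
  wlog hle : φ a ≤ φ b generalizing a b
  · exact (this hb ha hab.symm (not_le.mp hle).le).symm
  obtain ⟨q, hq⟩ := (Nat.modEq_iff_dvd' hle).mp ((ZMod.natCast_eq_natCast_iff _ _ _).mp hab)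
  exact eq_of_map_eq_add_mul ho hm ha hb (q := q) (by rw [mul_comm]; omega)

theorem normalSet_finite {m : ℕ} [NeZero m] {o : σ} (ho : ∀ i, o ≤ i)
    (hm : φ (single o 1) = m) : (normalSet φ o).Finite :=
  Set.Finite.of_finite_image (Set.toFinite _) (normalSet_injOn ho hm)

theorem ncard_normalSet [Finite σ] (hφ : ∀ i, 0 < φ (single i 1)) {m : ℕ} {o : σ}
    (ho : ∀ i, o ≤ i) (hm : φ (single o 1) = m)
    (hsurj : ∀ r : ZMod m, ∃ a, (φ a : ZMod m) = r) : (normalSet φ o).ncard = m := by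
  rw [← (normalSet_injOn ho hm).ncard_image]
  suffices h : (fun a => (φ a : ZMod m)) '' normalSet φ o = Set.univ by
    rw [h, Set.ncard_univ, Nat.card_zmod]
  refine Set.eq_univ_of_forall fun r => ?_
  obtain ⟨a, rfl⟩ := hsurj r
  obtain ⟨b, hb, hbn⟩ := exists_isNormal hφ a
  refine ⟨b.erase o, ⟨hbn.of_le ?_, erase_same⟩, ?_⟩
  · conv_rhs => rw [← erase_add_single o b]
    exact le_self_add
  · simp only [natCast_map_erase hm, hb]

/-- If all monomials of degree `k + 1` avoiding `o` are normal, then `m` is large. -/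
theorem le_of_forall_isNormal [Fintype σ] {m k : ℕ} [NeZero m] {o j : σ} (ho : ∀ i, o ≤ i)
    (hj : j ≠ o) (hm : φ (single o 1) = m)
    (hall : ∀ a ∈ (Finset.univ.erase o).finsuppAntidiag (k + 1), IsNormal φ a) :
    Nat.multichoose (Fintype.card σ) k +
      (Fintype.card σ - 1) * Nat.multichoose (Fintype.card σ - 1) k ≤ m := by
  have hsum : ∀ a : σ →₀ ℕ, ∑ i, a i = ∑ i ∈ Finset.univ.erase o, a.erase o i + a o := by
    intro a
    rw [← Finset.sum_erase_add _ _ (Finset.mem_univ o)]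
    congr 1
    exact Finset.sum_congr rfl fun i hi => (erase_ne (Finset.ne_of_mem_erase hi)).symm
  have hmem : ∀ a ∈ Finset.univ.finsuppAntidiag (k + 1), a.erase o ∈ normalSet φ o := by
    intro a ha
    refine ⟨(hall (a.erase o + single j (a o)) ?_).of_le le_self_add, erase_same⟩
    rw [Finset.mem_finsuppAntidiag] at ha ⊢
    refine ⟨?_, fun i hi => ?_⟩
    · have h1 : ∑ i ∈ Finset.univ.erase o, (single j (a o)) i = a o := by
        rw [Finset.sum_eq_single_of_mem j (by simp [hj]) fun i _ hi => single_eq_of_ne hi,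
          single_eq_same]
      have h2 := hsum a
      have h3 : ∑ i, a i = k + 1 := ha.1
      simp only [coe_add, Pi.add_apply, Finset.sum_add_distrib, h1]
      omega
    · rw [Finset.mem_erase]
      refine ⟨?_, Finset.mem_univ i⟩
      rintro rfl
      simp [hj.symm] at hi
  have hinj : ∀ a ∈ Finset.univ.finsuppAntidiag (k + 1),
      ∀ b ∈ Finset.univ.finsuppAntidiag (k + 1), (φ a : ZMod m) = φ b → a = b := by
    intro a ha b hb hab
    have h1 : a.erase o = b.erase o := normalSet_injOn ho hm (hmem a ha) (hmem b hb) (by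
      simpa only [natCast_map_erase hm] using hab)
    have h2 := hsum a
    have h3 := hsum b
    have ha' : ∑ i, a i = k + 1 := (Finset.mem_finsuppAntidiag.mp ha).1
    have hb' : ∑ i, b i = k + 1 := (Finset.mem_finsuppAntidiag.mp hb).1
    rw [← erase_add_single o a, ← erase_add_single o b, h1]
    rw [h1] at h2
    congr 2
    omega
  have hadd : ∀ (a : σ →₀ ℕ) (i : σ) (s : Finset σ), a ∈ s.finsuppAntidiag k →
      a + single i 1 ∈ Finset.univ.finsuppAntidiag (k + 1) := by
    intro a i s ha
    rw [Finset.mem_finsuppAntidiag] at ha ⊢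
    refine ⟨?_, Finset.subset_univ _⟩
    simp only [coe_add, Pi.add_apply, Finset.sum_add_distrib]
    rw [← ha.1, Finset.sum_subset (Finset.subset_univ s) fun i _ hi =>
      notMem_support_iff.mp fun h => hi (ha.2 h),
      Finset.sum_eq_single_of_mem i (Finset.mem_univ i) fun i _ hi => single_eq_of_ne hi,
      single_eq_same]
  have hcast : ∀ (a : σ →₀ ℕ) (i : σ),
      (φ (a + single i 1) : ZMod m) = φ a + φ (single i 1) := by
    intro a i; rw [map_add, Nat.cast_add]
  have ho0 : (φ (single o 1) : ZMod m) = 0 := by rw [hm]; simp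
  let T : Finset (Σ _ : σ, σ →₀ ℕ) :=
    (Finset.univ.erase o).sigma fun i => (Finset.univ.erase i).finsuppAntidiag k
  let f : (Σ _ : σ, σ →₀ ℕ) → ZMod m := fun p => φ p.2 - φ (single p.1 1)
  have hT : ∀ p ∈ T, p.1 ≠ o ∧ p.2 ∈ (Finset.univ.erase p.1).finsuppAntidiag k := by
    intro p hp
    simpa [T] using hp
  have hzero : ∀ p ∈ T, p.2 p.1 = 0 := by
    intro p hp
    by_contra h
    exact Finset.notMem_erase p.1 Finset.univ
      ((Finset.mem_finsuppAntidiag.mp (hT p hp).2).2 (mem_support_iff.mpr h))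
  have hcard₁ : ((Finset.univ.finsuppAntidiag k).image fun a => (φ a : ZMod m)).card =
      Nat.multichoose (Fintype.card σ) k := by
    rw [Finset.card_image_of_injOn, Finset.card_finsuppAntidiag_nat_eq_multichoose,
      Finset.card_univ]
    intro a ha b hb hab
    refine add_right_cancel (hinj _ (hadd a o _ ha) _ (hadd b o _ hb) ?_)
    rw [hcast, hcast]
    exact congrArg (· + _) hab
  have hcard₂ : (T.image f).card =
      (Fintype.card σ - 1) * Nat.multichoose (Fintype.card σ - 1) k := by
    rw [Finset.card_image_of_injOn, Finset.card_sigma]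
    · simp [Finset.card_finsuppAntidiag_nat_eq_multichoose, Finset.card_erase_of_mem]
    · rintro ⟨i, a⟩ hp ⟨i', a'⟩ hp' h
      have h1 : a + single i' 1 = a' + single i 1 := by
        refine hinj _ (hadd a i' _ (hT _ hp).2) _ (hadd a' i _ (hT _ hp').2) ?_
        rw [hcast, hcast]
        linear_combination h
      have h2 : i = i' := by
        by_contra hne
        have h3 := DFunLike.congr_fun h1 i
        have h4 : a i = 0 := hzero _ hp
        simp [h4, hne] at h3
      subst h2
      rw [add_right_cancel h1]
  have hdisj : Disjoint ((Finset.univ.finsuppAntidiag k).image fun a => (φ a : ZMod m))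
      (T.image f) := by
    rw [Finset.disjoint_left]
    intro r hr hr'
    obtain ⟨a, ha, rfl⟩ := Finset.mem_image.mp hr
    obtain ⟨p, hp, hpa⟩ := Finset.mem_image.mp hr'
    have h1 : p.2 + single o 1 = a + single p.1 1 := by
      refine hinj _ (hadd _ o _ (hT p hp).2) _ (hadd a p.1 _ ha) ?_
      rw [hcast, hcast, ho0]
      linear_combination hpa
    have h3 := DFunLike.congr_fun h1 p.1
    simp [hzero p hp, (hT p hp).1] at h3
  have h := Finset.card_le_univ (((Finset.univ.finsuppAntidiag k).image
    fun a => (φ a : ZMod m)) ∪ T.image f)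
  rwa [Finset.card_union_of_disjoint hdisj, hcard₁, hcard₂, ZMod.card] at h

theorem finite_setOf_isMinNonnormal [Finite σ] (hφ : ∀ i, 0 < φ (single i 1)) {m : ℕ} [NeZero m]
    {o : σ} (ho : ∀ i, o ≤ i) (hm : φ (single o 1) = m) :
    {c | IsMinNonnormal φ c}.Finite := by
  refine (Set.finite_iUnion fun i =>
    (normalSet_finite ho hm).image (· + single i 1)).subset fun c hc => ?_
  have hc0 : c ≠ 0 := by
    rintro rfl
    obtain ⟨b, -, hb⟩ := exists_isNormal hφ 0
    exact hc.1 (hb.of_le zero_le)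
  obtain ⟨i, hi⟩ := Finsupp.ne_iff.mp hc0
  refine Set.mem_iUnion.mpr ⟨i, c - single i 1, ⟨hc.2 i hi, ?_⟩,
    tsub_add_cancel_of_le (single_one_le hi)⟩
  rw [tsub_apply, hc.apply_bot ho, Nat.zero_sub]

theorem ncard_isMinNonnormal_lt_mathcalC [Fintype σ] (hφ : ∀ i, 0 < φ (single i 1))
    {m n k : ℕ} {o : σ} (ho : ∀ i, o ≤ i) (hm : φ (single o 1) = m)
    (hsurj : ∀ r : ZMod m, ∃ a, (φ a : ZMod m) = r) (hcard : Fintype.card σ = n + 1 + 1)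
    (h1 : Nat.choose (n + 1 + (k + 1)) (k + 1) ≤ m)
    (h2 : m < Nat.multichoose (n + 1 + 1) k + (n + 1) * Nat.multichoose (n + 1) k) :
    {c | IsMinNonnormal φ c}.ncard < mathcalC (n + 1) m := by
  have : NeZero m := ⟨by
    have := Nat.choose_pos (n := n + 1 + (k + 1)) (k := k + 1) (by omega)
    omega⟩
  have hfin := normalSet_finite ho hm
  have hCfin := finite_setOf_isMinNonnormal hφ ho hm
  set s : Finset σ := Finset.univ.erase o with hs
  have hsc : s.card = n + 1 := by simp [hs, Finset.card_erase_of_mem, hcard]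
  have hsupp : ∀ f : σ →₀ ℕ, f o = 0 → f.support ⊆ s := fun f hf i hi => by
    refine Finset.mem_erase.mpr ⟨?_, Finset.mem_univ i⟩
    rintro rfl
    exact mem_support_iff.mp hi hf
  have hLs : ∀ f ∈ hfin.toFinset, f.support ⊆ s := fun f hf =>
    hsupp f (hfin.mem_toFinset.mp hf).2
  have hdown : ∀ f ∈ hfin.toFinset, ∀ g ≤ f, g ∈ hfin.toFinset := fun f hf g hgf => by
    rw [hfin.mem_toFinset] at hf ⊢
    exact ⟨hf.1.of_le hgf, Nat.le_zero.mp ((hgf o).trans hf.2.le)⟩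
  have hLcard : hfin.toFinset.card = m := by
    rw [← Set.ncard_eq_toFinset_card _ hfin, ncard_normalSet hφ ho hm hsurj]
  have h0 : 0 ∈ hfin.toFinset := by
    obtain ⟨f, hf⟩ := Finset.card_pos.mp (hLcard ▸ Nat.pos_of_neZero m)
    exact hdown f hf 0 zero_le
  obtain ⟨d, hd⟩ : ∃ d, ∀ f ∈ hfin.toFinset, ∑ i ∈ s, f i < d :=
    ⟨_, fun f hf => Nat.lt_succ_of_le
      (Finset.le_sup (f := fun f : σ →₀ ℕ => ∑ i ∈ s, f i) hf)⟩
  have hC := card_corners_le (C := hCfin.toFinset) hLs hdown h0 hd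
    (fun c hc => hsupp c ((hCfin.mem_toFinset.mp hc).apply_bot ho))
    (Finset.disjoint_left.mpr fun c hc hc' =>
      (hCfin.mem_toFinset.mp hc).1 (hfin.mem_toFinset.mp hc').1)
    (fun c hc i hi => by
      rw [hCfin.mem_toFinset] at hc
      rw [hfin.mem_toFinset]
      exact ⟨hc.2 i hi, by rw [tsub_apply, hc.apply_bot ho, Nat.zero_sub]⟩)
  have hsne : s.Nonempty := Finset.card_pos.mp (by omega)
  have hk : hilbert s hfin.toFinset (k + 1) < Nat.multichoose s.card (k + 1) := by
    by_contra! hge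
    rw [multichoose_le_hilbert_iff hLs] at hge
    obtain ⟨j, hj⟩ := hsne
    have := le_of_forall_isNormal ho (Finset.ne_of_mem_erase hj) hm
      fun a ha => (hfin.mem_toFinset.mp (hge ha)).1
    rw [hcard, Nat.add_sub_cancel] at this
    omega
  rw [hsc] at hC
  have h3 := one_add_sum_lexGain_lt_mathcalC (n := n) (d := d) (k := k + 1)
    (h := hilbert s hfin.toFinset) (fun i => hsc ▸ hilbert_le hLs i)
    (fun i hi => hsc ▸ hilbert_lt_of_le hsne hLs hdown hi hk)
    (by rwa [sum_hilbert hd, hLcard])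
  rw [sum_hilbert hd, hLcard] at h3
  rw [Set.ncard_eq_toFinset_card _ hCfin]
  omega

end Normal

theorem factorizationHom_single (Γ : AddSubmonoid ℕ) (g : minGens Γ) :
    factorizationHom Γ (Finsupp.single g 1) = g := by
  simp [factorizationHom]

theorem exists_factorizationHom_eq {Γ : AddSubmonoid ℕ} {g : ℕ} (hg : g ∈ Γ) :
    ∃ a, factorizationHom Γ a = g := by
  induction g using Nat.strong_induction_on with
  | _ g ih =>
    by_cases hmin : g ∈ minGens Γ
    · exact ⟨_, factorizationHom_single Γ ⟨g, hmin⟩⟩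
    by_cases h0 : g = 0
    · exact ⟨0, by rw [map_zero, h0]⟩
    obtain ⟨a, ha, b, hb, ha0, hb0, rfl⟩ :
        ∃ a ∈ Γ, ∃ b ∈ Γ, a ≠ 0 ∧ b ≠ 0 ∧ g = a + b := by
      by_contra! h
      exact hmin ⟨hg, h0, h⟩
    obtain ⟨x, hx⟩ := ih a (by omega) ha
    obtain ⟨y, hy⟩ := ih b (by omega) hb
    exact ⟨x + y, by rw [map_add, hx, hy]⟩

theorem IsNumericalMonoid.exists_natCast_eq {Γ : AddSubmonoid ℕ} (hΓ : IsNumericalMonoid Γ)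
    {m : ℕ} [NeZero m] (r : ZMod m) : ∃ g ∈ Γ, (g : ZMod m) = r := by
  obtain ⟨N, hN⟩ := hΓ.bddAbove
  refine ⟨r.val + m * (N + 1), ?_, by simp⟩
  by_contra h
  have h1 : r.val + m * (N + 1) ≤ N := hN h
  have h2 := Nat.le_mul_of_pos_left (N + 1) (Nat.pos_of_neZero m)
  omega

theorem mult_le {Γ : AddSubmonoid ℕ} {g : ℕ} (hg : g ∈ Γ) (h0 : g ≠ 0) : mult Γ ≤ g :=
  Nat.sInf_le ⟨hg, h0⟩

theorem mult_mem_minGens {Γ : AddSubmonoid ℕ} (h : mult Γ ≠ 0) : mult Γ ∈ minGens Γ := by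
  obtain ⟨hmem, -⟩ := Nat.sInf_mem (Nat.nonempty_of_sInf_eq_succ
    (Nat.succ_pred_eq_of_ne_zero h).symm : {g : ℕ | g ∈ Γ ∧ g ≠ 0}.Nonempty)
  refine ⟨hmem, h, fun a ha b hb ha0 hb0 hab => ?_⟩
  have := mult_le ha ha0
  omega

theorem rho_le_ncard_isMinNonnormal {Γ : AddSubmonoid ℕ} [Finite (minGens Γ)]
    (hfin : {c | IsMinNonnormal (factorizationHom Γ) c}.Finite) :
    rho Γ ≤ {c | IsMinNonnormal (factorizationHom Γ) c}.ncard := by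
  have hφ : ∀ i, 0 < factorizationHom Γ (Finsupp.single i 1) := fun i => by
    rw [factorizationHom_single]
    exact Nat.pos_of_ne_zero i.2.2.1
  choose nf hnf hnormal using exists_isNormal hφ
  refine le_trans (Nat.sInf_le ⟨(fun c => (c, nf c)) '' _, hfin.image _, rfl, ?_⟩)
    (Set.ncard_image_le hfin)
  refine addConGen_eq_ker hφ ?_ fun c hc => ⟨nf c, hnormal c, c, hc, rfl⟩
  rintro _ ⟨c, -, rfl⟩
  exact (hnf c).symm

/-- If C(e+k,k) ≤ m ≤ C(e+k-1,k-1) + e·C(e+k-2,k-1) - 1 for some k ≥ 2,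
then 𝒭(e,m) < 𝒞(e,m). -/
theorem rho_lt_C_of_range (e k m : ℕ) (he : 2 ≤ e) (hk : 2 ≤ k)
    (h1 : Nat.choose (e + k) k ≤ m)
    (h2 : m ≤ Nat.choose (e + k - 1) (k - 1) + e * Nat.choose (e + k - 2) (k - 1) - 1)
    (Γ : AddSubmonoid ℕ) (hΓ : IsNumericalMonoid Γ)
    (hedim : edim Γ = e + 1) (hmult : mult Γ = m) :
    rho Γ < mathcalC e m := by
  have hm0 : 0 < m := (Nat.choose_pos (Nat.le_add_left k e)).trans_le h1
  obtain ⟨n, rfl⟩ := Nat.exists_eq_add_of_le' (show 1 ≤ e by omega)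
  obtain ⟨k, rfl⟩ := Nat.exists_eq_add_of_le' (show 1 ≤ k by omega)
  have : NeZero m := ⟨hm0.ne'⟩
  have hfinite : (minGens Γ).Finite :=
    Set.finite_of_ncard_ne_zero (by rw [show (minGens Γ).ncard = _ from hedim]; omega)
  have := hfinite.fintype
  have hφ : ∀ i, 0 < factorizationHom Γ (Finsupp.single i 1) := fun i => by
    rw [factorizationHom_single]
    exact Nat.pos_of_ne_zero i.2.2.1
  let o : minGens Γ := ⟨mult Γ, mult_mem_minGens (by omega)⟩
  have ho : ∀ i, o ≤ i := fun i => mult_le i.2.1 i.2.2.1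
  have hm : factorizationHom Γ (Finsupp.single o 1) = m := by
    rw [factorizationHom_single]
    exact hmult
  refine (rho_le_ncard_isMinNonnormal (finite_setOf_isMinNonnormal hφ ho hm)).trans_lt
    (ncard_isMinNonnormal_lt_mathcalC (k := k) hφ ho hm (fun r => ?_) ?_ h1 ?_)
  · obtain ⟨g, hg, rfl⟩ := hΓ.exists_natCast_eq r
    obtain ⟨a, ha⟩ := exists_factorizationHom_eq hg
    exact ⟨a, by rw [ha]⟩
  · rw [← Nat.card_eq_fintype_card]
    exact hedim
  · rw [Nat.multichoose_eq, Nat.multichoose_eq]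
    have h3 : 0 < (n + 1 + 1 + k - 1).choose k := Nat.choose_pos (by omega)
    rw [show n + 1 + (k + 1) - 1 = n + 1 + 1 + k - 1 by omega,
      show n + 1 + (k + 1) - 2 = n + 1 + k - 1 by omega, Nat.add_sub_cancel] at h2
    omega
end

section
/- Let G be a finite abelian group with |G| = m, let A ⊆ G be a subset with |A| = e+1, and let k > 0 be an integer. If m < binom(e+k−1, k−1) + e·binom(e+k−2, k−1), then |kA| < binom(e+k, k), where kA = A + A + ... + A (k summands) is the k-fold sumset of A. -/
open scoped Pointwise

/-- The k-fold iterated sumset A + A + ⋯ + A (k summands) of a finset in an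
additive group. -/
def nfoldSum {G : Type*} [AddCommGroup G] [DecidableEq G] : ℕ → Finset G → Finset G
  | 0, _ => {0}
  | k + 1, A => A + nfoldSum k A

theorem card_finset_sym_eq_multichoose {α : Type*} [DecidableEq α] (s : Finset α) (n : ℕ) :
    (s.sym n).card = s.card.multichoose n := by
  have h : s = (Finset.univ : Finset s).map (Function.Embedding.subtype (· ∈ s)) := by
    ext
    simp
  calc (s.sym n).card
      = (((Finset.univ : Finset s).map (Function.Embedding.subtype (· ∈ s))).sym n).card := by
        rw [← h]
    _ = s.card.multichoose n := by
        rw [Finset.sym_map, Finset.card_map, Finset.sym_univ, Finset.card_univ,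
          Sym.card_sym_eq_multichoose, Fintype.card_coe]

theorem nfoldSum_subset_image_sym {G : Type*} [AddCommGroup G] [DecidableEq G]
    (k : ℕ) (A : Finset G) :
    nfoldSum k A ⊆ (A.sym k).image fun x : Sym G k => (x : Multiset G).sum := by
  induction k with
  | zero =>
    intro g hg
    rw [nfoldSum, Finset.mem_singleton] at hg
    exact Finset.mem_image.2 ⟨∅, by simp, hg ▸ Multiset.sum_zero⟩
  | succ k ih =>
    intro g hg
    obtain ⟨a, ha, b, hb, rfl⟩ := Finset.mem_add.1 hg
    obtain ⟨x, hx, rfl⟩ := Finset.mem_image.1 (ih hb)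
    refine Finset.mem_image.2 ⟨a ::ₛ x, ?_, by rw [Sym.coe_cons, Multiset.sum_cons]⟩
    rw [Finset.mem_sym_iff] at hx ⊢
    intro c hc
    rcases Sym.mem_cons.1 hc with rfl | h
    · exact ha
    · exact hx c h

/-- If `kA` has the maximal possible size, then sums of `k` elements of `A` determine the
multiset of summands. -/
theorem injOn_sum_of_le_card_nfoldSum {G : Type*} [AddCommGroup G] [DecidableEq G]
    (k : ℕ) (A : Finset G) (h : A.card.multichoose k ≤ (nfoldSum k A).card) :
    Set.InjOn (fun x : Sym G k => (x : Multiset G).sum) (A.sym k) := by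
  rw [← Finset.card_image_iff]
  refine le_antisymm Finset.card_image_le ?_
  rw [card_finset_sym_eq_multichoose]
  exact h.trans (Finset.card_le_card (nfoldSum_subset_image_sym k A))

/-- If sums of `n + 1` elements of `A` determine the multiset of summands, then the elements
`x₁ + ⋯ + xₙ - i`, where `i ∈ A` differs from all `xⱼ ∈ A` unless `i = a`, are distinct. -/
theorem multichoose_add_le_card_of_injOn_sum {G : Type*} [AddCommGroup G] [Fintype G]
    [DecidableEq G] (n e : ℕ) (A : Finset G) (hA : A.card = e + 1)
    (h : Set.InjOn (fun x : Sym G (n + 1) => (x : Multiset G).sum) (A.sym (n + 1))) :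
    (e + 1).multichoose n + e * e.multichoose n ≤ Fintype.card G := by
  obtain ⟨a, ha⟩ : A.Nonempty := Finset.card_pos.1 (by omega)
  let T : G → Finset G := fun i => if i = a then A else A.erase i
  have hT : ∀ i, T i ⊆ A := by
    intro i
    dsimp only [T]
    split_ifs
    · exact subset_rfl
    · exact Finset.erase_subset _ _
  have hcard : (A.sigma fun i => (T i).sym n).card =
      (e + 1).multichoose n + e * e.multichoose n := by
    rw [Finset.card_sigma, ← Finset.add_sum_erase A _ ha]
    congr 1
    · simp [T, card_finset_sym_eq_multichoose, hA]
    · rw [Finset.sum_congr rfl (g := fun _ => e.multichoose n)]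
      · simp [ha, hA]
      · intro i hi
        obtain ⟨hia, hi⟩ := Finset.mem_erase.1 hi
        simp [T, hia, card_finset_sym_eq_multichoose, Finset.card_erase_of_mem hi, hA]
  rw [← hcard]
  refine Finset.card_le_card_of_injOn
    (fun p : (_ : G) × Sym G n => (p.2 : Multiset G).sum - p.1) (by simp) ?_
  rintro ⟨i, x⟩ hp ⟨j, y⟩ hq hpq
  obtain ⟨hi, hx⟩ := Finset.mem_sigma.1 (Finset.mem_coe.1 hp)
  obtain ⟨hj, hy⟩ := Finset.mem_sigma.1 (Finset.mem_coe.1 hq)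
  dsimp only at hi hj hx hy hpq
  rw [Finset.mem_sym_iff] at hx hy
  have hcons : j ::ₛ x = i ::ₛ y := by
    refine h ?_ ?_ ?_
    · rw [Finset.mem_coe, Finset.mem_sym_iff]
      intro c hc
      rcases Sym.mem_cons.1 hc with rfl | hc
      exacts [hj, hT _ (hx c hc)]
    · rw [Finset.mem_coe, Finset.mem_sym_iff]
      intro c hc
      rcases Sym.mem_cons.1 hc with rfl | hc
      exacts [hi, hT _ (hy c hc)]
    · simp only [Sym.coe_cons, Multiset.sum_cons]
      rw [sub_eq_sub_iff_add_eq_add] at hpq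
      rw [add_comm, hpq, add_comm]
  by_cases hij : i = j
  · subst hij
    rw [Sym.cons_inj_right] at hcons
    rw [hcons]
  · exfalso
    have hix : i ∈ x := by
      have : i ∈ j ::ₛ x := hcons ▸ Sym.mem_cons_self i y
      exact (Sym.mem_cons.1 this).resolve_left hij
    have hjy : j ∈ y := by
      have : j ∈ i ::ₛ y := hcons ▸ Sym.mem_cons_self j x
      exact (Sym.mem_cons.1 this).resolve_left (Ne.symm hij)
    have hia : i = a := by
      by_contra hia
      simpa [T, hia] using hx i hix
    have hja : j = a := by
      by_contra hja
      simpa [T, hja] using hy j hjy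
    exact hij (hia.trans hja.symm)

/-- If G is abelian of order m, |A| = e + 1 and m < C(e+k-1,k-1) + e·C(e+k-2,k-1)
for some k > 0, then |kA| < C(e+k,k). -/
theorem card_nfoldSum_lt {G : Type*} [AddCommGroup G] [Fintype G] [DecidableEq G]
    (e m k : ℕ) (hG : Fintype.card G = m) (A : Finset G) (hA : A.card = e + 1)
    (hk : 0 < k)
    (hm : m < Nat.choose (e + k - 1) (k - 1) + e * Nat.choose (e + k - 2) (k - 1)) :
    (nfoldSum k A).card < Nat.choose (e + k) k := by
  obtain ⟨n, rfl⟩ : ∃ n, k = n + 1 := ⟨k - 1, by omega⟩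
  by_contra! hle
  have hchoose : (e + (n + 1)).choose (n + 1) = A.card.multichoose (n + 1) := by
    rw [hA, Nat.multichoose_eq]
    congr 1
    omega
  have hbound := multichoose_add_le_card_of_injOn_sum n e A hA
    (injOn_sum_of_le_card_nfoldSum (n + 1) A (hchoose ▸ hle))
  rw [Nat.multichoose_eq, Nat.multichoose_eq, hG,
    show e + 1 + n - 1 = e + (n + 1) - 1 by omega,
    show e + n - 1 = e + (n + 1) - 2 by omega] at hbound
  exact absurd hm (not_lt.2 hbound)
end
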